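/- Consider the independent parallel Gaussian two-level security wiretap channel consisting of L independent subchannels Y_l = √a_l·X_l + N_{1,l}, Z_{1,l} = √b_{1,l}·X_l + N_{2,l}, Z_{2,l} = √b_{2,l}·X_l + N_{3,l} with b_{1,l} ≥ b_{2,l} ≥ 0 for all l, independent standard Gaussian noises, and the average individual per-subchannel power constraints (1/n)∑_{i=1}^n (X_l[i])^2 ≤ P_l for l = 1,…,L. The secrecy capacity region of the channel is exactly the set of all nonnegative pairs (R1,R2) satisfying R1 ≤ ∑_{l=1}^L Cs(P_l,a_l,b_{1,l}) and R1 + R2 ≤ ∑_{l=1}^L Cs(P_l,a_l,b_{2,l}), where Cs(P,a,b) := [ (1/2)log(1+aP) − (1/2)log(1+bP) ]^+. -/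

import Mathlib

open MeasureTheory ProbabilityTheory
open scoped BigOperators ENNReal
noncomputable section

/-- Kullback–Leibler divergence (in bits) of `μ` from `ν`. -/
def klDivBits {Ω : Type*} [MeasurableSpace Ω] (μ ν : Measure Ω) : ℝ :=
  ∫ ω, Real.logb 2 ((μ.rnDeriv ν ω).toReal) ∂μ

/-- Mutual information (in bits) of a joint law on `α × β`: the KL divergence between the
joint law and the product of its marginals. -/
def miBits {α β : Type*} [MeasurableSpace α] [MeasurableSpace β]
    (μ : Measure (α × β)) : ℝ :=
  klDivBits μ ((μ.map Prod.fst).prod (μ.map Prod.snd))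

/-- Law of the outputs of `L` independent parallel memoryless Gaussian channels with
gains `g l` on the input sequences `xs` (time index first, subchannel index second). -/
def parOut {n L : ℕ} (g : Fin L → ℝ) (xs : Fin n → Fin L → ℝ) :
    Measure (Fin n → Fin L → ℝ) :=
  Measure.pi fun i => Measure.pi fun l => gaussianReal (Real.sqrt (g l) * xs i l) 1

/-- Joint law of the (uniform, independent) message pair and the length-`n` outputs of
the `L` independent parallel Gaussian channels with gains `g`, for the encoder `enc`. -/
def jointLawPar {n L K₁ K₂ : ℕ} (g : Fin L → ℝ)
    (enc : Fin K₁ × Fin K₂ → Measure (Fin n → Fin L → ℝ)) :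
    Measure ((Fin K₁ × Fin K₂) × (Fin n → Fin L → ℝ)) :=
  ((K₁ : ℝ≥0∞) * (K₂ : ℝ≥0∞))⁻¹ •
    Measure.sum fun m : Fin K₁ × Fin K₂ =>
      (Measure.dirac m).prod ((enc m).bind (parOut g))

/-- Achievability of `(R₁,R₂)` for the independent parallel Gaussian two-level security
wiretap channel with legitimate gains `a`, eavesdropper gains `b₁` and `b₂`, under the
input constraint described by the set `PowOK n` (the set of admissible input sequences of
blocklength `n`). -/
def ParAchievable (L : ℕ) (a b₁ b₂ : Fin L → ℝ)
    (PowOK : (n : ℕ) → Set (Fin n → Fin L → ℝ)) (R₁ R₂ : ℝ) : Prop :=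
  ∀ ε > 0, ∃ n : ℕ, 0 < n ∧ ∃ K₁ K₂ : ℕ, 0 < K₁ ∧ 0 < K₂ ∧
    (n : ℝ) * (R₁ - ε) ≤ Real.logb 2 K₁ ∧ (n : ℝ) * (R₂ - ε) ≤ Real.logb 2 K₂ ∧
    ∃ enc : Fin K₁ × Fin K₂ → Measure (Fin n → Fin L → ℝ),
      (∀ m, IsProbabilityMeasure (enc m)) ∧
      (∀ m, enc m (PowOK n) = 1) ∧
      ∃ dec : (Fin n → Fin L → ℝ) → Fin K₁ × Fin K₂, Measurable dec ∧
        (jointLawPar a enc {p | dec p.2 ≠ p.1}).toReal ≤ ε ∧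
        miBits (jointLawPar b₂ enc) ≤ (n : ℝ) * ε ∧
        miBits ((jointLawPar b₁ enc).map fun p => (p.1.1, p.2)) ≤ (n : ℝ) * ε

/-- The average individual per-subchannel power constraint `(1/n) ∑ i, (X_l[i])² ≤ P_l`. -/
def perSubPow (L : ℕ) (P : Fin L → ℝ) : (n : ℕ) → Set (Fin n → Fin L → ℝ) :=
  fun n => {xs | ∀ l, ∑ i, (xs i l) ^ 2 ≤ (n : ℝ) * P l}

/-- The average total power constraint `∑ l, (1/n) ∑ i, (X_l[i])² ≤ P`. -/
def totalPow (L : ℕ) (P : ℝ) : (n : ℕ) → Set (Fin n → Fin L → ℝ) :=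
  fun n => {xs | ∑ l, ∑ i, (xs i l) ^ 2 ≤ (n : ℝ) * P}

/-- The secrecy capacity `Cs(P,a,b)` of the scalar Gaussian wiretap channel. -/
def Cs (P a b : ℝ) : ℝ :=
  max 0 ((1 / 2) * Real.logb 2 (1 + a * P) - (1 / 2) * Real.logb 2 (1 + b * P))


section ProductTools

variable {ι : Type*} [Fintype ι] {X Y : ι → Type*}
  [∀ i, MeasurableSpace (X i)] [∀ i, MeasurableSpace (Y i)]

lemma lintegral_pi_prod (μ : ∀ i, Measure (X i)) [∀ i, IsProbabilityMeasure (μ i)]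
    (f : ∀ i, X i → ℝ≥0∞) (hf : ∀ i, Measurable (f i)) :
    ∫⁻ x, ∏ i, f i (x i) ∂(Measure.pi μ) = ∏ i, ∫⁻ x, f i x ∂(μ i) := by
  have h := lintegral_prod_eq_prod_lintegral_of_indepFun (μ := Measure.pi μ) Finset.univ
    (fun i (x : ∀ i, X i) => f i (x i)) (iIndepFun_pi (fun i => (hf i).aemeasurable))
    (fun i => (hf i).comp (measurable_pi_apply i))
  rw [h]
  refine Finset.prod_congr rfl fun i _ => ?_
  exact (measurePreserving_eval μ i).lintegral_comp (hf i)

lemma measurable_pi_measure {Z : Type*} [MeasurableSpace Z] (V : ∀ i, Z → Measure (Y i))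
    [∀ i z, IsProbabilityMeasure (V i z)] (hV : ∀ i, Measurable (V i)) :
    Measurable (fun z : Z => Measure.pi (fun i => V i z)) := by
  refine Measurable.measure_of_isPiSystem_of_isProbabilityMeasure generateFrom_pi.symm
    isPiSystem_pi ?_
  rintro _ ⟨s, hs, rfl⟩
  simp only [Measure.pi_pi]
  refine Finset.measurable_prod _ fun i _ => ?_
  exact (Measure.measurable_coe (hs i (Set.mem_univ i))).comp (hV i)

lemma pi_bind_pi (μ : ∀ i, Measure (X i)) [∀ i, IsProbabilityMeasure (μ i)]
    (V : ∀ i, X i → Measure (Y i)) [∀ i z, IsProbabilityMeasure (V i z)]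
    (hV : ∀ i, Measurable (V i)) :
    (Measure.pi μ).bind (fun x => Measure.pi (fun i => V i (x i)))
      = Measure.pi (fun i => (μ i).bind (V i)) := by
  have hp : ∀ i, IsProbabilityMeasure ((μ i).bind (V i)) := fun i =>
    isProbabilityMeasure_bind (hV i).aemeasurable (Filter.Eventually.of_forall fun z => inferInstance)
  symm
  refine Measure.pi_eq fun s hs => ?_
  have hm : Measurable (fun x : (∀ i, X i) => Measure.pi (fun i => V i (x i))) :=
    measurable_pi_measure (fun i (x : ∀ i, X i) => V i (x i)) (fun i => (hV i).comp (measurable_pi_apply i))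
  rw [Measure.bind_apply (MeasurableSet.univ_pi hs) hm.aemeasurable]
  simp only [Measure.pi_pi]
  rw [lintegral_pi_prod μ (fun i x => V i x (s i))
    (fun i => (Measure.measurable_coe (hs i)).comp (hV i))]
  refine Finset.prod_congr rfl fun i _ => ?_
  rw [Measure.bind_apply (hs i) (hV i).aemeasurable]

lemma pi_withDensity (ν : ∀ i, Measure (X i)) [∀ i, IsProbabilityMeasure (ν i)]
    (f : ∀ i, X i → ℝ≥0∞) (hf : ∀ i, Measurable (f i))
    [∀ i, IsProbabilityMeasure ((ν i).withDensity (f i))] :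
    Measure.pi (fun i => (ν i).withDensity (f i))
      = (Measure.pi ν).withDensity (fun x => ∏ i, f i (x i)) := by
  refine Measure.pi_eq fun s hs => ?_
  rw [withDensity_apply _ (MeasurableSet.univ_pi hs), ← lintegral_indicator (MeasurableSet.univ_pi hs)]
  have : ∀ x : ∀ i, X i, (Set.univ.pi s).indicator (fun x => ∏ i, f i (x i)) x
      = ∏ i, (s i).indicator (f i) (x i) := by
    intro x
    classical
    by_cases hx : x ∈ Set.univ.pi s
    · rw [Set.indicator_of_mem hx]
      exact Finset.prod_congr rfl fun i _ => (Set.indicator_of_mem (hx i (Set.mem_univ i)) _).symm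
    · rw [Set.indicator_of_notMem hx]
      simp only [Set.mem_pi, Set.mem_univ, true_implies, not_forall] at hx
      obtain ⟨i, hi⟩ := hx
      exact (Finset.prod_eq_zero (Finset.mem_univ i) (Set.indicator_of_notMem hi _)).symm
  simp_rw [this]
  rw [lintegral_pi_prod ν (fun i => (s i).indicator (f i)) (fun i => (hf i).indicator (hs i))]
  refine Finset.prod_congr rfl fun i _ => ?_
  rw [withDensity_apply _ (hs i), lintegral_indicator (hs i)]

end ProductTools

section KLTools
open InformationTheory

lemma klDiv_map_equiv {α β : Type*} [MeasurableSpace α] [MeasurableSpace β]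
    (μ ν : Measure α) [IsFiniteMeasure μ] [IsFiniteMeasure ν] (e : α ≃ᵐ β) :
    klDiv (μ.map e) (ν.map e) = klDiv μ ν := by
  refine le_antisymm (klDiv_map_le _ _ e.measurable) ?_
  have h := klDiv_map_le (μ.map e) (ν.map e) e.symm.measurable
  simpa [Measure.map_map e.symm.measurable e.measurable] using h

lemma klDiv_prod_left {α β : Type*} [MeasurableSpace α] [MeasurableSpace β]
    (μ ν : Measure α) [IsProbabilityMeasure μ] [IsProbabilityMeasure ν]
    (ρ : Measure β) [IsProbabilityMeasure ρ] :
    klDiv (μ.prod ρ) (ν.prod ρ) = klDiv μ ν := by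
  have := klDiv_compProd_left μ ν (Kernel.const α ρ)
  simpa [Measure.compProd_const] using this

lemma klDiv_prod_right {α β : Type*} [MeasurableSpace α] [MeasurableSpace β]
    (μ ν : Measure α) [IsProbabilityMeasure μ] [IsProbabilityMeasure ν]
    (ρ : Measure β) [IsProbabilityMeasure ρ] :
    klDiv (ρ.prod μ) (ρ.prod ν) = klDiv μ ν := by
  rw [← klDiv_prod_left μ ν ρ, ← klDiv_map_equiv (ρ.prod μ) (ρ.prod ν) MeasurableEquiv.prodComm]
  congr 1 <;> exact Measure.prod_swap

lemma klDiv_prod_prod {α β : Type*} [MeasurableSpace α] [MeasurableSpace β]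
    [MeasurableSpace.CountableOrCountablyGenerated α β]
    (μ ν : Measure α) [IsProbabilityMeasure μ] [IsProbabilityMeasure ν]
    (ρ σ : Measure β) [IsProbabilityMeasure ρ] [IsProbabilityMeasure σ] :
    klDiv (μ.prod ρ) (ν.prod σ) = klDiv μ ν + klDiv ρ σ := by
  have := klDiv_compProd_eq_add μ ν (Kernel.const α ρ) (Kernel.const α σ)
  simp only [Measure.compProd_const] at this
  rw [this, klDiv_prod_right]

lemma klDiv_prod_prod' {α β : Type*} [MeasurableSpace α] [MeasurableSpace β]
    [MeasurableSpace.CountableOrCountablyGenerated β α]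
    (μ ν : Measure α) [IsProbabilityMeasure μ] [IsProbabilityMeasure ν]
    (ρ σ : Measure β) [IsProbabilityMeasure ρ] [IsProbabilityMeasure σ] :
    klDiv (μ.prod ρ) (ν.prod σ) = klDiv μ ν + klDiv ρ σ := by
  rw [add_comm, ← klDiv_prod_prod, ← klDiv_map_equiv _ _ MeasurableEquiv.prodComm]
  congr 1 <;> exact Measure.prod_swap

lemma klDiv_pi_fin (n : ℕ) {X : Fin n → Type*} [∀ i, MeasurableSpace (X i)]
    [∀ i, MeasurableSpace.CountablyGenerated (X i)]
    (μ ν : ∀ i, Measure (X i)) [∀ i, IsProbabilityMeasure (μ i)]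
    [∀ i, IsProbabilityMeasure (ν i)] :
    klDiv (Measure.pi μ) (Measure.pi ν) = ∑ i, klDiv (μ i) (ν i) := by
  induction n with
  | zero =>
    have : Measure.pi μ = Measure.pi ν := by
      rw [Measure.pi_of_empty, Measure.pi_of_empty]
    rw [this]; simp
  | succ n ih =>
    rw [← klDiv_map_equiv (Measure.pi μ) (Measure.pi ν) (MeasurableEquiv.piFinSuccAbove X 0),
      (measurePreserving_piFinSuccAbove μ 0).map_eq, (measurePreserving_piFinSuccAbove ν 0).map_eq,
      klDiv_prod_prod', ih, Fin.sum_univ_succ]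
    rfl

end KLTools


section MITools
open InformationTheory

variable {α β γ : Type*} [MeasurableSpace α] [MeasurableSpace β] [MeasurableSpace γ]

lemma klDiv_withDensity (Q : Measure β) [IsProbabilityMeasure Q] (f : β → ℝ≥0∞)
    (hf : Measurable f) [IsFiniteMeasure (Q.withDensity f)] :
    klDiv (Q.withDensity f) Q = ∫⁻ y, ENNReal.ofReal (klFun (f y).toReal) ∂Q := by
  rw [klDiv_eq_lintegral_klFun_of_ac (withDensity_absolutelyContinuous Q f)]
  refine lintegral_congr_ae ?_
  filter_upwards [Measure.rnDeriv_withDensity Q hf] with y hy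
  rw [hy]

lemma compProd_eq_withDensity (π : Measure α) [IsProbabilityMeasure π] (κ : Kernel α β)
    [IsMarkovKernel κ] (Q : Measure β) [IsProbabilityMeasure Q] (f : α → β → ℝ≥0∞)
    (hf : Measurable (Function.uncurry f)) (hκ : ∀ x, κ x = Q.withDensity (f x)) :
    π ⊗ₘ κ = (π.prod Q).withDensity (Function.uncurry f) := by
  ext s hs
  rw [Measure.compProd_apply hs, withDensity_apply _ hs, ← lintegral_indicator hs,
    lintegral_prod _ (hf.indicator hs).aemeasurable]
  refine lintegral_congr fun x => ?_
  rw [hκ, withDensity_apply _ (measurable_prodMk_left hs),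
    ← lintegral_indicator (measurable_prodMk_left hs)]
  rfl

lemma klDiv_compProd_const_of_density (π : Measure α) [IsProbabilityMeasure π] (κ : Kernel α β)
    [IsMarkovKernel κ] (Q : Measure β) [IsProbabilityMeasure Q] (f : α → β → ℝ≥0∞)
    (hf : Measurable (Function.uncurry f)) (hκ : ∀ x, κ x = Q.withDensity (f x)) :
    klDiv (π ⊗ₘ κ) (π.prod Q) = ∫⁻ x, klDiv (κ x) Q ∂π := by
  have h := compProd_eq_withDensity π κ Q f hf hκ
  have : IsFiniteMeasure ((π.prod Q).withDensity (Function.uncurry f)) := h ▸ inferInstance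
  have hm : Measurable (fun z => ENNReal.ofReal (klFun (Function.uncurry f z).toReal)) :=
    (measurable_klFun.comp hf.ennreal_toReal).ennreal_ofReal
  rw [h, klDiv_withDensity _ _ hf, lintegral_prod _ hm.aemeasurable]
  refine lintegral_congr fun x => ?_
  have : IsFiniteMeasure (Q.withDensity (f x)) := hκ x ▸ inferInstance
  rw [hκ, klDiv_withDensity Q (f x) (hf.comp measurable_prodMk_left)]
  rfl

lemma klDiv_compProd_const (π : Measure α) [IsProbabilityMeasure π] (κ : Kernel α β)
    [MeasurableSpace.CountableOrCountablyGenerated α β]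
    [IsMarkovKernel κ] (Q : Measure β) [IsProbabilityMeasure Q] (hac : ∀ x, κ x ≪ Q) :
    klDiv (π ⊗ₘ κ) (π.prod Q) = ∫⁻ x, klDiv (κ x) Q ∂π := by
  refine klDiv_compProd_const_of_density π κ Q
    (fun x => Kernel.rnDeriv κ (Kernel.const α Q) x) (Kernel.measurable_rnDeriv _ _) fun x => ?_
  have h := Kernel.withDensity_rnDeriv_eq (κ := κ) (η := Kernel.const α Q) (a := x) (by simpa using hac x)
  rw [Kernel.withDensity_apply _ (Kernel.measurable_rnDeriv _ _)] at h
  simpa using h.symm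

lemma mi_chain [StandardBorelSpace α] [Nonempty α] (π : Measure α) [IsProbabilityMeasure π]
    (W : Kernel α β) [IsMarkovKernel W] (Q : Measure β) [IsProbabilityMeasure Q] :
    klDiv (π ⊗ₘ W) (π.prod Q) = klDiv (W ∘ₘ π) Q + klDiv (π ⊗ₘ W) (π.prod (W ∘ₘ π)) := by
  have hs : ∀ R : Measure β, IsProbabilityMeasure R → klDiv (π ⊗ₘ W) (π.prod R)
      = klDiv ((W ∘ₘ π) ⊗ₘ (W†π)) (R ⊗ₘ Kernel.const β π) := by
    intro R _
    rw [compProd_posterior_eq_map_swap, Measure.compProd_const,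
      ← klDiv_map_equiv (π ⊗ₘ W) (π.prod R) MeasurableEquiv.prodComm]
    congr 1
    exact Measure.prod_swap
  rw [hs Q inferInstance, hs (W ∘ₘ π) inferInstance, klDiv_compProd_eq_add]

lemma mi_dpi (π : Measure α) [IsProbabilityMeasure π]
    (W : Kernel α β) [IsMarkovKernel W] (Q : Measure β) [IsProbabilityMeasure Q]
    (V : Kernel β γ) [IsMarkovKernel V] :
    klDiv (π ⊗ₘ (V ∘ₖ W)) (π.prod (V ∘ₘ Q)) ≤ klDiv (π ⊗ₘ W) (π.prod Q) := by
  rw [← Measure.parallelComp_comp_compProd, Measure.prod_comp_right]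
  exact klDiv_comp_right_le _ _ _

/-- Uniform measure on a finite type. -/
def unif (α : Type*) [Fintype α] [MeasurableSpace α] : Measure α :=
  (Fintype.card α : ℝ≥0∞)⁻¹ • Measure.sum fun m : α => Measure.dirac m

variable [Fintype α] [MeasurableSingletonClass α]

instance [Nonempty α] : IsProbabilityMeasure (unif α) := by
  constructor
  simp only [unif, Measure.smul_apply, Measure.sum_apply _ MeasurableSet.univ, measure_univ,
    tsum_fintype, Finset.sum_const, Finset.card_univ, smul_eq_mul, nsmul_eq_mul, mul_one]
  exact ENNReal.inv_mul_cancel (by simp) (by simp)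

lemma lintegral_unif (f : α → ℝ≥0∞) :
    ∫⁻ x, f x ∂(unif α) = (Fintype.card α : ℝ≥0∞)⁻¹ * ∑ m, f m := by
  rw [unif, lintegral_smul_measure, lintegral_sum_measure]
  simp [tsum_fintype]

lemma unif_singleton (m : α) : unif α {m} = (Fintype.card α : ℝ≥0∞)⁻¹ := by
  rw [← lintegral_indicator_one (measurableSet_singleton m), lintegral_unif]
  classical
  simp [Set.indicator_apply]

/-- Kernel from a finite type. -/
def fk (κ : α → Measure β) : Kernel α β := ⟨κ, measurable_of_finite κ⟩

@[simp] lemma fk_apply (κ : α → Measure β) (m : α) : fk κ m = κ m := rfl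

instance (κ : α → Measure β) [∀ m, IsProbabilityMeasure (κ m)] : IsMarkovKernel (fk κ) :=
  ⟨fun m => by rw [fk_apply]; infer_instance⟩

lemma ac_comp_unif [Nonempty α] (κ : Kernel α β) [IsMarkovKernel κ] (m : α) :
    κ m ≪ κ ∘ₘ (unif α) := by
  refine Measure.AbsolutelyContinuous.mk fun s hs h => ?_
  rw [Measure.bind_apply hs κ.aemeasurable, lintegral_unif] at h
  simp only [mul_eq_zero, ENNReal.inv_eq_zero, ENNReal.natCast_ne_top, Finset.sum_eq_zero_iff,
    Finset.mem_univ, true_implies, false_or] at h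
  exact h m

lemma miBits_compProd_unif [Nonempty α] (κ : Kernel α β) [IsMarkovKernel κ] :
    miBits (unif α ⊗ₘ κ)
      = (klDiv (unif α ⊗ₘ κ) ((unif α).prod (κ ∘ₘ (unif α)))).toReal / Real.log 2 := by
  have h1 : (unif α ⊗ₘ κ).map Prod.fst = unif α := Measure.fst_compProd _ _
  have h2 : (unif α ⊗ₘ κ).map Prod.snd = κ ∘ₘ (unif α) := Measure.snd_compProd _ _
  have hac : unif α ⊗ₘ κ ≪ (unif α).prod (κ ∘ₘ (unif α)) := by
    rw [← Measure.compProd_const]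
    refine Measure.AbsolutelyContinuous.compProd_right (Filter.Eventually.of_forall fun m => ?_)
    rw [Kernel.const_apply]
    exact ac_comp_unif κ m
  rw [miBits, klDivBits, h1, h2, toReal_klDiv_of_measure_eq hac (by simp)]
  simp only [Real.logb]
  rw [integral_div]
  rfl

/-- Mutual information bounded by the average divergence to any reference. -/
lemma mi_le_avg [Nonempty α] [StandardBorelSpace α] (κ : Kernel α β) [IsMarkovKernel κ] (Q : Measure β) [IsProbabilityMeasure Q] :
    klDiv (unif α ⊗ₘ κ) ((unif α).prod (κ ∘ₘ (unif α))) ≤ ∫⁻ m, klDiv (κ m) Q ∂(unif α) := by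
  by_cases h : ∫⁻ m, klDiv (κ m) Q ∂(unif α) = ∞
  · rw [h]; exact le_top
  have hac : ∀ m, κ m ≪ Q := by
    intro m
    by_contra hc
    apply h
    rw [lintegral_unif, ENNReal.mul_eq_top]
    left
    refine ⟨by simp, ?_⟩
    rw [ENNReal.sum_eq_top]
    exact ⟨m, Finset.mem_univ m, klDiv_of_not_ac hc⟩
  rw [← klDiv_compProd_const _ _ _ hac, mi_chain (unif α) κ Q]
  exact le_add_self

end MITools

lemma measurable_parOut {n L : ℕ} (g : Fin L → ℝ) :
    Measurable (parOut (n := n) g) := by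
  unfold parOut
  refine measurable_pi_measure (fun i (xs : Fin n → Fin L → ℝ) =>
    Measure.pi fun l => gaussianReal (Real.sqrt (g l) * xs i l) 1) fun i => ?_
  refine measurable_pi_measure (fun l (xs : Fin n → Fin L → ℝ) =>
    gaussianReal (Real.sqrt (g l) * xs i l) 1) fun l => ?_
  exact measurable_gaussianReal.comp ((by fun_prop : Measurable fun xs : Fin n → Fin L → ℝ =>
    ((Real.sqrt (g l) * xs i l, (1 : NNReal)) : ℝ × NNReal)))

instance {n L : ℕ} (g : Fin L → ℝ) (xs : Fin n → Fin L → ℝ) :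
    IsProbabilityMeasure (parOut g xs) := by unfold parOut; infer_instance

/-- `parOut` as a kernel. -/
def parK (n : ℕ) {L : ℕ} (g : Fin L → ℝ) : Kernel (Fin n → Fin L → ℝ) (Fin n → Fin L → ℝ) :=
  ⟨parOut g, measurable_parOut g⟩

lemma parK_apply {n L : ℕ} (g : Fin L → ℝ) (xs : Fin n → Fin L → ℝ) :
    parK n g xs = parOut g xs := rfl

instance {n L : ℕ} (g : Fin L → ℝ) : IsMarkovKernel (parK n g) :=
  ⟨fun xs => by rw [parK_apply]; infer_instance⟩

lemma jointLawPar_eq {n L K₁ K₂ : ℕ} (g : Fin L → ℝ)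
    (enc : Fin K₁ × Fin K₂ → Measure (Fin n → Fin L → ℝ)) [∀ m, IsProbabilityMeasure (enc m)] :
    jointLawPar g enc = unif (Fin K₁ × Fin K₂) ⊗ₘ (parK n g ∘ₖ fk enc) := by
  have : SFinite (unif (Fin K₁ × Fin K₂)) := by unfold unif; infer_instance
  ext s hs
  rw [Measure.compProd_apply hs, lintegral_unif, jointLawPar, Measure.smul_apply,
    Measure.sum_apply _ hs, tsum_fintype]
  simp only [Fintype.card_prod, Fintype.card_fin, Nat.cast_mul, smul_eq_mul]
  congr 1
  refine Finset.sum_congr rfl fun m _ => ?_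
  have : IsProbabilityMeasure ((enc m).bind (parOut g)) :=
    isProbabilityMeasure_bind (measurable_parOut g).aemeasurable (Filter.Eventually.of_forall fun z => inferInstance)
  rw [Measure.prod_apply hs, lintegral_dirac, Kernel.comp_apply]
  rfl

lemma jointLawPar_map_eq {n L K₁ K₂ : ℕ} (hK : 0 < K₂) (g : Fin L → ℝ)
    (enc : Fin K₁ × Fin K₂ → Measure (Fin n → Fin L → ℝ)) [∀ m, IsProbabilityMeasure (enc m)] :
    (jointLawPar g enc).map (fun p => (p.1.1, p.2)) = unif (Fin K₁) ⊗ₘ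
      (parK n g ∘ₖ fk (fun m₁ => (unif (Fin K₂)).bind (fun m₂ => enc (m₁, m₂)))) := by
  have : SFinite (unif (Fin K₁ × Fin K₂)) := by unfold unif; infer_instance
  have : SFinite (unif (Fin K₁)) := by unfold unif; infer_instance
  have : Nonempty (Fin K₂) := ⟨⟨0, hK⟩⟩
  have hp : ∀ m₁, IsProbabilityMeasure ((unif (Fin K₂)).bind (fun m₂ => enc (m₁, m₂))) := fun m₁ =>
    isProbabilityMeasure_bind (measurable_of_finite _).aemeasurable (Filter.Eventually.of_forall fun z => inferInstance)
  have hm : Measurable (fun p : (Fin K₁ × Fin K₂) × (Fin n → Fin L → ℝ) => (p.1.1, p.2)) := by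
    fun_prop
  ext s hs
  rw [jointLawPar_eq, Measure.map_apply hm hs, Measure.compProd_apply (hm hs),
    Measure.compProd_apply hs, lintegral_unif, lintegral_unif]
  simp only [Fintype.card_prod, Fintype.card_fin, Nat.cast_mul]
  rw [Fintype.sum_prod_type, ENNReal.mul_inv (by simp) (by simp), mul_assoc, Finset.mul_sum]
  congr 1
  refine Finset.sum_congr rfl fun m₁ _ => ?_
  have hs' : MeasurableSet (Prod.mk m₁ ⁻¹' s) := measurable_prodMk_left hs
  rw [Kernel.comp_apply, Measure.bind_apply hs' (Kernel.aemeasurable _), fk_apply,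
    Measure.lintegral_bind (measurable_of_finite _).aemeasurable
      ((Kernel.measurable_coe _ hs').aemeasurable), lintegral_unif]
  simp only [Fintype.card_fin]
  congr 1
  refine Finset.sum_congr rfl fun m₂ _ => ?_
  rw [Kernel.comp_apply, fk_apply, Set.preimage_preimage,
    Measure.bind_apply hs' (Kernel.aemeasurable _)]


section Scalar
open InformationTheory

/-- log density of `N(m,1)` with respect to `N(0,v)`. -/
def iota (v m y : ℝ) : ℝ := (1/2) * Real.log v - (y - m)^2/2 + y^2/(2*v)

lemma gaussian_withDensity (m : ℝ) (v : NNReal) (hv : v ≠ 0) :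
    gaussianReal m 1 = (gaussianReal 0 v).withDensity
      (fun y => ENNReal.ofReal (Real.exp (iota v m y))) := by
  have hv' : (0:ℝ) < v := by positivity
  rw [gaussianReal_of_var_ne_zero _ one_ne_zero, gaussianReal_of_var_ne_zero _ hv,
    ← withDensity_mul _ (measurable_gaussianPDF _ _)
      (by unfold iota; fun_prop)]
  congr 1
  ext y
  simp only [Pi.mul_apply, gaussianPDF]
  rw [← ENNReal.ofReal_mul (gaussianPDFReal_nonneg _ _ _)]
  congr 1
  simp only [gaussianPDFReal, iota, NNReal.coe_one, mul_one, sub_zero]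
  have h1 : Real.sqrt (2 * Real.pi * v) = Real.sqrt (2 * Real.pi) * Real.exp ((1/2) * Real.log v) := by
    rw [Real.sqrt_mul (by positivity), Real.sqrt_eq_rpow (v:ℝ), Real.rpow_def_of_pos hv']
    ring_nf
  rw [h1, mul_inv, ← Real.exp_neg, mul_assoc, mul_assoc, ← Real.exp_add, ← Real.exp_add]
  congr 2
  ring

lemma measurable_iota (v : ℝ) : Measurable (fun p : ℝ × ℝ => iota v p.1 p.2) := by
  unfold iota; fun_prop

lemma gaussian_sq_integrable (m : ℝ) (v : NNReal) :
    Integrable (fun y : ℝ => y^2) (gaussianReal m v) :=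
  (memLp_id_gaussianReal (μ := m) (v := v) 2).integrable_sq

lemma gaussian_integral_sq (m : ℝ) (v : NNReal) :
    ∫ y, y^2 ∂(gaussianReal m v) = v + m^2 := by
  have h := variance_eq_sub (memLp_id_gaussianReal (μ := m) (v := v) 2)
  rw [variance_id_gaussianReal] at h
  simp only [id_eq, Pi.pow_apply, integral_id_gaussianReal] at h
  linarith

lemma gaussian_id_integrable (m : ℝ) (v : NNReal) :
    Integrable (fun y : ℝ => y) (gaussianReal m v) :=
  (memLp_id_gaussianReal (μ := m) (v := v) 1).integrable le_rfl

lemma iota_integrable (v m : ℝ) : Integrable (iota v m) (gaussianReal m 1) := by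
  have h1 := gaussian_sq_integrable m 1
  have h2 := gaussian_id_integrable m 1
  have : iota v m = fun y => ((1/2) * Real.log v - m^2/2) + m * y + (1/(2*v) - 1/2) * y^2 := by
    ext y; unfold iota; ring
  rw [this]
  exact ((integrable_const _).add (h2.const_mul _)).add (h1.const_mul _)

lemma iota_integral (v m : ℝ) : ∫ y, iota v m y ∂(gaussianReal m 1)
    = (1/2) * Real.log v + (m^2+1)/(2*v) - 1/2 := by
  have h1 := gaussian_sq_integrable m 1
  have h2 := gaussian_id_integrable m 1
  have : iota v m = fun y => ((1/2) * Real.log v - m^2/2) + m * y + (1/(2*v) - 1/2) * y^2 := by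
    ext y; unfold iota; ring
  have h3 : Integrable (fun y => ((1/2) * Real.log v - m^2/2) + m * y) (gaussianReal m 1) :=
    (integrable_const _).add (h2.const_mul _)
  rw [this]
  beta_reduce
  rw [integral_add h3 (h1.const_mul _),
    integral_add (integrable_const _) (h2.const_mul _), integral_const_mul, integral_const_mul,
    gaussian_integral_sq, integral_id_gaussianReal]
  simp only [integral_const, probReal_univ, smul_eq_mul, one_mul, NNReal.coe_one]
  ring

lemma klDiv_gaussian (m : ℝ) (v : NNReal) (hv : v ≠ 0) :
    klDiv (gaussianReal m 1) (gaussianReal 0 v) ≠ ∞ ∧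
    (klDiv (gaussianReal m 1) (gaussianReal 0 v)).toReal =
      (1/2) * Real.log v + (m^2+1)/(2*v) - 1/2 := by
  have hd := gaussian_withDensity m v hv
  have hmeas : Measurable (fun y => ENNReal.ofReal (Real.exp (iota v m y))) := by
    unfold iota; fun_prop
  have hac : gaussianReal m 1 ≪ gaussianReal 0 v := by
    rw [hd]; exact withDensity_absolutelyContinuous _ _
  have hllr : llr (gaussianReal m 1) (gaussianReal 0 v) =ᵐ[gaussianReal m 1] iota v m := by
    have h := Measure.rnDeriv_withDensity (gaussianReal 0 v) hmeas
    rw [← hd] at h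
    filter_upwards [hac.ae_eq h] with y hy
    simp only [llr, hy]
    rw [ENNReal.toReal_ofReal (Real.exp_pos _).le, Real.log_exp]
  have hintg : Integrable (llr (gaussianReal m 1) (gaussianReal 0 v)) (gaussianReal m 1) :=
    (integrable_congr hllr).2 (iota_integrable _ _)
  refine ⟨klDiv_ne_top hac hintg, ?_⟩
  rw [toReal_klDiv_of_measure_eq hac (by simp), integral_congr_ae hllr, iota_integral]

end Scalar

section Degrade

lemma gaussian_bind (m c : ℝ) (s w : NNReal) :
    (gaussianReal m s).bind (fun y => gaussianReal (c * y) w)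
      = gaussianReal (c * m) (NNReal.mk (c^2) (sq_nonneg c) * s + w) := by
  have hm : Measurable (fun y : ℝ => gaussianReal (c * y) w) :=
    measurable_gaussianReal.comp (by fun_prop : Measurable fun y : ℝ => ((c * y, w) : ℝ × NNReal))
  have h0 : ∀ z : ℝ, gaussianReal z w = (gaussianReal 0 w).map (fun t => z + t) := by
    intro z
    rw [gaussianReal_map_const_add, zero_add]
  have h := gaussianReal_conv_gaussianReal (m₁ := c * m) (m₂ := 0) (v₁ := NNReal.mk (c^2) (sq_nonneg c) * s) (v₂ := w)
  rw [add_zero] at h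
  rw [← h, ← gaussianReal_map_const_mul]
  refine Measure.ext_of_lintegral _ fun f hf => ?_
  rw [Measure.lintegral_bind hm.aemeasurable hf.aemeasurable, Measure.lintegral_conv hf,
    lintegral_map (by fun_prop) (by fun_prop)]
  refine lintegral_congr fun y => ?_
  rw [h0, lintegral_map hf (by fun_prop)]

/-- the degrading noise variance -/
def degW (a b : ℝ) : NNReal := (1 - b / a).toNNReal

lemma deg_out (a b x : ℝ) (hb : 0 ≤ b) (hab : b ≤ a) :
    (gaussianReal (Real.sqrt a * x) 1).bind (fun y => gaussianReal (Real.sqrt (b / a) * y) (degW a b))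
      = gaussianReal (Real.sqrt b * x) 1 := by
  rw [gaussian_bind]
  have ha : 0 ≤ a := hb.trans hab
  have h1 : b / a ≤ 1 := div_le_one_of_le₀ hab ha
  congr 1
  · rw [← mul_assoc, ← Real.sqrt_mul (by positivity)]
    congr 2
    rcases ha.eq_or_lt with h | h
    · subst h; have : b = 0 := le_antisymm hab hb
      simp [this]
    · field_simp
  · ext
    simp only [NNReal.coe_add, NNReal.coe_mul, NNReal.coe_mk, NNReal.coe_one, mul_one, degW,
      Real.coe_toNNReal _ (sub_nonneg.2 h1)]
    rw [Real.sq_sqrt (by positivity)]; ring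

lemma deg_ref (a b P : ℝ) (hb : 0 ≤ b) (hab : b ≤ a) (hP : 0 ≤ P) :
    (gaussianReal 0 (1 + a * P).toNNReal).bind
      (fun y => gaussianReal (Real.sqrt (b / a) * y) (degW a b))
      = gaussianReal 0 (1 + b * P).toNNReal := by
  rw [gaussian_bind]
  have ha : 0 ≤ a := hb.trans hab
  have h1 : b / a ≤ 1 := div_le_one_of_le₀ hab ha
  congr 1
  · simp
  · ext
    simp only [NNReal.coe_add, NNReal.coe_mul, NNReal.coe_mk, degW,
      Real.coe_toNNReal _ (sub_nonneg.2 h1)]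
    rw [Real.coe_toNNReal _ (by positivity), Real.coe_toNNReal _ (by positivity),
      Real.sq_sqrt (by positivity)]
    rcases ha.eq_or_lt with h | h
    · subst h; have : b = 0 := le_antisymm hab hb
      simp [this]
    · field_simp; ring

variable {n L : ℕ}

/-- Degrading kernel. -/
def degK (n : ℕ) {L : ℕ} (a b : Fin L → ℝ) : Kernel (Fin n → Fin L → ℝ) (Fin n → Fin L → ℝ) where
  toFun y := Measure.pi fun i => Measure.pi fun l =>
    gaussianReal (Real.sqrt (b l / a l) * y i l) (degW (a l) (b l))
  measurable' := by
    refine measurable_pi_measure (fun i (xs : Fin n → Fin L → ℝ) =>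
      Measure.pi fun l => gaussianReal (Real.sqrt (b l / a l) * xs i l) (degW (a l) (b l))) fun i => ?_
    refine measurable_pi_measure (fun l (xs : Fin n → Fin L → ℝ) =>
      gaussianReal (Real.sqrt (b l / a l) * xs i l) (degW (a l) (b l))) fun l => ?_
    exact measurable_gaussianReal.comp ((by fun_prop : Measurable fun xs : Fin n → Fin L → ℝ =>
      ((Real.sqrt (b l / a l) * xs i l, degW (a l) (b l)) : ℝ × NNReal)))

lemma degK_apply (a b : Fin L → ℝ) (y : Fin n → Fin L → ℝ) :
    degK n a b y = Measure.pi fun i => Measure.pi fun l =>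
    gaussianReal (Real.sqrt (b l / a l) * y i l) (degW (a l) (b l)) := rfl

instance (a b : Fin L → ℝ) : IsMarkovKernel (degK n a b) :=
  ⟨fun xs => by rw [degK_apply]; infer_instance⟩

lemma degK_comp_pi (a b : Fin L → ℝ) (μ : Fin n → Fin L → Measure ℝ)
    [∀ i l, IsProbabilityMeasure (μ i l)] :
    degK n a b ∘ₘ (Measure.pi fun i => Measure.pi fun l => μ i l) =
      Measure.pi fun i => Measure.pi fun l => (μ i l).bind
        (fun y => gaussianReal (Real.sqrt (b l / a l) * y) (degW (a l) (b l))) := by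
  have hm : ∀ l, Measurable (fun y : ℝ => gaussianReal (Real.sqrt (b l / a l) * y) (degW (a l) (b l))) :=
    fun l => measurable_gaussianReal.comp (by fun_prop :
      Measurable fun y : ℝ => ((Real.sqrt (b l / a l) * y, degW (a l) (b l)) : ℝ × NNReal))
  have hm2 : Measurable (fun y : Fin L → ℝ => Measure.pi fun l =>
      gaussianReal (Real.sqrt (b l / a l) * y l) (degW (a l) (b l))) :=
    measurable_pi_measure (fun l (y : Fin L → ℝ) =>
      gaussianReal (Real.sqrt (b l / a l) * y l) (degW (a l) (b l)))
      fun l => (hm l).comp (measurable_pi_apply l)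
  have h1 := pi_bind_pi (fun i : Fin n => Measure.pi fun l => μ i l)
    (fun _ (y : Fin L → ℝ) => Measure.pi fun l =>
      gaussianReal (Real.sqrt (b l / a l) * y l) (degW (a l) (b l))) (fun _ => hm2)
  refine h1.trans ?_
  congr 1
  ext1 i
  exact pi_bind_pi (fun l => μ i l)
    (fun l y => gaussianReal (Real.sqrt (b l / a l) * y) (degW (a l) (b l))) hm

lemma degK_parOut (a b : Fin L → ℝ) (hb : ∀ l, 0 ≤ b l) (hab : ∀ l, b l ≤ a l) :
    degK n a b ∘ₖ parK n a = parK n b := by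
  ext1 x
  rw [Kernel.comp_apply, parK_apply, parK_apply, parOut, degK_comp_pi, parOut]
  simp_rw [deg_out _ _ _ (hb _) (hab _)]

/-- reference output law -/
def refQ (n : ℕ) {L : ℕ} (g P : Fin L → ℝ) : Measure (Fin n → Fin L → ℝ) :=
  Measure.pi fun _ => Measure.pi fun l => gaussianReal 0 (1 + g l * P l).toNNReal

instance (g P : Fin L → ℝ) : IsProbabilityMeasure (refQ n g P) := by
  unfold refQ; infer_instance

lemma degK_refQ (a b P : Fin L → ℝ) (hb : ∀ l, 0 ≤ b l) (hab : ∀ l, b l ≤ a l) (hP : ∀ l, 0 ≤ P l) :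
    degK n a b ∘ₘ refQ n a P = refQ n b P := by
  rw [refQ, degK_comp_pi, refQ]
  simp_rw [deg_ref _ _ _ (hb _) (hab _) (hP _)]

end Degrade


section Converse
open InformationTheory

variable {n L : ℕ}

/-- scalar divergence -/
def kk (g P x : ℝ) : ℝ := (1/2) * Real.log (1 + g * P) + (g * x^2 + 1)/(2*(1 + g * P)) - 1/2

lemma klDiv_scalar (g P x : ℝ) (hg : 0 ≤ g) (hP : 0 ≤ P) :
    0 ≤ kk g P x ∧ klDiv (gaussianReal (Real.sqrt g * x) 1) (gaussianReal 0 (1 + g * P).toNNReal)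
      = ENNReal.ofReal (kk g P x) := by
  have hpos : 0 < 1 + g * P := by positivity
  have h := klDiv_gaussian (Real.sqrt g * x) (1 + g * P).toNNReal (by simpa using hpos)
  rw [Real.coe_toNNReal _ hpos.le, mul_pow, Real.sq_sqrt hg] at h
  have h2 : (klDiv (gaussianReal (Real.sqrt g * x) 1) (gaussianReal 0 (1 + g * P).toNNReal)).toReal
      = kk g P x := h.2
  exact ⟨h2 ▸ ENNReal.toReal_nonneg, by rw [← h2, ENNReal.ofReal_toReal h.1]⟩

lemma klDiv_parOut (g P : Fin L → ℝ) (hg : ∀ l, 0 ≤ g l) (hP : ∀ l, 0 ≤ P l)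
    (x : Fin n → Fin L → ℝ) :
    klDiv (parOut g x) (refQ n g P) = ENNReal.ofReal (∑ i, ∑ l, kk (g l) (P l) (x i l)) := by
  have h0 : ∀ i l, 0 ≤ kk (g l) (P l) (x i l) := fun i l => (klDiv_scalar _ _ _ (hg l) (hP l)).1
  rw [parOut, refQ, klDiv_pi_fin, ENNReal.ofReal_sum_of_nonneg
    (fun i _ => Finset.sum_nonneg fun l _ => h0 i l)]
  refine Finset.sum_congr rfl fun i _ => ?_
  rw [klDiv_pi_fin, ENNReal.ofReal_sum_of_nonneg (fun l _ => h0 i l)]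
  exact Finset.sum_congr rfl fun l _ => (klDiv_scalar _ _ _ (hg l) (hP l)).2

lemma sum_kk (g P : ℝ) (x : Fin n → ℝ) :
    ∑ i, kk g P (x i) = n * ((1/2) * Real.log (1 + g * P)) +
      ((g * ∑ i, (x i)^2 + n) / (2 * (1 + g * P)) - n * (1/2)) := by
  simp only [kk, Finset.sum_sub_distrib, Finset.sum_add_distrib, Finset.sum_const, Finset.card_univ,
    Fintype.card_fin, nsmul_eq_mul, ← Finset.sum_div, ← Finset.mul_sum, mul_one]
  ring

lemma sum_kk_le (g P : ℝ) (hg : 0 ≤ g) (hP : 0 ≤ P) (x : Fin n → ℝ) (hx : ∑ i, (x i)^2 ≤ n * P) :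
    ∑ i, kk g P (x i) ≤ n * ((1/2) * Real.log (1 + g * P)) := by
  rw [sum_kk]
  have : (g * ∑ i, (x i)^2 + n) / (2 * (1 + g * P)) ≤ n * (1/2) := by
    rw [div_le_iff₀ (by positivity)]
    have := mul_le_mul_of_nonneg_left hx hg
    linarith
  linarith

lemma sum_kk_diff (a b P : ℝ) (hb : 0 ≤ b) (hab : b ≤ a) (hP : 0 ≤ P) (x : Fin n → ℝ)
    (hx : ∑ i, (x i)^2 ≤ n * P) :
    ∑ i, kk a P (x i) ≤ ∑ i, kk b P (x i) +
      n * ((1/2) * Real.log (1 + a * P) - (1/2) * Real.log (1 + b * P)) := by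
  rw [sum_kk, sum_kk]
  have ha : 0 ≤ a := hb.trans hab
  set S := ∑ i, (x i)^2
  have : (a * S + n) / (2 * (1 + a * P)) ≤ (b * S + n) / (2 * (1 + b * P)) := by
    rw [div_le_div_iff₀ (by positivity) (by positivity)]
    nlinarith [mul_nonneg (sub_nonneg.2 hab) (sub_nonneg.2 hx)]
  linarith

variable {α : Type*} [MeasurableSpace α] [Fintype α] [MeasurableSingletonClass α] [Nonempty α]

/-- Mutual information between uniform message and output. -/
def MI (g : Fin L → ℝ) (E : α → Measure (Fin n → Fin L → ℝ)) : ℝ≥0∞ :=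
  klDiv (unif α ⊗ₘ (parK n g ∘ₖ fk E)) ((unif α).prod ((parK n g ∘ₖ fk E) ∘ₘ unif α))

lemma MI_mono (a b : Fin L → ℝ) (hb : ∀ l, 0 ≤ b l) (hab : ∀ l, b l ≤ a l)
    (E : α → Measure (Fin n → Fin L → ℝ)) [∀ m, IsProbabilityMeasure (E m)] :
    MI b E ≤ MI a E := by
  have h := mi_dpi (unif α) (parK n a ∘ₖ fk E) ((parK n a ∘ₖ fk E) ∘ₘ unif α) (degK n a b)
  rw [← Kernel.comp_assoc, degK_parOut a b hb hab, Measure.comp_assoc, ← Kernel.comp_assoc,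
    degK_parOut a b hb hab] at h
  exact h

/-- Total divergence and its decomposition. -/
lemma G_decomp (g P : Fin L → ℝ) (hg : ∀ l, 0 ≤ g l) (hP : ∀ l, 0 ≤ P l)
    (E : α → Measure (Fin n → Fin L → ℝ)) [∀ m, IsProbabilityMeasure (E m)]
    (hE : ∀ m, ∀ᵐ x ∂(E m), x ∈ perSubPow L P n) :
    ∫⁻ m, ∫⁻ x, ENNReal.ofReal (∑ i, ∑ l, kk (g l) (P l) (x i l)) ∂(E m) ∂(unif α) ≠ ∞ ∧
    ∫⁻ m, ∫⁻ x, ENNReal.ofReal (∑ i, ∑ l, kk (g l) (P l) (x i l)) ∂(E m) ∂(unif α) =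
      MI g E + (klDiv ((parK n g ∘ₖ fk E) ∘ₘ unif α) (refQ n g P) +
       ∫⁻ m, klDiv (E m ⊗ₘ parK n g) ((E m).prod (parK n g ∘ₘ E m)) ∂(unif α)) := by
  have hfin : ∀ m, ∫⁻ x, ENNReal.ofReal (∑ i, ∑ l, kk (g l) (P l) (x i l)) ∂(E m) ≠ ∞ := by
    intro m
    have : ∫⁻ x, ENNReal.ofReal (∑ i, ∑ l, kk (g l) (P l) (x i l)) ∂(E m) ≤
        ∫⁻ x, ENNReal.ofReal (∑ l, n * ((1/2) * Real.log (1 + g l * P l))) ∂(E m) := by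
      refine lintegral_mono_ae ?_
      filter_upwards [hE m] with x hx
      refine ENNReal.ofReal_le_ofReal ?_
      rw [Finset.sum_comm]
      exact Finset.sum_le_sum fun l _ => sum_kk_le _ _ (hg l) (hP l) (fun i => x i l) (hx l)
    refine ne_top_of_le_ne_top ?_ this
    simp
  have hne : Nonempty (Fin n → Fin L → ℝ) := ⟨0⟩
  have hac0 : ∀ x, parK n g x ≪ refQ n g P := by
    intro x
    by_contra hc
    have := klDiv_of_not_ac hc
    rw [parK_apply, klDiv_parOut g P hg hP] at this
    exact ENNReal.ofReal_ne_top this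
  have hG : ∀ m, ∫⁻ x, ENNReal.ofReal (∑ i, ∑ l, kk (g l) (P l) (x i l)) ∂(E m) =
      klDiv (parK n g ∘ₘ E m) (refQ n g P) + klDiv (E m ⊗ₘ parK n g) ((E m).prod (parK n g ∘ₘ E m)) := by
    intro m
    rw [← mi_chain, klDiv_compProd_const _ _ _ hac0]
    refine lintegral_congr fun x => ?_
    rw [parK_apply, klDiv_parOut g P hg hP]
  have hac : ∀ m, (parK n g ∘ₖ fk E) m ≪ refQ n g P := by
    intro m
    by_contra hc
    have h1 := hfin m
    rw [hG] at h1
    rw [Kernel.comp_apply, fk_apply] at hc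
    rw [klDiv_of_not_ac hc] at h1
    simp at h1
  constructor
  · rw [lintegral_unif]
    exact ENNReal.mul_ne_top (by simp) (ENNReal.sum_ne_top.2 fun m _ => hfin m)
  · simp_rw [hG]
    rw [lintegral_add_left (measurable_of_finite _), ← add_assoc]
    congr 1
    rw [add_comm (MI g E), MI, ← mi_chain, klDiv_compProd_const _ _ _ hac]
    rfl

lemma MI_diff (a b P : Fin L → ℝ) (hb : ∀ l, 0 ≤ b l) (hab : ∀ l, b l ≤ a l) (hP : ∀ l, 0 ≤ P l)
    (E : α → Measure (Fin n → Fin L → ℝ)) [∀ m, IsProbabilityMeasure (E m)]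
    (hE : ∀ m, ∀ᵐ x ∂(E m), x ∈ perSubPow L P n) :
    MI a E ≠ ∞ ∧
    MI a E ≤ MI b E + ENNReal.ofReal
      (∑ l, n * ((1/2) * Real.log (1 + a l * P l) - (1/2) * Real.log (1 + b l * P l))) := by
  have ha : ∀ l, 0 ≤ a l := fun l => (hb l).trans (hab l)
  have hA := G_decomp a P ha hP E hE
  have hB := G_decomp b P hb hP E hE
  set Δ := ∑ l, n * ((1/2) * Real.log (1 + a l * P l) - (1/2) * Real.log (1 + b l * P l)) with hΔ
  have hle : ∫⁻ m, ∫⁻ x, ENNReal.ofReal (∑ i, ∑ l, kk (a l) (P l) (x i l)) ∂(E m) ∂(unif α) ≤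
      ∫⁻ m, ∫⁻ x, ENNReal.ofReal (∑ i, ∑ l, kk (b l) (P l) (x i l)) ∂(E m) ∂(unif α)
        + ENNReal.ofReal Δ := by
    have : ENNReal.ofReal Δ = ∫⁻ m, ∫⁻ x, ENNReal.ofReal Δ ∂(E m) ∂(unif α) := by simp
    rw [this, ← lintegral_add_left (measurable_of_finite _)]
    refine lintegral_mono fun m => ?_
    rw [← lintegral_add_right _ measurable_const]
    refine lintegral_mono_ae ?_
    filter_upwards [hE m] with x hx
    refine le_trans (ENNReal.ofReal_le_ofReal ?_) ENNReal.ofReal_add_le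
    rw [Finset.sum_comm, hΔ, Finset.sum_comm (γ := Fin n), ← Finset.sum_add_distrib]
    exact Finset.sum_le_sum fun l _ =>
      sum_kk_diff _ _ _ (hb l) (hab l) (hP l) (fun i => x i l) (hx l)
  have hmono : klDiv ((parK n b ∘ₖ fk E) ∘ₘ unif α) (refQ n b P) +
       ∫⁻ m, klDiv (E m ⊗ₘ parK n b) ((E m).prod (parK n b ∘ₘ E m)) ∂(unif α) ≤
      klDiv ((parK n a ∘ₖ fk E) ∘ₘ unif α) (refQ n a P) +
       ∫⁻ m, klDiv (E m ⊗ₘ parK n a) ((E m).prod (parK n a ∘ₘ E m)) ∂(unif α) := by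
    refine add_le_add ?_ (lintegral_mono fun m => ?_)
    · have h := klDiv_comp_right_le ((parK n a ∘ₖ fk E) ∘ₘ unif α) (refQ n a P) (degK n a b)
      rw [degK_refQ a b P hb hab hP, Measure.comp_assoc, ← Kernel.comp_assoc,
        degK_parOut a b hb hab] at h
      exact h
    · have h := mi_dpi (E m) (parK n a) (parK n a ∘ₘ E m) (degK n a b)
      rw [Measure.comp_assoc, degK_parOut a b hb hab] at h
      exact h
  rw [hA.2, hB.2] at hle
  have hA1 := hA.1
  rw [hA.2] at hA1
  obtain ⟨hf1, hf2⟩ := ENNReal.add_ne_top.1 hA1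
  refine ⟨hf1, ?_⟩
  refine (ENNReal.add_le_add_iff_right hf2).1 (hle.trans ?_)
  rw [add_right_comm]
  gcongr

/-- General comparison in terms of `Cs`. -/
lemma MI_le_Cs (a b P : Fin L → ℝ) (ha : ∀ l, 0 ≤ a l) (hb : ∀ l, 0 ≤ b l) (hP : ∀ l, 0 ≤ P l)
    (E : α → Measure (Fin n → Fin L → ℝ)) [∀ m, IsProbabilityMeasure (E m)]
    (hE : ∀ m, ∀ᵐ x ∂(E m), x ∈ perSubPow L P n) :
    MI a E ≠ ∞ ∧ (MI a E).toReal ≤ (MI b E).toReal + n * (Real.log 2 * ∑ l, Cs (P l) (a l) (b l)) := by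
  have h := MI_diff (fun l => max (a l) (b l)) b P hb (fun l => le_max_right _ _) hP E hE
  have hB := (MI_diff b b P hb (fun l => le_rfl) hP E hE).1
  have hm := MI_mono (fun l => max (a l) (b l)) a ha (fun l => le_max_left _ _) E
  refine ⟨ne_top_of_le_ne_top h.1 hm, ?_⟩
  have hl2 : 0 < Real.log 2 := Real.log_pos (by norm_num)
  have hC : ∀ l, (1/2) * Real.log (1 + max (a l) (b l) * P l) - (1/2) * Real.log (1 + b l * P l)
      = Real.log 2 * Cs (P l) (a l) (b l) := by
    intro l
    rw [Cs, mul_max_of_nonneg _ _ hl2.le, mul_zero]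
    have e : Real.log 2 * (1 / 2 * Real.logb 2 (1 + a l * P l) - 1 / 2 * Real.logb 2 (1 + b l * P l))
        = (1/2) * Real.log (1 + a l * P l) - (1/2) * Real.log (1 + b l * P l) := by
      simp only [Real.logb]; field_simp
    rw [e]
    rcases le_total (a l) (b l) with hab | hab
    · rw [max_eq_right hab, sub_self, max_eq_left]
      have := Real.log_le_log (by nlinarith [mul_nonneg (ha l) (hP l)])
        (by nlinarith [mul_le_mul_of_nonneg_right hab (hP l)] : 1 + a l * P l ≤ 1 + b l * P l)
      linarith
    · rw [max_eq_left hab, max_eq_right]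
      have := Real.log_le_log (by nlinarith [mul_nonneg (hb l) (hP l)])
        (by nlinarith [mul_le_mul_of_nonneg_right hab (hP l)] : 1 + b l * P l ≤ 1 + a l * P l)
      linarith
  have hC0 : ∀ l, 0 ≤ Cs (P l) (a l) (b l) := fun l => le_max_left _ _
  have hle := hm.trans h.2
  simp_rw [hC] at hle
  have hle' := ENNReal.toReal_mono (by simp [hB]) hle
  rw [ENNReal.toReal_add hB (by simp), ENNReal.toReal_ofReal] at hle'
  · rw [Finset.mul_sum, Finset.mul_sum]
    exact hle'
  · exact Finset.sum_nonneg fun l _ => mul_nonneg (by positivity) (mul_nonneg hl2.le (hC0 l))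

lemma fenchel_kl {Ω : Type*} [MeasurableSpace Ω] (μ ν : Measure Ω) [IsProbabilityMeasure μ]
    [IsProbabilityMeasure ν] (hfin : klDiv μ ν ≠ ∞) (A : Set Ω) (hA : MeasurableSet A)
    (s δ : ℝ) (hs : 0 < s) (hδ : 0 < δ) :
    Real.log s * μ.real A + Real.log δ * μ.real Aᶜ ≤
      (klDiv μ ν).toReal + s * ν.real A + δ * ν.real Aᶜ - 1 := by
  classical
  obtain ⟨hac, hintg⟩ := klDiv_ne_top_iff.1 hfin
  rw [toReal_klDiv_eq_integral_klFun hac]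
  have hi1 := (integrable_klFun_rnDeriv_iff hac).2 hintg
  set φ : Ω → ℝ := fun ω => A.indicator (fun _ => Real.log s) ω + Aᶜ.indicator (fun _ => Real.log δ) ω
  set ψ : Ω → ℝ := fun ω => A.indicator (fun _ => s) ω + Aᶜ.indicator (fun _ => δ) ω
  have hφμ : ∫ ω, φ ω ∂μ = Real.log s * μ.real A + Real.log δ * μ.real Aᶜ := by
    rw [integral_add ((integrable_const _).indicator hA) ((integrable_const _).indicator hA.compl),
      integral_indicator_const _ hA, integral_indicator_const _ hA.compl]
    simp [mul_comm]
  have hψν : ∫ ω, ψ ω ∂ν = s * ν.real A + δ * ν.real Aᶜ := by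
    rw [integral_add ((integrable_const _).indicator hA) ((integrable_const _).indicator hA.compl),
      integral_indicator_const _ hA, integral_indicator_const _ hA.compl]
    simp [mul_comm]
  have hφi : Integrable φ μ :=
    ((integrable_const _).indicator hA).add ((integrable_const _).indicator hA.compl)
  have hψi : Integrable ψ ν :=
    ((integrable_const _).indicator hA).add ((integrable_const _).indicator hA.compl)
  have hφ2 : ∫ ω, (μ.rnDeriv ν ω).toReal * φ ω ∂ν = ∫ ω, φ ω ∂μ := integral_rnDeriv_smul hac
  have hi2 : Integrable (fun ω => (μ.rnDeriv ν ω).toReal * φ ω) ν :=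
    (integrable_rnDeriv_smul_iff hac).2 hφi
  have hpt : ∀ ω, (μ.rnDeriv ν ω).toReal * φ ω ≤ klFun (μ.rnDeriv ν ω).toReal + (ψ ω - 1) := by
    intro ω
    have key : ∀ h t : ℝ, 0 ≤ h → 0 < t → h * Real.log t ≤ klFun h + (t - 1) := by
      intro h t hh ht
      rw [klFun_apply]
      rcases hh.eq_or_lt with h0 | h0
      · subst h0; simp; linarith
      · have := Real.log_le_sub_one_of_pos (div_pos ht h0)
        rw [Real.log_div ht.ne' h0.ne'] at this
        have := mul_le_mul_of_nonneg_left this hh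
        have e : h * (t / h - 1) = t - h := by field_simp
        nlinarith
    by_cases hω : ω ∈ A
    · have h1 : φ ω = Real.log s := by simp [φ, hω]
      have h2 : ψ ω = s := by simp [ψ, hω]
      rw [h1, h2]; exact key _ _ ENNReal.toReal_nonneg hs
    · have h1 : φ ω = Real.log δ := by simp [φ, hω]
      have h2 : ψ ω = δ := by simp [ψ, hω]
      rw [h1, h2]; exact key _ _ ENNReal.toReal_nonneg hδ
  have hi3 : Integrable (fun ω => ψ ω - 1) ν := hψi.sub (integrable_const 1)
  have h := integral_mono hi2 (hi1.add hi3) hpt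
  rw [hφ2, hφμ] at h
  simp only [Pi.add_apply] at h
  rw [integral_add hi1 hi3, integral_sub hψi (integrable_const 1), hψν] at h
  simp only [integral_const, probReal_univ, smul_eq_mul, one_mul] at h
  linarith

/-- Fano-type inequality. -/
lemma fano [StandardBorelSpace α] {β : Type*} [MeasurableSpace β] (κ : Kernel α β) [IsMarkovKernel κ] (ε : ℝ)
    (hε : 0 < ε) (hε1 : ε ≤ 1)
    (hfin : klDiv (unif α ⊗ₘ κ) ((unif α).prod (κ ∘ₘ unif α)) ≠ ∞)
    (dec : β → α) (hdec : Measurable dec)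
    (herr : (unif α ⊗ₘ κ).real {p | dec p.2 ≠ p.1} ≤ ε) :
    (1 - ε) * Real.log (Fintype.card α) ≤
      (klDiv (unif α ⊗ₘ κ) ((unif α).prod (κ ∘ₘ unif α))).toReal + ε - ε * Real.log ε := by
  set A : Set (α × β) := {p | dec p.2 = p.1}
  have hA : MeasurableSet A := measurableSet_eq_fun (hdec.comp measurable_snd) measurable_fst
  have hcard : (0:ℝ) < Fintype.card α := by exact_mod_cast Fintype.card_pos
  have hAc : Aᶜ = {p | dec p.2 ≠ p.1} := rfl
  have h := fenchel_kl _ _ hfin A hA (Fintype.card α) ε hcard hε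
  have hν : ((unif α).prod (κ ∘ₘ unif α)).real A = (Fintype.card α : ℝ)⁻¹ := by
    rw [Measure.real, Measure.prod_apply_symm hA]
    have : ∀ y, unif α ((fun x => (x, y)) ⁻¹' A) = (Fintype.card α : ℝ≥0∞)⁻¹ := by
      intro y
      have : (fun x => (x, y)) ⁻¹' A = {dec y} := by
        ext x; simp [A, eq_comm]
      rw [this, unif_singleton]
    simp [this]
  rw [hν, mul_inv_cancel₀ hcard.ne'] at h
  rw [← hAc] at herr
  have hμ : (unif α ⊗ₘ κ).real A = 1 - (unif α ⊗ₘ κ).real Aᶜ := by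
    rw [probReal_compl_eq_one_sub hA]; ring
  rw [hμ] at h
  have hν2 : ((unif α).prod (κ ∘ₘ unif α)).real Aᶜ ≤ 1 := measureReal_le_one
  have hlogε : Real.log ε ≤ 0 := Real.log_nonpos hε.le hε1
  have hlogK : 0 ≤ Real.log (Fintype.card α) := Real.log_nonneg (by exact_mod_cast Fintype.card_pos)
  nlinarith [mul_le_mul_of_nonneg_left hν2 hε.le, mul_nonneg (sub_nonneg.2 herr) hlogK,
    mul_nonneg (sub_nonneg.2 herr) (neg_nonneg.2 hlogε)]

end Converse


section Converse2
open InformationTheory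

variable {n L : ℕ}

lemma measurableSet_perSubPow (P : Fin L → ℝ) : MeasurableSet (perSubPow L P n) := by
  unfold perSubPow
  rw [Set.setOf_forall]
  exact MeasurableSet.iInter fun l => measurableSet_le (by fun_prop) (by fun_prop)

lemma converse_step {α : Type*} [MeasurableSpace α] [Fintype α] [MeasurableSingletonClass α]
    [Nonempty α] [StandardBorelSpace α]
    (a b P : Fin L → ℝ) (ha : ∀ l, 0 ≤ a l) (hb : ∀ l, 0 ≤ b l) (hP : ∀ l, 0 ≤ P l)
    (E : α → Measure (Fin n → Fin L → ℝ)) [∀ m, IsProbabilityMeasure (E m)]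
    (hE : ∀ m, ∀ᵐ x ∂(E m), x ∈ perSubPow L P n) (hn : 0 < n) (ε r : ℝ) (hε : 0 < ε) (hε1 : ε ≤ 1)
    (hr : n * r ≤ Real.logb 2 (Fintype.card α))
    (hMI : miBits (unif α ⊗ₘ (parK n b ∘ₖ fk E)) ≤ n * ε)
    (dec : (Fin n → Fin L → ℝ) → α) (hdec : Measurable dec)
    (herr : (unif α ⊗ₘ (parK n a ∘ₖ fk E)).real {p | dec p.2 ≠ p.1} ≤ ε) :
    (1 - ε) * (r * Real.log 2) ≤
      Real.log 2 * ∑ l, Cs (P l) (a l) (b l) + ε * Real.log 2 + ε - ε * Real.log ε := by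
  have hl2 : 0 < Real.log 2 := Real.log_pos (by norm_num)
  obtain ⟨hf, hle⟩ := MI_le_Cs a b P ha hb hP E hE
  have hF := fano _ ε hε hε1 hf dec hdec herr
  rw [miBits_compProd_unif] at hMI
  change (MI b E).toReal / Real.log 2 ≤ n * ε at hMI
  rw [div_le_iff₀ hl2] at hMI
  change _ ≤ (MI a E).toReal + ε - ε * Real.log ε at hF
  rw [Real.logb, le_div_iff₀ hl2] at hr
  have hn1 : (1:ℝ) ≤ n := by exact_mod_cast hn
  have hlogε : Real.log ε ≤ 0 := Real.log_nonpos hε.le hε1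
  have h1 : (1 - ε) * (n * r * Real.log 2) ≤ (1 - ε) * Real.log (Fintype.card α) :=
    mul_le_mul_of_nonneg_left hr (by linarith)
  have h2 : ε - ε * Real.log ε ≤ n * (ε - ε * Real.log ε) := by
    have : 0 ≤ ε - ε * Real.log ε := by nlinarith
    nlinarith
  have h3 : n * ((1 - ε) * (r * Real.log 2)) ≤
      n * (Real.log 2 * ∑ l, Cs (P l) (a l) (b l) + ε * Real.log 2 + ε - ε * Real.log ε) := by
    linarith
  exact le_of_mul_le_mul_left h3 (by linarith)

lemma limit_step (R C k : ℝ)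
    (h : ∀ ε > 0, ε ≤ 1 → (1 - ε) * ((R - k * ε) * Real.log 2) ≤
      Real.log 2 * C + ε * Real.log 2 + ε - ε * Real.log ε) : R ≤ C := by
  have hl2 : 0 < Real.log 2 := Real.log_pos (by norm_num)
  have hc1 : Filter.Tendsto (fun ε : ℝ => (1 - ε) * ((R - k * ε) * Real.log 2))
      (nhdsWithin 0 (Set.Ioi 0)) (nhds ((1 - 0) * ((R - k * 0) * Real.log 2))) := by
    apply Filter.Tendsto.mono_left _ nhdsWithin_le_nhds
    apply Continuous.tendsto (f := fun ε : ℝ => (1 - ε) * ((R - k * ε) * Real.log 2))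
    fun_prop
  have hc2 : Filter.Tendsto (fun ε : ℝ => Real.log 2 * C + ε * Real.log 2 + ε - ε * Real.log ε)
      (nhdsWithin 0 (Set.Ioi 0)) (nhds (Real.log 2 * C + 0 * Real.log 2 + 0 - 0 * Real.log 0)) := by
    apply Filter.Tendsto.mono_left _ nhdsWithin_le_nhds
    apply Continuous.tendsto (f := fun ε : ℝ => Real.log 2 * C + ε * Real.log 2 + ε - ε * Real.log ε)
    exact (by fun_prop : Continuous fun ε : ℝ => Real.log 2 * C + ε * Real.log 2 + ε).sub
      Real.continuous_mul_log
  have h3 := le_of_tendsto_of_tendsto hc1 hc2 (by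
    filter_upwards [Ioc_mem_nhdsGT (zero_lt_one (α := ℝ))] with ε hε
    exact h ε hε.1 hε.2)
  simp only [sub_zero, mul_zero, one_mul, zero_mul, add_zero] at h3
  rw [mul_comm] at h3
  exact le_of_mul_le_mul_left h3 hl2

theorem converse_part (L : ℕ) (a b₁ b₂ P : Fin L → ℝ)
    (ha : ∀ l, 0 ≤ a l) (hb₁ : ∀ l, 0 ≤ b₁ l) (hb₂ : ∀ l, 0 ≤ b₂ l)
    (hP : ∀ l, 0 ≤ P l) (R₁ R₂ : ℝ)
    (H : ParAchievable L a b₁ b₂ (perSubPow L P) R₁ R₂) :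
      R₁ ≤ ∑ l, Cs (P l) (a l) (b₁ l) ∧ R₁ + R₂ ≤ ∑ l, Cs (P l) (a l) (b₂ l) := by
  constructor
  · refine limit_step _ _ 1 fun ε hε hε1 => ?_
    obtain ⟨n, hn, K₁, K₂, hK₁, hK₂, hR₁, hR₂, enc, hprob, hpow, dec, hdec, herr, hM2, hM1⟩ := H ε hε
    have := Fin.pos_iff_nonempty.1 hK₁
    have := Fin.pos_iff_nonempty.1 hK₂
    have hp : ∀ m₁, IsProbabilityMeasure ((unif (Fin K₂)).bind (fun m₂ => enc (m₁, m₂))) := fun m₁ =>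
      isProbabilityMeasure_bind (measurable_of_finite _).aemeasurable
        (Filter.Eventually.of_forall fun z => inferInstance)
    rw [jointLawPar_map_eq hK₂] at hM1
    refine converse_step a b₁ P ha hb₁ hP
      (fun m₁ => (unif (Fin K₂)).bind (fun m₂ => enc (m₁, m₂))) ?_ hn ε _ hε hε1 ?_ hM1
      (fun y => (dec y).1) (measurable_fst.comp hdec) ?_
    · intro m
      rw [ae_iff]
      change ((unif (Fin K₂)).bind (fun m₂ => enc (m, m₂))) (perSubPow L P n)ᶜ = 0
      rw [Measure.bind_apply (measurableSet_perSubPow P).compl (measurable_of_finite _).aemeasurable]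
      simp [prob_compl_eq_one_sub (measurableSet_perSubPow P), hpow]
    · simpa using hR₁
    · rw [← jointLawPar_map_eq hK₂]
      refine le_trans ?_ herr
      have hm : Measurable (fun p : (Fin K₁ × Fin K₂) × (Fin n → Fin L → ℝ) => (p.1.1, p.2)) := by
        fun_prop
      have hms : MeasurableSet {p : Fin K₁ × (Fin n → Fin L → ℝ) | (dec p.2).1 ≠ p.1} :=
        (measurableSet_eq_fun ((measurable_fst.comp hdec).comp measurable_snd) measurable_fst).compl
      rw [Measure.real, Measure.map_apply hm hms, jointLawPar_eq]
      refine ENNReal.toReal_mono (measure_ne_top _ _) (measure_mono ?_)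
      rintro ⟨⟨m1, m2⟩, y⟩ h
      simp only [Set.mem_preimage, Set.mem_setOf_eq] at h ⊢
      intro hc; rw [hc] at h; exact h rfl
  · refine limit_step _ _ 2 fun ε hε hε1 => ?_
    obtain ⟨n, hn, K₁, K₂, hK₁, hK₂, hR₁, hR₂, enc, hprob, hpow, dec, hdec, herr, hM2, hM1⟩ := H ε hε
    have := Fin.pos_iff_nonempty.1 hK₁
    have := Fin.pos_iff_nonempty.1 hK₂
    rw [jointLawPar_eq] at hM2 herr
    refine converse_step a b₂ P ha hb₂ hP enc ?_ hn ε _ hε hε1 ?_ hM2 dec hdec herr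
    · intro m
      rw [ae_iff]
      change enc m (perSubPow L P n)ᶜ = 0
      simp [prob_compl_eq_one_sub (measurableSet_perSubPow P), hpow]
    · simp only [Fintype.card_prod, Fintype.card_fin, Nat.cast_mul]
      rw [Real.logb_mul (by positivity) (by positivity)]
      linarith

end Converse2


section OneShot
open InformationTheory

variable {X Y : Type*} [MeasurableSpace X] [MeasurableSpace Y] {J N : Type*} [Fintype J] [Fintype N]

lemma lintegral_pi_one (p : Measure X) [IsProbabilityMeasure p] (j : J) (φ : X → ℝ≥0∞)
    (hφ : Measurable φ) :
    ∫⁻ x : J → X, φ (x j) ∂(Measure.pi fun _ => p) = ∫⁻ x, φ x ∂p :=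
  (measurePreserving_eval (fun _ : J => p) j).lintegral_comp hφ

lemma lintegral_pi_two (p : Measure X) [IsProbabilityMeasure p] (j k : J) (hjk : j ≠ k)
    (φ : X × X → ℝ≥0∞) (hφ : Measurable φ) :
    ∫⁻ x : J → X, φ (x j, x k) ∂(Measure.pi fun _ => p) = ∫⁻ x, ∫⁻ x', φ (x, x') ∂p ∂p := by
  have hind : iIndepFun (fun (i : J) (ω : J → X) => ω i) (Measure.pi fun _ => p) :=
    iIndepFun_pi (X := fun _ x => x) (fun i => aemeasurable_id)
  have h2 := (indepFun_iff_map_prod_eq_prod_map_map (measurable_pi_apply j).aemeasurable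
    (measurable_pi_apply k).aemeasurable).1 (hind.indepFun hjk)
  have e : ∀ i : J, (Measure.pi fun _ : J => p).map (fun ω => ω i) = p :=
    fun i => (measurePreserving_eval (fun _ : J => p) i).map_eq
  rw [e, e] at h2
  rw [← lintegral_prod _ hφ.aemeasurable, ← h2, lintegral_map hφ (by fun_prop)]

lemma kl_pointwise [Nonempty N] (c : ℝ) (hc : 1 ≤ c) (F : N → ℝ) (hF : ∀ k, 0 < F k) :
    let h := (Fintype.card N : ℝ)⁻¹ * ∑ k, F k
    ENNReal.ofReal (klFun h) + 2 * ENNReal.ofReal h ≤ 1 +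
      ∑ k, (Fintype.card N : ℝ≥0∞)⁻¹ * (ENNReal.ofReal (F k * Real.log (c + F k / Fintype.card N)) +
        ENNReal.ofReal (F k / (c + F k / Fintype.card N)) *
          ((Fintype.card N : ℝ≥0∞)⁻¹ * ∑ j, ENNReal.ofReal (F j))) := by
  intro h
  have hn : (0:ℝ) < Fintype.card N := by exact_mod_cast Fintype.card_pos
  have hh : 0 < h := mul_pos (inv_pos.2 hn) (Finset.sum_pos (fun k _ => hF k) Finset.univ_nonempty)
  have hv : ∀ k, 1 ≤ c + F k / Fintype.card N := fun k => by
    have := div_pos (hF k) hn; linarith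
  have hlv : ∀ k, 0 ≤ Real.log (c + F k / Fintype.card N) := fun k => Real.log_nonneg (hv k)
  have e1 : (Fintype.card N : ℝ≥0∞)⁻¹ = ENNReal.ofReal (Fintype.card N : ℝ)⁻¹ := by
    rw [ENNReal.ofReal_inv_of_pos hn, ENNReal.ofReal_natCast]
  have e2 : (Fintype.card N : ℝ≥0∞)⁻¹ * ∑ j, ENNReal.ofReal (F j) = ENNReal.ofReal h := by
    rw [e1, ← ENNReal.ofReal_sum_of_nonneg (fun k _ => (hF k).le), ← ENNReal.ofReal_mul (inv_pos.2 hn).le]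
  have hsF : ∑ k, F k = Fintype.card N * h := by
    simp only [h]; field_simp
  rw [e2, e1]
  clear_value h
  have e3 : ∀ k, ENNReal.ofReal (Fintype.card N : ℝ)⁻¹ *
      (ENNReal.ofReal (F k * Real.log (c + F k / Fintype.card N)) +
        ENNReal.ofReal (F k / (c + F k / Fintype.card N)) * ENNReal.ofReal h) =
      ENNReal.ofReal ((Fintype.card N : ℝ)⁻¹ * (F k * Real.log (c + F k / Fintype.card N) +
        F k / (c + F k / Fintype.card N) * h)) := by
    intro k
    have := hv k
    have h3 : 0 ≤ F k / (c + F k / Fintype.card N) := div_nonneg (hF k).le (by linarith)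
    rw [ENNReal.ofReal_mul (inv_pos.2 hn).le, ENNReal.ofReal_add (mul_nonneg (hF k).le (hlv k))
      (mul_nonneg h3 hh.le), ENNReal.ofReal_mul h3]
  simp_rw [e3]
  have hnn : ∀ k ∈ Finset.univ, 0 ≤ (Fintype.card N : ℝ)⁻¹ * (F k * Real.log (c + F k / Fintype.card N) +
        F k / (c + F k / Fintype.card N) * h) := by
    intro k _
    have := hv k
    have h3 : 0 ≤ F k / (c + F k / Fintype.card N) := div_nonneg (hF k).le (by linarith)
    exact mul_nonneg (inv_pos.2 hn).le (add_nonneg (mul_nonneg (hF k).le (hlv k)) (mul_nonneg h3 hh.le))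
  rw [← ENNReal.ofReal_sum_of_nonneg hnn, ← ENNReal.ofReal_one, ← ENNReal.ofReal_add zero_le_one
    (Finset.sum_nonneg hnn)]
  have e4 : (2:ℝ≥0∞) * ENNReal.ofReal h = ENNReal.ofReal (2 * h) := by
    rw [ENNReal.ofReal_mul (by norm_num)]; simp
  rw [e4, ← ENNReal.ofReal_add (klFun_nonneg hh.le) (by linarith)]
  refine ENNReal.ofReal_le_ofReal ?_
  have key : ∀ k, F k * Real.log h ≤ F k * Real.log (c + F k / Fintype.card N) +
        F k / (c + F k / Fintype.card N) * h - F k := by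
    intro k
    have hv0 : 0 < c + F k / Fintype.card N := by have := hv k; linarith
    have := Real.log_le_sub_one_of_pos (div_pos hh hv0)
    rw [Real.log_div hh.ne' hv0.ne'] at this
    have := mul_le_mul_of_nonneg_left this (hF k).le
    have e : F k * (h / (c + F k / Fintype.card N) - 1) = F k / (c + F k / Fintype.card N) * h - F k := by
      field_simp
    linarith
  have hsum := Finset.sum_le_sum (fun k (_ : k ∈ Finset.univ) => key k)
  rw [← Finset.sum_mul, Finset.sum_sub_distrib] at hsum
  rw [hsF] at hsum
  rw [← Finset.mul_sum, klFun_apply]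
  have h5 := mul_le_mul_of_nonneg_left hsum (inv_pos.2 hn).le
  have e5 : (Fintype.card N : ℝ)⁻¹ * (Fintype.card N * h * Real.log h) = h * Real.log h := by
    field_simp
  have e6 : (Fintype.card N : ℝ)⁻¹ * (Fintype.card N * h) = h := by
    field_simp
  rw [e5, mul_sub, e6] at h5
  linarith

set_option maxHeartbeats 400000 in
/-- Soft covering (resolvability) bound. -/
lemma soft_cover [Nonempty N] (p : Measure X) [IsProbabilityMeasure p] (q : Measure Y)
    [IsProbabilityMeasure q] (f : X → Y → ℝ) (hfm : Measurable (Function.uncurry f))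
    (hf : ∀ x y, 0 < f x y) (hf1 : ∀ x, ∫⁻ y, ENNReal.ofReal (f x y) ∂q = 1)
    (c : ℝ) (hc : 1 ≤ c) (hcf : ∀ᵐ y ∂q, ∫⁻ x, ENNReal.ofReal (f x y) ∂p ≤ ENNReal.ofReal c)
    (e : N → J) (he : Function.Injective e) :
    ∫⁻ x : J → X, ∫⁻ y, ENNReal.ofReal (klFun ((Fintype.card N : ℝ)⁻¹ * ∑ k, f (x (e k)) y)) ∂q
      ∂(Measure.pi fun _ => p) ≤
    ∫⁻ x, ∫⁻ y, ENNReal.ofReal (f x y * Real.log (c + f x y / Fintype.card N)) ∂q ∂p := by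
  set μ : Measure (J → X) := Measure.pi fun _ => p
  set n : ℝ := (Fintype.card N : ℝ) with hndef
  set T := ∫⁻ x, ∫⁻ y, ENNReal.ofReal (f x y * Real.log (c + f x y / n)) ∂q ∂p
  have hn : (0:ℝ) < n := by simp only [n]; exact_mod_cast Fintype.card_pos
  clear_value n
  have hnE0 : (Fintype.card N : ℝ≥0∞) ≠ 0 := by simp
  have hnE1 : (Fintype.card N : ℝ≥0∞) ≠ ∞ := by simp
  -- measurability facts
  have hfxy : ∀ k : N, Measurable (fun z : (J → X) × Y => f (z.1 (e k)) z.2) := fun k =>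
    hfm.comp (by fun_prop : Measurable fun z : (J → X) × Y => (z.1 (e k), z.2))
  have hv : ∀ x y, 1 ≤ c + f x y / n := fun x y => by
    have := div_pos (hf x y) hn; linarith
  have hm1 : Measurable (Function.uncurry fun x y => ENNReal.ofReal (f x y * Real.log (c + f x y / n))) :=
    (hfm.mul (Real.measurable_log.comp ((hfm.div_const n).const_add c))).ennreal_ofReal
  have hm2 : Measurable (Function.uncurry fun x y => ENNReal.ofReal (f x y / (c + f x y / n))) :=
    (hfm.div ((hfm.div_const n).const_add c)).ennreal_ofReal
  have hm0 : Measurable (Function.uncurry fun x y => ENNReal.ofReal (f x y)) := hfm.ennreal_ofReal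
  -- two-point bounds
  set D1 := ∫⁻ x, ∫⁻ y, ENNReal.ofReal (f x y / (c + f x y / n)) * ENNReal.ofReal (f x y) ∂q ∂p
  set D2 := ∫⁻ x, ∫⁻ y, ENNReal.ofReal (f x y / (c + f x y / n)) ∂q ∂p
  have hD : (Fintype.card N : ℝ≥0∞)⁻¹ * D1 + ENNReal.ofReal c * D2 = 1 := by
    have hmD1 : Measurable fun x => ∫⁻ y, ENNReal.ofReal (f x y / (c + f x y / n)) * ENNReal.ofReal (f x y) ∂q :=
      (hm2.mul hm0).lintegral_prod_right'
    have hmD2 : Measurable fun x => ∫⁻ y, ENNReal.ofReal (f x y / (c + f x y / n)) ∂q :=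
      hm2.lintegral_prod_right'
    rw [← lintegral_const_mul _ hmD1, ← lintegral_const_mul _ hmD2,
      ← lintegral_add_left (hmD1.const_mul _)]
    rw [show (1:ℝ≥0∞) = ∫⁻ x, ∫⁻ y, ENNReal.ofReal (f x y) ∂q ∂p by simp [hf1]]
    refine lintegral_congr fun x => ?_
    have hx2 : Measurable fun y => ENNReal.ofReal (f x y / (c + f x y / n)) :=
      hm2.comp measurable_prodMk_left
    have hx0 : Measurable fun y => ENNReal.ofReal (f x y) := hm0.comp measurable_prodMk_left
    rw [← lintegral_const_mul _ (hx2.fun_mul hx0), ← lintegral_const_mul _ hx2,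
      ← lintegral_add_left ((hx2.fun_mul hx0).const_mul _)]
    refine lintegral_congr fun y => ?_
    have hv0 : 0 < c + f x y / n := by have := hv x y; linarith
    have h3 : 0 ≤ f x y / (c + f x y / n) := (div_pos (hf x y) hv0).le
    rw [show (Fintype.card N : ℝ≥0∞)⁻¹ = ENNReal.ofReal n⁻¹ by
      rw [ENNReal.ofReal_inv_of_pos hn, hndef, ENNReal.ofReal_natCast], ← ENNReal.ofReal_mul h3,
      ← ENNReal.ofReal_mul (inv_pos.2 hn).le, ← ENNReal.ofReal_mul (by linarith),
      ← ENNReal.ofReal_add (mul_nonneg (inv_pos.2 hn).le (mul_nonneg h3 (hf x y).le))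
        (mul_nonneg (by linarith) h3)]
    congr 1
    have hne : f x y + n * c ≠ 0 := by
      have := hf x y
      have : 0 < n * c := mul_pos hn (by linarith)
      linarith
    have hne' : n * c + f x y ≠ 0 := by rwa [add_comm]
    field_simp
    ring
  classical
  have hB : ∀ k j : N, ∫⁻ x, ∫⁻ y, ENNReal.ofReal (f (x (e k)) y / (c + f (x (e k)) y / n)) *
      ENNReal.ofReal (f (x (e j)) y) ∂q ∂μ ≤ (if j = k then D1 else 0) + ENNReal.ofReal c * D2 := by
    intro k j
    by_cases hjk : j = k
    · subst hjk
      rw [lintegral_pi_one p (e j) (fun x => ∫⁻ y, ENNReal.ofReal (f x y / (c + f x y / n)) *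
        ENNReal.ofReal (f x y) ∂q) (hm2.mul hm0).lintegral_prod_right']
      simp only [if_true]
      exact le_self_add
    · have hne : e k ≠ e j := fun h => hjk (he h).symm
      have hmm : Measurable (fun z : (X × X) × Y => ENNReal.ofReal (f z.1.1 z.2 / (c + f z.1.1 z.2 / n)) *
        ENNReal.ofReal (f z.1.2 z.2)) :=
        (hm2.comp (by fun_prop : Measurable fun z : (X × X) × Y => (z.1.1, z.2))).mul
          (hm0.comp (by fun_prop : Measurable fun z : (X × X) × Y => (z.1.2, z.2)))
      rw [lintegral_pi_two p (e k) (e j) hne (fun z => ∫⁻ y, ENNReal.ofReal (f z.1 y / (c + f z.1 y / n)) *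
        ENNReal.ofReal (f z.2 y) ∂q) hmm.lintegral_prod_right']
      simp only [hjk, if_false, zero_add]
      have hmD2 : Measurable fun x => ∫⁻ y, ENNReal.ofReal (f x y / (c + f x y / n)) ∂q :=
        hm2.lintegral_prod_right'
      rw [← lintegral_const_mul _ hmD2]
      refine lintegral_mono fun x => ?_
      have hx2 : Measurable fun y => ENNReal.ofReal (f x y / (c + f x y / n)) :=
        hm2.comp measurable_prodMk_left
      have hsw : Measurable (Function.uncurry fun (x' : X) (y : Y) =>
          ENNReal.ofReal (f x y / (c + f x y / n)) * ENNReal.ofReal (f x' y)) :=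
        hmm.comp (by fun_prop : Measurable fun z : X × Y => ((x, z.1), z.2))
      rw [lintegral_lintegral_swap hsw.aemeasurable, ← lintegral_const_mul _ hx2]
      refine lintegral_mono_ae ?_
      filter_upwards [hcf] with y hy
      have : Measurable fun x' => ENNReal.ofReal (f x' y) := hm0.comp measurable_prodMk_right
      rw [lintegral_const_mul _ this, mul_comm]
      gcongr
  -- main estimate
  have hmain : ∫⁻ x : J → X, ∫⁻ y, ENNReal.ofReal (klFun (n⁻¹ * ∑ k, f (x (e k)) y)) ∂q ∂μ + 2
      ≤ 1 + (T + 1) := by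
    have hmh : Measurable (fun z : (J → X) × Y => ENNReal.ofReal (n⁻¹ * ∑ k, f (z.1 (e k)) z.2)) :=
      ((Finset.measurable_sum _ fun k _ => hfxy k).const_mul _).ennreal_ofReal
    have hmkl : Measurable (fun z : (J → X) × Y => ENNReal.ofReal (klFun (n⁻¹ * ∑ k, f (z.1 (e k)) z.2))) :=
      (measurable_klFun.comp ((Finset.measurable_sum _ fun k _ => hfxy k).const_mul _)).ennreal_ofReal
    have h2 : ∫⁻ x : J → X, ∫⁻ y, 2 * ENNReal.ofReal (n⁻¹ * ∑ k, f (x (e k)) y) ∂q ∂μ = 2 := by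
      have : ∀ x : J → X, ∫⁻ y, 2 * ENNReal.ofReal (n⁻¹ * ∑ k, f (x (e k)) y) ∂q = 2 := by
        intro x
        have hmx : ∀ k, Measurable fun y => ENNReal.ofReal (f (x (e k)) y) :=
          fun k => hm0.comp measurable_prodMk_left
        simp_rw [ENNReal.ofReal_mul (inv_pos.2 hn).le,
          ENNReal.ofReal_sum_of_nonneg (fun k (_ : k ∈ Finset.univ) => (hf _ _).le)]
        rw [lintegral_const_mul _ ((Finset.measurable_sum _ fun k _ => hmx k).const_mul _),
          lintegral_const_mul _ (Finset.measurable_sum _ fun k _ => hmx k),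
          lintegral_finsetSum _ (fun k _ => hmx k)]
        simp only [hf1, Finset.sum_const, Finset.card_univ, nsmul_eq_mul, mul_one]
        rw [ENNReal.ofReal_inv_of_pos hn, hndef, ENNReal.ofReal_natCast, ENNReal.inv_mul_cancel hnE0 hnE1, mul_one]
      simp [this]
    rw [← h2, ← lintegral_add_left hmkl.lintegral_prod_right']
    have step : ∀ x : J → X, ∫⁻ y, ENNReal.ofReal (klFun (n⁻¹ * ∑ k, f (x (e k)) y)) ∂q +
        ∫⁻ y, 2 * ENNReal.ofReal (n⁻¹ * ∑ k, f (x (e k)) y) ∂q ≤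
        1 + ∑ k, (Fintype.card N : ℝ≥0∞)⁻¹ *
          (∫⁻ y, ENNReal.ofReal (f (x (e k)) y * Real.log (c + f (x (e k)) y / n)) ∂q +
          (Fintype.card N : ℝ≥0∞)⁻¹ * ∑ j, ∫⁻ y, ENNReal.ofReal (f (x (e k)) y / (c + f (x (e k)) y / n)) *
            ENNReal.ofReal (f (x (e j)) y) ∂q) := by
      intro x
      have hx0 : ∀ k, Measurable fun y => ENNReal.ofReal (f (x (e k)) y) :=
          fun k => hm0.comp measurable_prodMk_left
      have hx1 : ∀ k, Measurable fun y => ENNReal.ofReal (f (x (e k)) y * Real.log (c + f (x (e k)) y / n)) :=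
          fun k => hm1.comp measurable_prodMk_left
      have hx2 : ∀ k, Measurable fun y => ENNReal.ofReal (f (x (e k)) y / (c + f (x (e k)) y / n)) :=
          fun k => hm2.comp measurable_prodMk_left
      have hxs : ∀ k, Measurable fun y => ENNReal.ofReal (f (x (e k)) y / (c + f (x (e k)) y / n)) *
          ((Fintype.card N : ℝ≥0∞)⁻¹ * ∑ j, ENNReal.ofReal (f (x (e j)) y)) := fun k =>
        (hx2 k).mul ((Finset.measurable_sum _ fun j _ => hx0 j).const_mul _)
      have hmklx : Measurable fun y => ENNReal.ofReal (klFun (n⁻¹ * ∑ k, f (x (e k)) y)) :=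
        (measurable_klFun.comp ((Finset.measurable_sum _ fun k _ =>
          (hfm.comp measurable_prodMk_left : Measurable fun y => f (x (e k)) y)).const_mul _)).ennreal_ofReal
      rw [← lintegral_add_left hmklx]
      have kp := fun y => kl_pointwise c hc (fun k => f (x (e k)) y) (fun k => hf _ _)
      simp only [← hndef] at kp
      refine (lintegral_mono kp).trans ?_
      rw [lintegral_add_left measurable_const, lintegral_finsetSum _ (fun k _ =>
        ((hx1 k).fun_add (hxs k)).const_mul _)]
      simp only [lintegral_const, measure_univ, mul_one]
      refine add_le_add le_rfl (Finset.sum_le_sum fun k _ => ?_)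
      rw [lintegral_const_mul _ ((hx1 k).fun_add (hxs k)), lintegral_add_left (hx1 k)]
      gcongr
      rw [← lintegral_finsetSum _ (fun j _ => (hx2 k).fun_mul (hx0 j)),
        ← lintegral_const_mul _ (Finset.measurable_sum _ fun j _ => (hx2 k).fun_mul (hx0 j))]
      refine le_of_eq (lintegral_congr fun y => ?_)
      rw [← Finset.mul_sum]; ring
    refine (lintegral_mono step).trans ?_
    have hmT : ∀ k, Measurable fun x : J → X =>
        ∫⁻ y, ENNReal.ofReal (f (x (e k)) y * Real.log (c + f (x (e k)) y / n)) ∂q := fun k =>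
      hm1.lintegral_prod_right'.comp (measurable_pi_apply (e k))
    have hmB : ∀ k j, Measurable fun x : J → X => ∫⁻ y, ENNReal.ofReal (f (x (e k)) y / (c + f (x (e k)) y / n)) *
            ENNReal.ofReal (f (x (e j)) y) ∂q := fun k j =>
      Measurable.lintegral_prod_right' (f := fun z : (J → X) × Y =>
        ENNReal.ofReal (f (z.1 (e k)) z.2 / (c + f (z.1 (e k)) z.2 / n)) * ENNReal.ofReal (f (z.1 (e j)) z.2))
        (((hfxy k).div (((hfxy k).div_const n).const_add c)).ennreal_ofReal.mul (hfxy j).ennreal_ofReal)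
    have hmB' : ∀ k, Measurable fun x : J → X => (Fintype.card N : ℝ≥0∞)⁻¹ * ∑ j,
        ∫⁻ y, ENNReal.ofReal (f (x (e k)) y / (c + f (x (e k)) y / n)) *
            ENNReal.ofReal (f (x (e j)) y) ∂q := fun k =>
      (Finset.measurable_sum _ fun j _ => hmB k j).const_mul _
    rw [lintegral_add_left measurable_const, lintegral_finsetSum _ (fun k _ =>
        ((hmT k).fun_add (hmB' k)).const_mul _)]
    simp only [lintegral_const, measure_univ, mul_one]
    gcongr
    have hk : ∀ k ∈ Finset.univ, ∫⁻ x, (Fintype.card N : ℝ≥0∞)⁻¹ *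
          (∫⁻ y, ENNReal.ofReal (f (x (e k)) y * Real.log (c + f (x (e k)) y / n)) ∂q +
          (Fintype.card N : ℝ≥0∞)⁻¹ * ∑ j, ∫⁻ y, ENNReal.ofReal (f (x (e k)) y / (c + f (x (e k)) y / n)) *
            ENNReal.ofReal (f (x (e j)) y) ∂q) ∂μ ≤ (Fintype.card N : ℝ≥0∞)⁻¹ * (T + 1) := by
      intro k _
      rw [lintegral_const_mul _ ((hmT k).fun_add (hmB' k)), lintegral_add_left (hmT k),
        lintegral_const_mul _ (Finset.measurable_sum _ fun j _ => hmB k j),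
        lintegral_finsetSum _ (fun j _ => hmB k j)]
      refine mul_le_mul_right (add_le_add (le_of_eq ?_) ?_) _
      · exact lintegral_pi_one p (e k) (fun x => ∫⁻ y, ENNReal.ofReal (f x y * Real.log (c + f x y / n)) ∂q)
          hm1.lintegral_prod_right'
      · refine (mul_le_mul_right (Finset.sum_le_sum fun j _ => hB k j) _).trans ?_
        rw [Finset.sum_add_distrib, Finset.sum_ite_eq' Finset.univ k, ← hD]
        simp only [Finset.mem_univ, if_true, Finset.sum_const, Finset.card_univ, nsmul_eq_mul, mul_add]
        rw [← mul_assoc _ (Fintype.card N : ℝ≥0∞), ENNReal.inv_mul_cancel hnE0 hnE1, one_mul]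
    refine (Finset.sum_le_sum hk).trans ?_
    simp only [Finset.sum_const, Finset.card_univ, nsmul_eq_mul]
    rw [← mul_assoc, ENNReal.mul_inv_cancel hnE0 hnE1, one_mul]
  have e2 : (1:ℝ≥0∞) + (T + 1) = T + 2 := by rw [add_comm, add_assoc]; norm_num
  rw [e2] at hmain
  exact (ENNReal.add_le_add_iff_right (by simp)).1 hmain

end OneShot


section OneShotRel
open InformationTheory

variable {X Y : Type*} [MeasurableSpace X] [MeasurableSpace Y] {J : Type*} [Fintype J]

/-- Missed-detection term. -/
def miss (q : Measure Y) (f : X → Y → ℝ) (τ : ℝ) (x : X) : ℝ≥0∞ :=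
  ∫⁻ y, (if f x y ≤ τ then ENNReal.ofReal (f x y) else 0) ∂q

/-- False-alarm term. -/
def alarm (q : Measure Y) (f : X → Y → ℝ) (τ : ℝ) (x x' : X) : ℝ≥0∞ :=
  ∫⁻ y, (if τ < f x' y then ENNReal.ofReal (f x y) else 0) ∂q

lemma measurable_miss (q : Measure Y) [IsProbabilityMeasure q] (f : X → Y → ℝ)
    (hfm : Measurable (Function.uncurry f)) (τ : ℝ) : Measurable (miss q f τ) := by
  refine Measurable.lintegral_prod_right' (f := fun z : X × Y =>
    if f z.1 z.2 ≤ τ then ENNReal.ofReal (f z.1 z.2) else 0) ?_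
  exact Measurable.ite (measurableSet_le hfm measurable_const) hfm.ennreal_ofReal measurable_const

lemma measurable_alarm (q : Measure Y) [IsProbabilityMeasure q] (f : X → Y → ℝ)
    (hfm : Measurable (Function.uncurry f)) (τ : ℝ) :
    Measurable (fun z : X × X => alarm q f τ z.1 z.2) := by
  refine Measurable.lintegral_prod_right' (f := fun z : (X × X) × Y =>
    if τ < f z.1.2 z.2 then ENNReal.ofReal (f z.1.1 z.2) else 0) ?_
  have h1 : Measurable fun z : (X × X) × Y => f z.1.1 z.2 :=
    hfm.comp (by fun_prop : Measurable fun z : (X × X) × Y => (z.1.1, z.2))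
  have h2 : Measurable fun z : (X × X) × Y => f z.1.2 z.2 :=
    hfm.comp (by fun_prop : Measurable fun z : (X × X) × Y => (z.1.2, z.2))
  exact Measurable.ite (measurableSet_lt measurable_const h2) h1.ennreal_ofReal measurable_const

lemma alarm_le (p : Measure X) [IsProbabilityMeasure p] (q : Measure Y)
    [IsProbabilityMeasure q] (f : X → Y → ℝ) (hfm : Measurable (Function.uncurry f))
    (hf1 : ∀ x, ∫⁻ y, ENNReal.ofReal (f x y) ∂q = 1)
    (c : ℝ) (hcf : ∀ᵐ y ∂q, ∫⁻ x, ENNReal.ofReal (f x y) ∂p ≤ ENNReal.ofReal c)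
    (τ : ℝ) (hτ : 0 < τ) :
    ∫⁻ x, ∫⁻ x', alarm q f τ x x' ∂p ∂p ≤ ENNReal.ofReal c / ENNReal.ofReal τ := by
  have hm0 : Measurable (Function.uncurry fun x y => ENNReal.ofReal (f x y)) := hfm.ennreal_ofReal
  rw [lintegral_lintegral_swap (measurable_alarm q f hfm τ).aemeasurable]
  have : ∀ x', ∫⁻ x, alarm q f τ x x' ∂p ≤ ENNReal.ofReal c / ENNReal.ofReal τ := by
    intro x'
    unfold alarm
    have hx' : Measurable fun y => f x' y := hfm.comp measurable_prodMk_left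
    have hsw : Measurable (Function.uncurry fun (x : X) (y : Y) =>
        if τ < f x' y then ENNReal.ofReal (f x y) else 0) :=
      Measurable.ite (measurableSet_lt measurable_const (hx'.comp measurable_snd)) hm0 measurable_const
    rw [lintegral_lintegral_swap hsw.aemeasurable]
    calc ∫⁻ y, ∫⁻ x, (if τ < f x' y then ENNReal.ofReal (f x y) else 0) ∂p ∂q
        ≤ ∫⁻ y, ENNReal.ofReal c * ((ENNReal.ofReal τ)⁻¹ * ENNReal.ofReal (f x' y)) ∂q := by
          refine lintegral_mono_ae ?_
          filter_upwards [hcf] with y hy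
          split_ifs with h
          · refine hy.trans ?_
            conv_lhs => rw [← mul_one (ENNReal.ofReal c)]
            gcongr
            rw [← ENNReal.inv_mul_cancel (a := ENNReal.ofReal τ) (by simpa using hτ) (by simp)]
            gcongr
          · simp
      _ = ENNReal.ofReal c / ENNReal.ofReal τ := by
          rw [lintegral_const_mul _ (hx'.ennreal_ofReal.const_mul _),
            lintegral_const_mul _ hx'.ennreal_ofReal, hf1, mul_one, div_eq_mul_inv]
  refine (lintegral_mono this).trans ?_
  simp

variable [DecidableEq J]

lemma reliab [Nonempty J] (p : Measure X) [IsProbabilityMeasure p] (q : Measure Y)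
    [IsProbabilityMeasure q] (f : X → Y → ℝ) (hfm : Measurable (Function.uncurry f))
    (hf1 : ∀ x, ∫⁻ y, ENNReal.ofReal (f x y) ∂q = 1)
    (c : ℝ) (hcf : ∀ᵐ y ∂q, ∫⁻ x, ENNReal.ofReal (f x y) ∂p ≤ ENNReal.ofReal c)
    (τ : ℝ) (hτ : 0 < τ) :
    Measurable (fun x : J → X => (Fintype.card J : ℝ≥0∞)⁻¹ * ∑ j, (miss q f τ (x j) +
      ∑ k ∈ Finset.univ.erase j, alarm q f τ (x j) (x k))) ∧
    ∫⁻ x : J → X, (Fintype.card J : ℝ≥0∞)⁻¹ * ∑ j, (miss q f τ (x j) +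
      ∑ k ∈ Finset.univ.erase j, alarm q f τ (x j) (x k)) ∂(Measure.pi fun _ => p) ≤
    ∫⁻ x, miss q f τ x ∂p + Fintype.card J * (ENNReal.ofReal c / ENNReal.ofReal τ) := by
  have hm1 : ∀ j, Measurable fun x : J → X => miss q f τ (x j) := fun j =>
    (measurable_miss q f hfm τ).comp (measurable_pi_apply j)
  have hm2 : ∀ j k, Measurable fun x : J → X => alarm q f τ (x j) (x k) := fun j k =>
    (measurable_alarm q f hfm τ).comp (by fun_prop : Measurable fun x : J → X => (x j, x k))
  have hm2s : ∀ j, Measurable fun x : J → X => ∑ k ∈ Finset.univ.erase j, alarm q f τ (x j) (x k) :=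
    fun j => Finset.measurable_sum _ fun k _ => hm2 j k
  have hm3 : ∀ j, Measurable fun x : J → X => miss q f τ (x j) +
      ∑ k ∈ Finset.univ.erase j, alarm q f τ (x j) (x k) := fun j => (hm1 j).add (hm2s j)
  have hm4 : Measurable fun x : J → X => ∑ j, (miss q f τ (x j) +
      ∑ k ∈ Finset.univ.erase j, alarm q f τ (x j) (x k)) := Finset.measurable_sum _ fun j _ => hm3 j
  refine ⟨hm4.const_mul _, ?_⟩
  rw [lintegral_const_mul _ hm4, lintegral_finsetSum _ (fun j _ => hm3 j)]
  have hj : ∀ j ∈ Finset.univ, ∫⁻ x : J → X, (miss q f τ (x j) +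
      ∑ k ∈ Finset.univ.erase j, alarm q f τ (x j) (x k)) ∂(Measure.pi fun _ => p) ≤
      ∫⁻ x, miss q f τ x ∂p + Fintype.card J * (ENNReal.ofReal c / ENNReal.ofReal τ) := by
    intro j _
    rw [lintegral_add_left (hm1 j), lintegral_finsetSum _ (fun k _ => hm2 j k),
      lintegral_pi_one p j _ (measurable_miss q f hfm τ)]
    gcongr
    have : ∀ k ∈ Finset.univ.erase j, ∫⁻ x : J → X, alarm q f τ (x j) (x k) ∂(Measure.pi fun _ => p) ≤
        ENNReal.ofReal c / ENNReal.ofReal τ := by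
      intro k hk
      rw [lintegral_pi_two p j k (Finset.ne_of_mem_erase hk).symm (fun z => alarm q f τ z.1 z.2)
        (measurable_alarm q f hfm τ)]
      exact alarm_le p q f hfm hf1 c hcf τ hτ
    refine (Finset.sum_le_sum this).trans ?_
    rw [Finset.sum_const, nsmul_eq_mul]
    gcongr
    exact Finset.card_le_univ _
  refine (mul_le_mul_right (Finset.sum_le_sum hj) _).trans ?_
  rw [Finset.sum_const, nsmul_eq_mul, Finset.card_univ, ← mul_assoc, ENNReal.inv_mul_cancel (by simp)
    (by simp), one_mul]

lemma dec_exists [Nonempty J] [MeasurableSpace J] [MeasurableSingletonClass J] (q : Measure Y)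
    (f : X → Y → ℝ) (hfm : Measurable (Function.uncurry f)) (τ : ℝ) (x : J → X) :
    ∃ dec : Y → J, Measurable dec ∧ ∀ j,
      (q.withDensity fun y => ENNReal.ofReal (f (x j) y)) {y | dec y ≠ j} ≤
      miss q f τ (x j) + ∑ k ∈ Finset.univ.erase j, alarm q f τ (x j) (x k) := by
  classical
  have hx : ∀ j, Measurable fun y => f (x j) y := fun j => hfm.comp measurable_prodMk_left
  let D : (J → Bool) → J := fun s => if h : ∃ j, s j = true then h.choose else Classical.arbitrary J
  let s : Y → J → Bool := fun y j => if τ < f (x j) y then true else false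
  have hs : Measurable s := measurable_pi_lambda _ fun j =>
    Measurable.ite (measurableSet_lt measurable_const (hx j)) measurable_const measurable_const
  have hD : Measurable fun y => D (s y) := (measurable_of_finite D).comp hs
  refine ⟨fun y => D (s y), hD, fun j => ?_⟩
  have hset : MeasurableSet {y | D (s y) ≠ j} :=
    (measurableSet_eq_fun hD measurable_const).compl
  rw [withDensity_apply _ hset, ← lintegral_indicator hset]
  have hm2 : ∀ k, Measurable fun y => if τ < f (x k) y then ENNReal.ofReal (f (x j) y) else 0 := fun k =>
    Measurable.ite (measurableSet_lt measurable_const (hx k)) (hx j).ennreal_ofReal measurable_const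
  have hm1 : Measurable fun y => if f (x j) y ≤ τ then ENNReal.ofReal (f (x j) y) else 0 :=
    Measurable.ite (measurableSet_le (hx j) measurable_const) (hx j).ennreal_ofReal measurable_const
  unfold miss alarm
  rw [← lintegral_finsetSum _ (fun k _ => hm2 k), ← lintegral_add_left hm1]
  refine lintegral_mono fun y => ?_
  by_cases hy : D (s y) = j
  · simp [Set.indicator_apply, hy]
  rw [Set.indicator_of_mem (show y ∈ {y | D (s y) ≠ j} from hy)]
  by_cases h1 : f (x j) y ≤ τ
  · simp [h1]
  · have hex : ∃ k, s y k = true := ⟨j, by simp [s, not_le.1 h1]⟩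
    have hsp : s y (D (s y)) = true := by
      simp only [D, dif_pos hex]; exact hex.choose_spec
    have h2 : τ < f (x (D (s y))) y := by simpa [s] using hsp
    refine le_trans ?_ le_add_self
    refine le_trans ?_ (Finset.single_le_sum (f := fun k => if τ < f (x k) y then ENNReal.ofReal (f (x j) y) else 0)
      (fun _ _ => zero_le) (Finset.mem_erase.2 ⟨hy, Finset.mem_univ _⟩))
    simp [h2]

end OneShotRel

section OneShotMain
open InformationTheory

variable {X Y : Type*} [MeasurableSpace X] [MeasurableSpace Y]

/-- A channel with density `f` w.r.t. a reference measure `q`, with input law dominated. -/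
structure GoodCh (p : Measure X) (W : Kernel X Y) (q : Measure Y) (f : X → Y → ℝ) (c : ℝ) : Prop where
  meas : Measurable (Function.uncurry f)
  pos : ∀ x y, 0 < f x y
  dens : ∀ x, W x = q.withDensity (fun y => ENNReal.ofReal (f x y))
  one : ∀ x, ∫⁻ y, ENNReal.ofReal (f x y) ∂q = 1
  dom : ∀ᵐ y ∂q, ∫⁻ x, ENNReal.ofReal (f x y) ∂p ≤ ENNReal.ofReal c

lemma bind_map_unif {N : Type*} [Fintype N] [Nonempty N] [MeasurableSpace N] [MeasurableSingletonClass N]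
    {p : Measure X} {W : Kernel X Y} {q : Measure Y} [IsProbabilityMeasure q] {f : X → Y → ℝ} {c : ℝ}
    (hW : GoodCh p W q f c) (x : N → X) :
    ((unif N).map x).bind W = q.withDensity
      (fun y => ENNReal.ofReal ((Fintype.card N : ℝ)⁻¹ * ∑ k, f (x k) y)) := by
  have hn : (0:ℝ) < Fintype.card N := by exact_mod_cast Fintype.card_pos
  have hx : Measurable x := measurable_of_finite x
  have hm : ∀ k, Measurable fun y => ENNReal.ofReal (f (x k) y) := fun k =>
    hW.meas.ennreal_ofReal.comp measurable_prodMk_left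
  ext s hs
  rw [Measure.bind_apply hs W.aemeasurable, lintegral_map (Kernel.measurable_coe _ hs) hx, lintegral_unif,
    withDensity_apply _ hs]
  simp_rw [hW.dens, withDensity_apply _ hs, ENNReal.ofReal_mul (inv_pos.2 hn).le,
    ENNReal.ofReal_sum_of_nonneg (fun k (_ : k ∈ Finset.univ) => (hW.pos _ _).le)]
  rw [lintegral_const_mul _ (Finset.measurable_sum _ fun k _ => hm k),
    lintegral_finsetSum _ (fun k _ => hm k), ENNReal.ofReal_inv_of_pos hn, ENNReal.ofReal_natCast]

lemma klDiv_bind_map_unif {N : Type*} [Fintype N] [Nonempty N] [MeasurableSpace N] [MeasurableSingletonClass N]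
    {p : Measure X} {W : Kernel X Y} [IsMarkovKernel W] {q : Measure Y} [IsProbabilityMeasure q]
    {f : X → Y → ℝ} {c : ℝ} (hW : GoodCh p W q f c) (x : N → X) :
    klDiv (((unif N).map x).bind W) q =
      ∫⁻ y, ENNReal.ofReal (klFun ((Fintype.card N : ℝ)⁻¹ * ∑ k, f (x k) y)) ∂q := by
  have hn : (0:ℝ) < Fintype.card N := by exact_mod_cast Fintype.card_pos
  have hx : Measurable x := measurable_of_finite x
  have : IsProbabilityMeasure ((unif N).map x) := Measure.isProbabilityMeasure_map hx.aemeasurable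
  have hp : IsProbabilityMeasure (((unif N).map x).bind W) :=
    isProbabilityMeasure_bind W.aemeasurable (Filter.Eventually.of_forall fun z => inferInstance)
  have hm : ∀ k, Measurable fun y => f (x k) y := fun k => hW.meas.comp measurable_prodMk_left
  have he := bind_map_unif hW x
  have : IsFiniteMeasure (q.withDensity
      (fun y => ENNReal.ofReal ((Fintype.card N : ℝ)⁻¹ * ∑ k, f (x k) y))) := by
    rw [← he]; infer_instance
  rw [he, klDiv_withDensity _ _ ((Finset.measurable_sum _ fun k _ => hm k).const_mul _).ennreal_ofReal]
  refine lintegral_congr fun y => ?_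
  rw [ENNReal.toReal_ofReal]
  exact mul_nonneg (inv_pos.2 hn).le (Finset.sum_nonneg fun k _ => (hW.pos _ _).le)

lemma unif_prod_map {M N : Type*} [Fintype M] [MeasurableSpace M] [MeasurableSingletonClass M]
    [Fintype N] [MeasurableSpace N] [MeasurableSingletonClass N] (x : M × N → X) :
    (unif M).bind (fun m => (unif N).map fun k => x (m, k)) = (unif (M × N)).map x := by
  ext s hs
  rw [Measure.bind_apply hs (measurable_of_finite _).aemeasurable, lintegral_unif,
    ← lintegral_indicator_one hs, lintegral_map (measurable_one.indicator hs) (measurable_of_finite _),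
    lintegral_unif, Fintype.sum_prod_type, Fintype.card_prod, Nat.cast_mul,
    ENNReal.mul_inv (by simp) (by simp), mul_assoc, Finset.mul_sum (s := Finset.univ)
      (a := (Fintype.card N : ℝ≥0∞)⁻¹)]
  congr 1
  refine Finset.sum_congr rfl fun m _ => ?_
  rw [← lintegral_indicator_one hs, lintegral_map (measurable_one.indicator hs) (measurable_of_finite _),
    lintegral_unif]

/-- The soft covering cost. -/
def softT (p : Measure X) (q : Measure Y) (f : X → Y → ℝ) (c N : ℝ) : ℝ≥0∞ :=
  ∫⁻ x, ∫⁻ y, ENNReal.ofReal (f x y * Real.log (c + f x y / N)) ∂q ∂p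

set_option maxHeartbeats 400000 in
/-- One-shot random coding theorem. -/
theorem one_shot {M₁ M₂ N : Type} [Fintype M₁] [Fintype M₂] [Fintype N] [Nonempty M₁] [Nonempty M₂]
    [Nonempty N] [MeasurableSpace M₁] [MeasurableSpace M₂] [MeasurableSpace N]
    [MeasurableSingletonClass M₁] [MeasurableSingletonClass M₂] [MeasurableSingletonClass N]
    (p : Measure X) [IsProbabilityMeasure p] (A : Set X) (hA : p Aᶜ = 0)
    (W₀ W₁ W₂ : Kernel X Y) [IsMarkovKernel W₀] [IsMarkovKernel W₁] [IsMarkovKernel W₂]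
    (q₀ q₁ q₂ : Measure Y) [IsProbabilityMeasure q₀] [IsProbabilityMeasure q₁] [IsProbabilityMeasure q₂]
    (f₀ f₁ f₂ : X → Y → ℝ) (c : ℝ) (hc : 1 ≤ c)
    (h₀ : GoodCh p W₀ q₀ f₀ c) (h₁ : GoodCh p W₁ q₁ f₁ c) (h₂ : GoodCh p W₂ q₂ f₂ c)
    (τ : ℝ) (hτ : 0 < τ) (s₁ s₂ : ℝ≥0∞) :
    ∃ x : (M₁ × M₂) × N → X, (∀ j, x j ∈ A) ∧ ∃ dec : Y → M₁ × M₂, Measurable dec ∧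
      ∫⁻ m, (((unif N).map fun k => x (m, k)).bind W₀) {y | dec y ≠ m} ∂(unif (M₁ × M₂)) +
      s₂ * ∫⁻ m, klDiv (((unif N).map fun k => x (m, k)).bind W₂) q₂ ∂(unif (M₁ × M₂)) +
      s₁ * ∫⁻ m₁, klDiv (((unif M₂).bind fun m₂ => (unif N).map fun k => x ((m₁, m₂), k)).bind W₁) q₁
        ∂(unif M₁) ≤
      (∫⁻ x, miss q₀ f₀ τ x ∂p + Fintype.card ((M₁ × M₂) × N) * (ENNReal.ofReal c / ENNReal.ofReal τ)) +
      s₂ * softT p q₂ f₂ c (Fintype.card N) + s₁ * softT p q₁ f₁ c (Fintype.card (M₂ × N)) := by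
  classical
  obtain ⟨hB, hBi⟩ := reliab (J := (M₁ × M₂) × N) p q₀ f₀ h₀.meas h₀.one c h₀.dom τ hτ
  set μ : Measure ((M₁ × M₂) × N → X) := Measure.pi fun _ => p with hμ
  set B : ((M₁ × M₂) × N → X) → ℝ≥0∞ := fun x => (Fintype.card ((M₁ × M₂) × N) : ℝ≥0∞)⁻¹ *
    ∑ j, (miss q₀ f₀ τ (x j) + ∑ k ∈ Finset.univ.erase j, alarm q₀ f₀ τ (x j) (x k)) with hBdef
  set G₂ : ((M₁ × M₂) × N → X) → ℝ≥0∞ := fun x =>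
    ∫⁻ m, klDiv (((unif N).map fun k => x (m, k)).bind W₂) q₂ ∂(unif (M₁ × M₂)) with hG₂
  set G₁ : ((M₁ × M₂) × N → X) → ℝ≥0∞ := fun x =>
    ∫⁻ m₁, klDiv (((unif M₂).bind fun m₂ => (unif N).map fun k => x ((m₁, m₂), k)).bind W₁) q₁
        ∂(unif M₁) with hG₁
  have key : ∀ {M N' : Type} [Fintype M] [Fintype N'] [Nonempty M] [Nonempty N'] [MeasurableSpace M]
      [MeasurableSingletonClass M] (e : M → N' → (M₁ × M₂) × N) (he : ∀ m, Function.Injective (e m))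
      (W : Kernel X Y) [IsMarkovKernel W] (q : Measure Y) [IsProbabilityMeasure q] (f : X → Y → ℝ)
      (h : GoodCh p W q f c),
      Measurable (fun x : (M₁ × M₂) × N → X => ∫⁻ m, (∫⁻ y, ENNReal.ofReal (klFun ((Fintype.card N' : ℝ)⁻¹ *
        ∑ k, f (x (e m k)) y)) ∂q) ∂(unif M)) ∧
      ∫⁻ x, ∫⁻ m, (∫⁻ y, ENNReal.ofReal (klFun ((Fintype.card N' : ℝ)⁻¹ *
        ∑ k, f (x (e m k)) y)) ∂q) ∂(unif M) ∂μ ≤ softT p q f c (Fintype.card N') := by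
    intro M N' _ _ _ _ _ _ e he W _ q _ f h
    have hm : ∀ m, Measurable fun x : (M₁ × M₂) × N → X => ∫⁻ y, ENNReal.ofReal (klFun
        ((Fintype.card N' : ℝ)⁻¹ * ∑ k, f (x (e m k)) y)) ∂q := fun m => by
      refine Measurable.lintegral_prod_right' (f := fun z : ((M₁ × M₂) × N → X) × Y =>
        ENNReal.ofReal (klFun ((Fintype.card N' : ℝ)⁻¹ * ∑ k, f (z.1 (e m k)) z.2))) ?_
      refine (measurable_klFun.comp ((Finset.measurable_sum _ fun k _ => ?_).const_mul _)).ennreal_ofReal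
      exact h.meas.comp (by fun_prop : Measurable fun z : ((M₁ × M₂) × N → X) × Y => (z.1 (e m k), z.2))
    simp_rw [lintegral_unif]
    have hms := Finset.measurable_sum Finset.univ fun m _ => hm m
    refine ⟨hms.const_mul _, ?_⟩
    rw [lintegral_const_mul _ hms, lintegral_finsetSum _ fun m _ => hm m]
    refine (mul_le_mul_right (Finset.sum_le_sum fun m _ => soft_cover p q f h.meas h.pos h.one c hc
      h.dom (e m) (he m)) _).trans ?_
    rw [Finset.sum_const, nsmul_eq_mul, Finset.card_univ, ← mul_assoc, ENNReal.inv_mul_cancel (by simp)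
      (by simp), one_mul]
    rfl
  have e₂ : G₂ = fun x => ∫⁻ m, (∫⁻ y, ENNReal.ofReal (klFun ((Fintype.card N : ℝ)⁻¹ *
        ∑ k, f₂ (x (m, k)) y)) ∂q₂) ∂(unif (M₁ × M₂)) := by
    funext x
    refine lintegral_congr fun m => ?_
    rw [klDiv_bind_map_unif h₂]
  have e₁ : G₁ = fun x => ∫⁻ m₁, (∫⁻ y, ENNReal.ofReal (klFun ((Fintype.card (M₂ × N) : ℝ)⁻¹ *
        ∑ k : M₂ × N, f₁ (x ((m₁, k.1), k.2)) y)) ∂q₁) ∂(unif M₁) := by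
    funext x
    refine lintegral_congr fun m => ?_
    rw [unif_prod_map (fun k : M₂ × N => x ((m, k.1), k.2)), klDiv_bind_map_unif h₁]
  obtain ⟨hm₂, hi₂⟩ := key (fun (m : M₁ × M₂) (k : N) => (m, k)) (fun m k k' h => by simpa using h)
    W₂ q₂ f₂ h₂
  obtain ⟨hm₁, hi₁⟩ := key (fun (m : M₁) (k : M₂ × N) => ((m, k.1), k.2))
    (fun m k k' h => by simp only [Prod.mk.injEq, true_and] at h; exact Prod.ext h.1 h.2) W₁ q₁ f₁ h₁
  rw [← e₂] at hm₂
  rw [← e₁] at hm₁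
  have hi₂' : ∫⁻ x, G₂ x ∂μ ≤ softT p q₂ f₂ c (Fintype.card N) := by rw [e₂]; exact hi₂
  have hi₁' : ∫⁻ x, G₁ x ∂μ ≤ softT p q₁ f₁ c (Fintype.card (M₂ × N)) := by rw [e₁]; exact hi₁
  have hnull : μ {x | ∃ j, x j ∉ A} = 0 := by
    have : {x : (M₁ × M₂) × N → X | ∃ j, x j ∉ A} = ⋃ j, (fun x => x j) ⁻¹' Aᶜ := by
      ext x; simp
    rw [this, measure_iUnion_null_iff]
    intro j
    exact (measurePreserving_eval (fun _ : (M₁ × M₂) × N => p) j).quasiMeasurePreserving.preimage_null hA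
  have hmF : Measurable fun x => B x + s₂ * G₂ x + s₁ * G₁ x :=
    (hB.add (hm₂.const_mul _)).add (hm₁.const_mul _)
  obtain ⟨x, hxN, hx⟩ := exists_notMem_null_le_lintegral hmF.aemeasurable hnull
  refine ⟨x, by simpa using hxN, ?_⟩
  obtain ⟨dec, hdec, hj⟩ := dec_exists (J := (M₁ × M₂) × N) q₀ f₀ h₀.meas τ x
  refine ⟨fun y => (dec y).1, measurable_fst.comp hdec, ?_⟩
  have hm₁' : Measurable fun x => s₁ * G₁ x := hm₁.const_mul _
  have hm₂' : Measurable fun x => s₂ * G₂ x := hm₂.const_mul _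
  rw [lintegral_add_right _ hm₁', lintegral_add_left hB, lintegral_const_mul _ hm₂,
    lintegral_const_mul _ hm₁] at hx
  refine le_trans ?_ (hx.trans (add_le_add (add_le_add hBi (mul_le_mul_right hi₂' _))
    (mul_le_mul_right hi₁' _)))
  refine add_le_add (add_le_add ?_ le_rfl) le_rfl
  have hset : ∀ m : M₁ × M₂, MeasurableSet {y | (dec y).1 ≠ m} := fun m =>
    (measurableSet_eq_fun (measurable_fst.comp hdec) measurable_const).compl
  rw [lintegral_unif, hBdef]
  simp only
  conv_rhs =>
    rw [Fintype.sum_prod_type, Fintype.card_prod (M₁ × M₂) N, Nat.cast_mul,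
      ENNReal.mul_inv (by simp) (by simp), mul_assoc, Finset.mul_sum (a := (Fintype.card N : ℝ≥0∞)⁻¹)]
  refine mul_le_mul_right (Finset.sum_le_sum fun m _ => ?_) _
  rw [Measure.bind_apply (hset m) W₀.aemeasurable, lintegral_map (Kernel.measurable_coe _ (hset m))
    (measurable_of_finite _), lintegral_unif]
  refine mul_le_mul_right (Finset.sum_le_sum fun k _ => ?_) _
  refine le_trans ?_ (hj (m, k))
  rw [h₀.dens]
  refine measure_mono fun y hy => ?_
  simp only [ne_eq, Set.mem_setOf_eq] at hy ⊢
  exact fun h => hy (by rw [h])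

end OneShotMain


section ScalarCode
open InformationTheory

lemma l1_dev {Ω : Type*} [MeasurableSpace Ω] (ν : Measure Ω) [IsProbabilityMeasure ν] (h : Ω → ℝ)
    (hm : Measurable h) (h2 : MemLp h 2 ν) (n : ℕ) :
    ∫⁻ z : Fin n → Ω, ENNReal.ofReal |∑ i, h (z i) - n * ∫ ω, h ω ∂ν| ∂(Measure.pi fun _ => ν) ≤
      ENNReal.ofReal (Real.sqrt (n * Var[h; ν])) := by
  set μ : Measure (Fin n → Ω) := Measure.pi fun _ => ν
  have hvar := variance_sum_pi (μ := fun _ : Fin n => ν) (X := fun _ => h) (fun _ => h2)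
  have hi : ∀ i, MemLp (fun z : Fin n → Ω => h (z i)) 2 μ := fun i =>
    h2.comp_measurePreserving (measurePreserving_eval (fun _ : Fin n => ν) i)
  have hintg : ∀ i, ∫ z, h (z i) ∂μ = ∫ ω, h ω ∂ν := fun i => by
    have := (measurePreserving_eval (fun _ : Fin n => ν) i).map_eq
    conv_rhs => rw [← this]
    rw [integral_map (measurable_pi_apply i).aemeasurable hm.aestronglyMeasurable]
  have hS : MemLp (fun z : Fin n → Ω => ∑ i, h (z i)) 2 μ := memLp_finsetSum _ fun i _ => hi i
  have hSint : ∫ z, ∑ i, h (z i) ∂μ = n * ∫ ω, h ω ∂ν := by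
    rw [integral_finsetSum _ (fun i _ => (hi i).integrable (by norm_num))]
    simp [hintg]
  have hv : Var[fun z : Fin n → Ω => ∑ i, h (z i); μ] = n * Var[h; ν] := by
    have : (∑ i : Fin n, fun ω : Fin n → Ω => h (ω i)) = fun z : Fin n → Ω => ∑ i, h (z i) := by
      ext z; simp
    rw [this] at hvar
    rw [hvar]; simp
  have hc : MemLp (fun z : Fin n → Ω => ∑ i, h (z i) - n * ∫ ω, h ω ∂ν) 2 μ := hS.sub (memLp_const _)
  have hsq : ∫ z, (∑ i, h (z i) - n * ∫ ω, h ω ∂ν)^2 ∂μ = n * Var[h; ν] := by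
    rw [← hv, variance_eq_integral hS.aestronglyMeasurable.aemeasurable, hSint]
  rw [← ofReal_integral_eq_lintegral_ofReal (hc.integrable (by norm_num)).abs
    (Filter.Eventually.of_forall fun _ => abs_nonneg _)]
  refine ENNReal.ofReal_le_ofReal (Real.le_sqrt_of_sq_le ?_)
  rw [← hsq]
  have habs : MemLp (fun z : Fin n → Ω => |∑ i, h (z i) - n * ∫ ω, h ω ∂ν|) 2 μ := hc.abs
  have h0 := variance_nonneg (fun z : Fin n → Ω => |∑ i, h (z i) - n * ∫ ω, h ω ∂ν|) μ
  rw [variance_eq_sub habs] at h0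
  simp only [Pi.pow_apply, sq_abs] at h0
  linarith

/-- Scalar memoryless Gaussian channel. -/
def scK (n : ℕ) (g : ℝ) : Kernel (Fin n → ℝ) (Fin n → ℝ) :=
  ⟨fun x => Measure.pi fun i => gaussianReal (Real.sqrt g * x i) 1,
    measurable_pi_measure (fun i (x : Fin n → ℝ) => gaussianReal (Real.sqrt g * x i) 1) fun i =>
      measurable_gaussianReal.comp ((by fun_prop : Measurable fun x : Fin n → ℝ =>
        ((Real.sqrt g * x i, (1 : NNReal)) : ℝ × NNReal)))⟩

lemma scK_apply (n : ℕ) (g : ℝ) (x : Fin n → ℝ) :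
    scK n g x = Measure.pi fun i => gaussianReal (Real.sqrt g * x i) 1 := rfl

instance (n : ℕ) (g : ℝ) : IsMarkovKernel (scK n g) :=
  ⟨fun x => by rw [scK_apply]; infer_instance⟩

/-- output variance -/
def ov (g : ℝ) (P : NNReal) : NNReal := (1 + g * P).toNNReal

lemma ov_pos (g : ℝ) (hg : 0 ≤ g) (P : NNReal) : ov g P ≠ 0 := by
  unfold ov
  have : 0 < 1 + g * P := by positivity
  simpa using this

lemma ov_coe (g : ℝ) (hg : 0 ≤ g) (P : NNReal) : (ov g P : ℝ) = 1 + g * P :=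
  Real.coe_toNNReal _ (by positivity)

/-- output reference measure -/
def sqm (n : ℕ) (g : ℝ) (P : NNReal) : Measure (Fin n → ℝ) := Measure.pi fun _ => gaussianReal 0 (ov g P)
/-- input measure -/
def sp (n : ℕ) (P : NNReal) : Measure (Fin n → ℝ) := Measure.pi fun _ => gaussianReal 0 P
/-- information density -/
def sS (n : ℕ) (g : ℝ) (P : NNReal) (x y : Fin n → ℝ) : ℝ := ∑ i, iota (ov g P) (Real.sqrt g * x i) (y i)
/-- density -/
def sf (n : ℕ) (g : ℝ) (P : NNReal) (x y : Fin n → ℝ) : ℝ := Real.exp (sS n g P x y)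

instance (n : ℕ) (g : ℝ) (P : NNReal) : IsProbabilityMeasure (sqm n g P) := by unfold sqm; infer_instance
instance (n : ℕ) (P : NNReal) : IsProbabilityMeasure (sp n P) := by unfold sp; infer_instance

lemma measurable_sS (n : ℕ) (g : ℝ) (P : NNReal) : Measurable (Function.uncurry (sS n g P)) := by
  have h : ∀ i, Measurable fun z : (Fin n → ℝ) × (Fin n → ℝ) =>
      iota (ov g P) (Real.sqrt g * z.1 i) (z.2 i) := fun i => by
    unfold iota
    fun_prop
  exact Finset.measurable_sum Finset.univ fun i _ => h i

lemma measurable_sf (n : ℕ) (g : ℝ) (P : NNReal) : Measurable (Function.uncurry (sf n g P)) :=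
  Real.measurable_exp.comp (measurable_sS n g P)

lemma scK_dens (n : ℕ) (g : ℝ) (hg : 0 ≤ g) (P : NNReal) (x : Fin n → ℝ) :
    scK n g x = (sqm n g P).withDensity (fun y => ENNReal.ofReal (sf n g P x y)) := by
  rw [scK_apply, sqm]
  have hd : ∀ i, gaussianReal (Real.sqrt g * x i) 1 = _ := fun i =>
    gaussian_withDensity (Real.sqrt g * x i) (ov g P) (ov_pos g hg P)
  have : ∀ i, IsProbabilityMeasure ((gaussianReal 0 (ov g P)).withDensity
      (fun y => ENNReal.ofReal (Real.exp (iota (ov g P) (Real.sqrt g * x i) y)))) := fun i => by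
    rw [← hd i]; infer_instance
  simp_rw [hd]
  rw [pi_withDensity (fun _ => gaussianReal 0 (ov g P)) (fun i y => ENNReal.ofReal (Real.exp (iota (ov g P) (Real.sqrt g * x i) y)))
    (fun i => by unfold iota; fun_prop)]
  congr 1
  ext y
  rw [sf, sS, Real.exp_sum, ENNReal.ofReal_prod_of_nonneg (fun i _ => (Real.exp_pos _).le)]

lemma sp_bind (n : ℕ) (g : ℝ) (hg : 0 ≤ g) (P : NNReal) : (sp n P).bind (scK n g) = sqm n g P := by
  have hV : Measurable fun x : ℝ => gaussianReal (Real.sqrt g * x) 1 :=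
    measurable_gaussianReal.comp (by fun_prop : Measurable fun x : ℝ =>
        ((Real.sqrt g * x, (1 : NNReal)) : ℝ × NNReal))
  have := pi_bind_pi (fun _ : Fin n => gaussianReal 0 P) (fun _ x => gaussianReal (Real.sqrt g * x) 1)
    (fun _ => hV)
  rw [sp, sqm]
  refine Eq.trans this ?_
  congr 1
  funext i
  rw [gaussian_bind, mul_zero]
  congr 1
  apply NNReal.coe_injective
  rw [ov_coe g hg]
  push_cast
  rw [Real.sq_sqrt hg]
  ring

lemma sf_one (n : ℕ) (g : ℝ) (hg : 0 ≤ g) (P : NNReal) (x : Fin n → ℝ) :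
    ∫⁻ y, ENNReal.ofReal (sf n g P x y) ∂(sqm n g P) = 1 := by
  have := scK_dens n g hg P x
  have h1 : scK n g x Set.univ = 1 := measure_univ
  rwa [this, withDensity_apply _ MeasurableSet.univ, Measure.restrict_univ] at h1

lemma sf_ae (n : ℕ) (g : ℝ) (hg : 0 ≤ g) (P : NNReal) :
    ∀ᵐ y ∂(sqm n g P), ∫⁻ x, ENNReal.ofReal (sf n g P x y) ∂(sp n P) = 1 := by
  have hm : Measurable (Function.uncurry fun x y => ENNReal.ofReal (sf n g P x y)) :=
    (measurable_sf n g P).ennreal_ofReal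
  have hm' : Measurable fun y => ∫⁻ x, ENNReal.ofReal (sf n g P x y) ∂(sp n P) :=
    hm.lintegral_prod_left'
  have : (sqm n g P).withDensity (fun y => ∫⁻ x, ENNReal.ofReal (sf n g P x y) ∂(sp n P)) =
      (sqm n g P).withDensity 1 := by
    rw [withDensity_one]
    conv_rhs => rw [← sp_bind n g hg P]
    ext s hs
    rw [Measure.bind_apply hs (scK n g).aemeasurable, withDensity_apply _ hs,
      lintegral_lintegral_swap]
    · refine lintegral_congr fun x => ?_
      rw [scK_dens n g hg P, withDensity_apply _ hs]
    · exact (hm.comp measurable_swap).aemeasurable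
  have h2 := (withDensity_eq_iff_of_sigmaFinite hm'.aemeasurable aemeasurable_const).1 this
  filter_upwards [h2] with y hy
  simpa using hy

end ScalarCode


section ScalarDev
open InformationTheory

/-- single-letter joint law -/
def rho (g : ℝ) (P : NNReal) : Measure (ℝ × ℝ) :=
  ((gaussianReal 0 P).prod (gaussianReal 0 1)).map (fun z => (z.1, Real.sqrt g * z.1 + z.2))

instance (g : ℝ) (P : NNReal) : IsProbabilityMeasure (rho g P) :=
  Measure.isProbabilityMeasure_map (by fun_prop)

/-- single-letter information density -/
def hh (g : ℝ) (P : NNReal) (z : ℝ × ℝ) : ℝ := iota (ov g P) (Real.sqrt g * z.1) z.2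

lemma measurable_hh (g : ℝ) (P : NNReal) : Measurable (hh g P) := by
  unfold hh iota; fun_prop

lemma memLp_sq_of_four {Ω : Type*} [MeasurableSpace Ω] {μ : Measure Ω} {u : Ω → ℝ} (h : MemLp u 4 μ) :
    MemLp (fun ω => u ω ^ 2) 2 μ := by
  have : ENNReal.HolderTriple 4 4 2 := ⟨by
    rw [← two_mul, show (4 : ℝ≥0∞) = 2 * 2 by norm_num, ENNReal.mul_inv (by simp) (by simp), ← mul_assoc,
      ENNReal.mul_inv_cancel (by simp) (by simp), one_mul]⟩
  have h2 : MemLp (fun ω => u ω * u ω) 2 μ := h.mul' h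
  simpa [pow_two] using h2

lemma hh_memLp (g : ℝ) (P : NNReal) : MemLp (hh g P) 2 (rho g P) := by
  unfold rho
  rw [memLp_map_measure_iff (measurable_hh g P).aestronglyMeasurable (by fun_prop)]
  set ν := (gaussianReal 0 P).prod (gaussianReal 0 1)
  have hx : MemLp (fun z : ℝ × ℝ => z.1) 4 ν :=
    (memLp_id_gaussianReal (μ := 0) (v := P) 4).comp_measurePreserving measurePreserving_fst
  have hw : MemLp (fun z : ℝ × ℝ => z.2) 4 ν :=
    (memLp_id_gaussianReal (μ := 0) (v := 1) 4).comp_measurePreserving measurePreserving_snd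
  have hu : MemLp (fun z : ℝ × ℝ => Real.sqrt g * z.1 + z.2) 4 ν := (hx.const_mul _).add hw
  have h1 := (memLp_sq_of_four hw).const_mul (1/2)
  have h2 := (memLp_sq_of_four hu).const_mul (1/(2 * (ov g P : ℝ)))
  have h3 := ((memLp_const ((1/2) * Real.log (ov g P))).sub h1).add h2
  refine h3.ae_eq (Filter.Eventually.of_forall fun z => ?_)
  simp only [hh, iota, Pi.add_apply, Pi.sub_apply, Function.comp_apply]
  ring

lemma hh_integral (g : ℝ) (hg : 0 ≤ g) (P : NNReal) :
    ∫ z, hh g P z ∂(rho g P) = (1/2) * Real.log (1 + g * P) := by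
  have hi : Integrable (hh g P) (rho g P) := (hh_memLp g P).integrable (by norm_num)
  unfold rho at *
  rw [integral_map (by fun_prop) (measurable_hh g P).aestronglyMeasurable]
  rw [integrable_map_measure (measurable_hh g P).aestronglyMeasurable (by fun_prop)] at hi
  have hi' : Integrable (fun z : ℝ × ℝ => hh g P (z.1, Real.sqrt g * z.1 + z.2))
    ((gaussianReal 0 P).prod (gaussianReal 0 1)) := hi
  rw [integral_prod _ hi']
  have : ∀ x, ∫ w, hh g P (x, Real.sqrt g * x + w) ∂(gaussianReal 0 1) =
      (1/2) * Real.log (ov g P) + ((Real.sqrt g * x)^2+1)/(2*(ov g P)) - 1/2 := by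
    intro x
    rw [← iota_integral]
    have : gaussianReal (Real.sqrt g * x) 1 = (gaussianReal 0 1).map (fun w => Real.sqrt g * x + w) := by
      rw [gaussianReal_map_const_add]; simp
    rw [this, integral_map (by fun_prop) (by unfold iota; fun_prop)]
    rfl
  simp only [this]
  have e : ∀ x : ℝ, (1/2) * Real.log (ov g P) + ((Real.sqrt g * x)^2+1)/(2*(ov g P)) - 1/2 =
      ((1/2) * Real.log (ov g P) + 1/(2*(ov g P)) - 1/2) + g / (2 * (ov g P)) * x^2 := by
    intro x
    rw [mul_pow, Real.sq_sqrt hg]; ring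
  simp only [e]
  rw [integral_add (integrable_const _) ((gaussian_sq_integrable 0 P).const_mul _), integral_const,
    integral_const_mul, gaussian_integral_sq, ov_coe g hg]
  simp only [probReal_univ, smul_eq_mul, one_mul]
  have : 0 < 1 + g * P := by positivity
  field_simp
  ring

lemma lintegral_joint (n : ℕ) (g : ℝ) (P : NNReal) (F : (Fin n → ℝ × ℝ) → ℝ≥0∞) (hF : Measurable F) :
    ∫⁻ x, ∫⁻ y, F (fun i => (x i, y i)) ∂(scK n g x) ∂(sp n P) =
      ∫⁻ z, F z ∂(Measure.pi fun _ => rho g P) := by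
  let V : ℝ → Measure (ℝ × ℝ) := fun x => (gaussianReal (Real.sqrt g * x) 1).map (fun y => (x, y))
  have hVp : ∀ x, IsProbabilityMeasure (V x) := fun x => Measure.isProbabilityMeasure_map (by fun_prop)
  have hV' : ∀ x, V x = (gaussianReal 0 1).map (fun w => (x, Real.sqrt g * x + w)) := by
    intro x
    have : gaussianReal (Real.sqrt g * x) 1 = (gaussianReal 0 1).map (fun w => Real.sqrt g * x + w) := by
      rw [gaussianReal_map_const_add]; simp
    simp only [V]
    rw [this, Measure.map_map (by fun_prop) (by fun_prop)]
    rfl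
  have hT : Measurable fun z : ℝ × ℝ => (z.1, Real.sqrt g * z.1 + z.2) := by fun_prop
  have hVs : ∀ s, MeasurableSet s → ∀ x, V x s = gaussianReal 0 1 (Prod.mk x ⁻¹' ((fun z : ℝ × ℝ =>
      (z.1, Real.sqrt g * z.1 + z.2)) ⁻¹' s)) := by
    intro s hs x
    rw [hV', Measure.map_apply (by fun_prop) hs]
    rfl
  have hVm : Measurable V := by
    refine Measure.measurable_of_measurable_coe _ fun s hs => ?_
    simp_rw [hVs s hs]
    exact measurable_measure_prodMk_left (hT hs)
  have hrho : (gaussianReal 0 P).bind V = rho g P := by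
    ext s hs
    rw [Measure.bind_apply hs hVm.aemeasurable, rho, Measure.map_apply hT hs, Measure.prod_apply (hT hs)]
    simp_rw [hVs s hs]
  have hb := pi_bind_pi (fun _ : Fin n => gaussianReal 0 P) (fun _ => V) (fun _ => hVm)
  have hpm : ∀ x : Fin n → ℝ, Measure.pi (fun i => V (x i)) = (scK n g x).map (fun y i => (x i, y i)) := by
    intro x
    rw [scK_apply, Measure.pi_map_pi (f := fun i y => (x i, y)) (fun i => by fun_prop)]
  rw [hrho] at hb
  rw [← hb, Measure.lintegral_bind (measurable_pi_measure (fun i (x : Fin n → ℝ) => V (x i))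
    (fun i => hVm.comp (measurable_pi_apply i))).aemeasurable hF.aemeasurable]
  refine lintegral_congr fun x => ?_
  rw [hpm, lintegral_map hF (by fun_prop)]

/-- First-moment deviation of the information density. -/
lemma dev (n : ℕ) (g : ℝ) (hg : 0 ≤ g) (P : NNReal) :
    ∫⁻ x, ∫⁻ y, ENNReal.ofReal |sS n g P x y - n * ((1/2) * Real.log (1 + g * P))| ∂(scK n g x) ∂(sp n P)
      ≤ ENNReal.ofReal (Real.sqrt (n * Var[hh g P; rho g P])) := by
  have h := l1_dev (rho g P) (hh g P) (measurable_hh g P) (hh_memLp g P) n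
  rw [hh_integral g hg] at h
  refine le_trans (le_of_eq ?_) h
  have hF : Measurable fun z : Fin n → ℝ × ℝ => ENNReal.ofReal |∑ i, hh g P (z i) -
      n * ((1/2) * Real.log (1 + g * P))| := by
    have : ∀ i, Measurable fun z : Fin n → ℝ × ℝ => hh g P (z i) := fun i =>
      (measurable_hh g P).comp (measurable_pi_apply i)
    exact ((Finset.measurable_sum _ fun i _ => this i).sub_const _).abs.ennreal_ofReal
  rw [← lintegral_joint n g P _ hF]
  rfl

/-- Power constraint holds with probability at least one half. -/
lemma pow_half (P' : NNReal) (P : ℝ) (hP : P' < P) :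
    ∃ n₀ : ℕ, ∀ n ≥ n₀, sp n P' {x | ∑ i, x i ^ 2 ≤ n * P}ᶜ ≤ 1/2 := by
  set V := Var[fun x : ℝ => x^2; gaussianReal 0 P'] with hV
  have hd : 0 < P - P' := by linarith
  obtain ⟨n₀, hn₀⟩ := exists_nat_ge (4 * V / (P - P')^2)
  refine ⟨n₀ + 1, fun n hn => ?_⟩
  have hn1 : (0:ℝ) < n := by exact_mod_cast (by omega : 0 < n)
  have hnV : 4 * V ≤ n * (P - P')^2 := by
    rw [div_le_iff₀ (by positivity)] at hn₀
    have : (n₀:ℝ) ≤ n := by exact_mod_cast (by omega : n₀ ≤ n)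
    nlinarith [sq_nonneg (P - P')]
  have h := l1_dev (gaussianReal 0 P') (fun x => x^2) (by fun_prop)
    (memLp_sq_of_four (memLp_id_gaussianReal (μ := 0) (v := P') 4)) n
  rw [gaussian_integral_sq] at h
  have hm : Measurable fun x : Fin n → ℝ => ENNReal.ofReal |∑ i, x i ^ 2 - n * ((P':ℝ) + 0^2)| := by
    fun_prop
  have h2 := meas_ge_le_lintegral_div (μ := sp n P') hm.aemeasurable
    (ε := ENNReal.ofReal (n * (P - P'))) 
    (by rw [Ne, ENNReal.ofReal_eq_zero, not_le]; positivity) ENNReal.ofReal_ne_top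
  have hsub : {x : Fin n → ℝ | ∑ i, x i ^ 2 ≤ n * P}ᶜ ⊆ {x : Fin n → ℝ | ENNReal.ofReal (n * (P - P')) ≤
      ENNReal.ofReal |∑ i, x i ^ 2 - n * ((P':ℝ) + 0^2)|} := by
    intro x hx
    simp only [Set.mem_compl_iff, Set.mem_setOf_eq, not_le] at hx ⊢
    refine ENNReal.ofReal_le_ofReal (le_trans ?_ (le_abs_self _))
    nlinarith
  refine (measure_mono hsub).trans (h2.trans ?_)
  refine (ENNReal.div_le_div_right h _).trans ?_
  rw [← ENNReal.ofReal_div_of_pos (by positivity), show (1/2 : ℝ≥0∞) = ENNReal.ofReal (1/2) by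
    rw [ENNReal.ofReal_div_of_pos (by norm_num)]; simp]
  refine ENNReal.ofReal_le_ofReal ?_
  rw [div_le_iff₀ (by positivity)]
  refine Real.sqrt_le_iff.2 ⟨by positivity, ?_⟩
  rw [← hV]
  nlinarith

end ScalarDev


section ScalarBounds
open InformationTheory

lemma cond_le_two {X : Type*} [MeasurableSpace X] (p : Measure X) [IsProbabilityMeasure p] (A : Set X)
    (hAm : MeasurableSet A) (hA : p Aᶜ ≤ 1/2) :
    IsProbabilityMeasure (ProbabilityTheory.cond p A) ∧ ProbabilityTheory.cond p A Aᶜ = 0 ∧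
      ProbabilityTheory.cond p A ≤ (2 : ℝ≥0∞) • p := by
  have h1 : (1/2 : ℝ≥0∞) ≤ p A := by
    have h := prob_add_prob_compl (μ := p) hAm
    by_contra hlt
    push Not at hlt
    have : p A + p Aᶜ < 1/2 + 1/2 := ENNReal.add_lt_add_of_lt_of_le (by
      exact ne_top_of_le_ne_top (by simp) hA) hlt hA
    rw [h, ENNReal.add_halves] at this
    exact lt_irrefl _ this
  have h0 : p A ≠ 0 := fun h => by rw [h] at h1; simp at h1
  refine ⟨cond_isProbabilityMeasure h0, ?_, ?_⟩
  · rw [cond_apply hAm]; simp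
  · rw [ProbabilityTheory.cond]
    refine Measure.le_iff.2 fun s hs => ?_
    rw [Measure.smul_apply, Measure.smul_apply, smul_eq_mul, smul_eq_mul]
    refine mul_le_mul' ?_ (Measure.restrict_apply_le _ _)
    rw [ENNReal.inv_le_iff_inv_le]
    simpa using h1

variable {n : ℕ} {P : NNReal} {p : Measure (Fin n → ℝ)}

lemma lintegral_two (hp : p ≤ (2 : ℝ≥0∞) • sp n P) (φ : (Fin n → ℝ) → ℝ≥0∞) :
    ∫⁻ x, φ x ∂p ≤ 2 * ∫⁻ x, φ x ∂(sp n P) := by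
  refine (lintegral_mono' hp le_rfl).trans ?_
  rw [lintegral_smul_measure]; rfl

lemma goodCh_sc (hp : p ≤ (2 : ℝ≥0∞) • sp n P) (g : ℝ) (hg : 0 ≤ g) :
    GoodCh p (scK n g) (sqm n g P) (sf n g P) 2 where
  meas := measurable_sf n g P
  pos x y := Real.exp_pos _
  dens := scK_dens n g hg P
  one := sf_one n g hg P
  dom := by
    filter_upwards [sf_ae n g hg P] with y hy
    refine (lintegral_two hp _).trans ?_
    rw [hy]; simp

lemma softT_le_gen {X Y : Type*} [MeasurableSpace X] [MeasurableSpace Y] (p p' : Measure X)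
    (hp : p ≤ (2 : ℝ≥0∞) • p') [IsProbabilityMeasure p'] (W : Kernel X Y) [IsMarkovKernel W] (q : Measure Y)
    (f s : X → Y → ℝ) (hf : ∀ x y, f x y = Real.exp (s x y)) (hs : Measurable (Function.uncurry s))
    (hd : ∀ x, W x = q.withDensity (fun y => ENNReal.ofReal (f x y)))
    (I v : ℝ) (hv : 0 ≤ v)
    (hdev : ∫⁻ x, ∫⁻ y, ENNReal.ofReal |s x y - I| ∂(W x) ∂p' ≤ ENNReal.ofReal v)
    (N : ℝ) (hN : Real.exp I ≤ N) :
    softT p q f 2 N ≤ ENNReal.ofReal (2 * (Real.log 3 + v)) := by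
  have hN0 : 0 < N := (Real.exp_pos _).trans_le hN
  have hmS : ∀ x, Measurable fun y => s x y := fun x => hs.comp measurable_prodMk_left
  have hpt : ∀ x y, Real.log (2 + f x y / N) ≤ Real.log 3 + |s x y - I| := by
    intro x y
    have h3 : (0:ℝ) < 3 := by norm_num
    rw [← Real.log_exp |s x y - I|, ← Real.log_mul h3.ne' (Real.exp_pos _).ne']
    have hq : 0 < f x y / N := div_pos (by rw [hf]; exact Real.exp_pos _) hN0
    refine Real.log_le_log (by linarith) ?_
    have h1 : f x y / N ≤ Real.exp |s x y - I| := by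
      calc f x y / N ≤ f x y / Real.exp I :=
            div_le_div_of_nonneg_left (by rw [hf]; exact (Real.exp_pos _).le) (Real.exp_pos _) hN
        _ = Real.exp (s x y - I) := by rw [Real.exp_sub, hf]
        _ ≤ _ := Real.exp_le_exp.2 (le_abs_self _)
    have h2 : 1 ≤ Real.exp |s x y - I| := Real.one_le_exp (abs_nonneg _)
    linarith
  have hin : ∀ x, ∫⁻ y, ENNReal.ofReal (f x y * Real.log (2 + f x y / N)) ∂q ≤
      ENNReal.ofReal (Real.log 3) + ∫⁻ y, ENNReal.ofReal |s x y - I| ∂(W x) := by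
    intro x
    have hmf : Measurable fun y => ENNReal.ofReal (f x y) := by
      simp only [hf]
      exact (Real.measurable_exp.comp (hmS x)).ennreal_ofReal
    have : ENNReal.ofReal (Real.log 3) = ∫⁻ y, ENNReal.ofReal (Real.log 3) ∂(W x) := by simp
    rw [this, ← lintegral_add_left measurable_const, hd,
      lintegral_withDensity_eq_lintegral_mul _ hmf (by
        exact measurable_const.add ((hmS x).sub_const _).abs.ennreal_ofReal)]
    refine lintegral_mono fun y => ?_
    simp only [Pi.mul_apply]
    rw [ENNReal.ofReal_mul (by rw [hf]; exact (Real.exp_pos _).le),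
      ← ENNReal.ofReal_add (Real.log_nonneg (by norm_num)) (abs_nonneg _)]
    gcongr
    exact hpt x y
  rw [softT]
  refine (lintegral_mono' hp le_rfl).trans ?_
  rw [lintegral_smul_measure, smul_eq_mul]
  rw [ENNReal.ofReal_mul (by norm_num), ENNReal.ofReal_ofNat]
  gcongr
  refine (lintegral_mono hin).trans ?_
  rw [lintegral_add_left measurable_const, ENNReal.ofReal_add (Real.log_nonneg (by norm_num)) hv]
  refine add_le_add (by simp) hdev

lemma miss_le_gen {X Y : Type*} [MeasurableSpace X] [MeasurableSpace Y] (p p' : Measure X)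
    (hp : p ≤ (2 : ℝ≥0∞) • p') [IsProbabilityMeasure p'] (W : Kernel X Y) [IsMarkovKernel W] (q : Measure Y)
    (f s : X → Y → ℝ) (hf : ∀ x y, f x y = Real.exp (s x y)) (hs : Measurable (Function.uncurry s))
    (hd : ∀ x, W x = q.withDensity (fun y => ENNReal.ofReal (f x y)))
    (I v : ℝ) 
    (hdev : ∫⁻ x, ∫⁻ y, ENNReal.ofReal |s x y - I| ∂(W x) ∂p' ≤ ENNReal.ofReal v)
    (d : ℝ) (hd0 : 0 < d) :
    ∫⁻ x, miss q f (Real.exp (I - d)) x ∂p ≤ ENNReal.ofReal (2 * (v / d)) := by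
  have hmS : ∀ x, Measurable fun y => s x y := fun x => hs.comp measurable_prodMk_left
  have hmS' : Measurable fun z : X × Y => ENNReal.ofReal |s z.1 z.2 - I| :=
    (hs.sub_const _).abs.ennreal_ofReal
  have hin : ∀ x, miss q f (Real.exp (I - d)) x ≤
      (ENNReal.ofReal d)⁻¹ * ∫⁻ y, ENNReal.ofReal |s x y - I| ∂(W x) := by
    intro x
    have hmf : Measurable fun y => ENNReal.ofReal (f x y) := by
      simp only [hf]
      exact (Real.measurable_exp.comp (hmS x)).ennreal_ofReal
    have hma : Measurable fun y => ENNReal.ofReal |s x y - I| :=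
      ((hmS x).sub_const _).abs.ennreal_ofReal
    rw [← lintegral_const_mul _ hma, hd,
      lintegral_withDensity_eq_lintegral_mul _ hmf (hma.const_mul _), miss]
    refine lintegral_mono fun y => ?_
    simp only [Pi.mul_apply]
    split_ifs with h
    · conv_lhs => rw [← mul_one (ENNReal.ofReal (f x y))]
      gcongr
      rw [← ENNReal.inv_mul_cancel (a := ENNReal.ofReal d) (by
        rw [Ne, ENNReal.ofReal_eq_zero, not_le]; exact hd0) ENNReal.ofReal_ne_top]
      gcongr
      rw [hf, Real.exp_le_exp] at h
      rw [abs_sub_comm]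
      refine le_trans ?_ (le_abs_self _)
      linarith
    · exact zero_le
  have hmi : Measurable fun x => ∫⁻ y, ENNReal.ofReal |s x y - I| ∂(W x) :=
    Measurable.lintegral_kernel_prod_right (κ := W)
      (f := fun x y => ENNReal.ofReal |s x y - I|) hmS'
  refine (lintegral_mono' hp le_rfl).trans ?_
  rw [lintegral_smul_measure, smul_eq_mul]
  rw [ENNReal.ofReal_mul (by norm_num), ENNReal.ofReal_ofNat]
  gcongr
  refine (lintegral_mono hin).trans ?_
  rw [lintegral_const_mul _ hmi, ENNReal.ofReal_div_of_pos hd0, mul_comm, div_eq_mul_inv]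
  gcongr

lemma sf_eq_exp (g : ℝ) (x y : Fin n → ℝ) : sf n g P x y = Real.exp (sS n g P x y) := rfl

lemma softT_le (hp : p ≤ (2 : ℝ≥0∞) • sp n P) (g : ℝ) (hg : 0 ≤ g) (N : ℝ)
    (hN : Real.exp (n * ((1/2) * Real.log (1 + g * P))) ≤ N) :
    softT p (sqm n g P) (sf n g P) 2 N ≤
      ENNReal.ofReal (2 * (Real.log 3 + Real.sqrt (n * Var[hh g P; rho g P]))) :=
  softT_le_gen p (sp n P) hp (scK n g) (sqm n g P) (sf n g P) (sS n g P) (sf_eq_exp g)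
    (measurable_sS n g P) (scK_dens n g hg P) _ _ (Real.sqrt_nonneg _) (dev n g hg P) N hN

lemma miss_le (hn : 0 < n) (hp : p ≤ (2 : ℝ≥0∞) • sp n P) (g : ℝ) (hg : 0 ≤ g) (δ : ℝ) (hδ : 0 < δ) :
    ∫⁻ x, miss (sqm n g P) (sf n g P) (Real.exp (n * ((1/2) * Real.log (1 + g * P) - δ))) x ∂p ≤
      ENNReal.ofReal (2 * (Real.sqrt (n * Var[hh g P; rho g P]) / (n * δ))) := by
  have hn' : (0:ℝ) < n := by exact_mod_cast hn
  rw [mul_sub]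
  exact miss_le_gen p (sp n P) hp (scK n g) (sqm n g P) (sf n g P) (sS n g P) (sf_eq_exp g)
    (measurable_sS n g P) (scK_dens n g hg P) _ _ (dev n g hg P) (n * δ) (by positivity)

end ScalarBounds


section ScalarCode
open InformationTheory Filter Topology

/-- Half-log capacity in nats. -/
def Cn (g P : ℝ) : ℝ := (1/2) * Real.log (1 + g * P)

def ScalarCode (n : ℕ) (a b₁ b₂ P : ℝ) (K₁ K₂ : ℕ) (ε : ℝ) : Prop :=
  ∃ enc : Fin K₁ × Fin K₂ → Measure (Fin n → ℝ), (∀ m, IsProbabilityMeasure (enc m)) ∧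
    (∀ m, enc m {x | ∑ i, x i ^ 2 ≤ n * P} = 1) ∧
    (∃ dec : (Fin n → ℝ) → Fin K₁ × Fin K₂, Measurable dec ∧
      ∫⁻ m, ((enc m).bind (scK n a)) {y | dec y ≠ m} ∂(unif (Fin K₁ × Fin K₂)) ≤ ENNReal.ofReal ε) ∧
    (∃ Q : Measure (Fin n → ℝ), IsProbabilityMeasure Q ∧
      ∫⁻ m, klDiv ((enc m).bind (scK n b₂)) Q ∂(unif (Fin K₁ × Fin K₂)) ≤ ENNReal.ofReal (n * ε)) ∧
    (∃ Q : Measure (Fin n → ℝ), IsProbabilityMeasure Q ∧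
      ∫⁻ m₁, klDiv (((unif (Fin K₂)).bind fun m₂ => enc (m₁, m₂)).bind (scK n b₁)) Q ∂(unif (Fin K₁))
        ≤ ENNReal.ofReal (n * ε))

def totB (V₀ V₁ V₂ δ : ℝ) (n : ℕ) : ℝ :=
  2 * (Real.sqrt (n * V₀) / (n * δ)) + 16 * Real.exp (-(2 * n * δ)) +
    (1/n) * (2 * (Real.log 3 + Real.sqrt (n * V₂))) + (1/n) * (2 * (Real.log 3 + Real.sqrt (n * V₁)))

lemma totB_tendsto (V₀ V₁ V₂ δ : ℝ) (hδ : 0 < δ) : Tendsto (totB V₀ V₁ V₂ δ) atTop (𝓝 0) := by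
  have h1 : Tendsto (fun n : ℕ => 1 / (n:ℝ)) atTop (𝓝 0) := tendsto_one_div_atTop_nhds_zero_nat
  have hs : ∀ V : ℝ, Tendsto (fun n : ℕ => Real.sqrt (n * V) / n) atTop (𝓝 0) := by
    intro V
    have : Tendsto (fun n : ℕ => Real.sqrt (1 / (n:ℝ)) * Real.sqrt V) atTop (𝓝 (Real.sqrt 0 * Real.sqrt V)) :=
      ((Real.continuous_sqrt.tendsto 0).comp h1).mul_const _
    rw [Real.sqrt_zero, zero_mul] at this
    refine this.congr fun n => ?_
    rw [Real.sqrt_mul (Nat.cast_nonneg n), mul_div_right_comm, Real.sqrt_div_self', Real.sqrt_div zero_le_one,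
      Real.sqrt_one]
  have he : Tendsto (fun n : ℕ => Real.exp (-(2 * n * δ))) atTop (𝓝 0) := by
    refine Real.tendsto_exp_neg_atTop_nhds_zero.comp ?_
    have : Tendsto (fun n : ℕ => (n:ℝ) * (2 * δ)) atTop atTop :=
      tendsto_natCast_atTop_atTop.atTop_mul_const (by positivity)
    refine this.congr fun n => by ring
  have := ((((hs V₀).const_mul (2 / δ)).add (he.const_mul 16)).add
    (((h1.mul_const (Real.log 3)).add (hs V₂)).const_mul 2)).add
    (((h1.mul_const (Real.log 3)).add (hs V₁)).const_mul 2)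
  simp only [mul_zero, zero_mul, add_zero] at this
  refine this.congr fun n => ?_
  rw [totB]
  rcases Nat.eq_zero_or_pos n with rfl | hn
  · simp
  have : (n:ℝ) ≠ 0 := by positivity
  field_simp

lemma scalar_core {n : ℕ} (hn : 0 < n) (P' : NNReal) (P a b₁ b₂ : ℝ) (ha : 0 ≤ a) (hb₁ : 0 ≤ b₁) (hb₂ : 0 ≤ b₂)
    (hA : sp n P' {x | ∑ i, x i ^ 2 ≤ n * P}ᶜ ≤ 1/2) (δ : ℝ) (hδ : 0 < δ) (K₁ K₂ N : ℕ)
    (hK₁ : 0 < K₁) (hK₂ : 0 < K₂) (hN : 0 < N)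
    (hN₂ : Real.exp (n * Cn b₂ P') ≤ N)
    (hN₁ : K₁ = 1 ∨ Real.exp (n * Cn b₁ P') ≤ K₂ * N)
    (hJ : (K₁ * K₂ * N : ℝ) ≤ 8 * Real.exp (n * (Cn a P' - 3 * δ))) (ε : ℝ)
    (hε : totB Var[hh a P'; rho a P'] Var[hh b₁ P'; rho b₁ P'] Var[hh b₂ P'; rho b₂ P'] δ n ≤ ε) :
    ScalarCode n a b₁ b₂ P K₁ K₂ ε := by
  haveI : Nonempty (Fin K₁) := ⟨⟨0, hK₁⟩⟩
  haveI : Nonempty (Fin K₂) := ⟨⟨0, hK₂⟩⟩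
  haveI : Nonempty (Fin N) := ⟨⟨0, hN⟩⟩
  have hn' : (0:ℝ) < n := by exact_mod_cast hn
  set A : Set (Fin n → ℝ) := {x | ∑ i, x i ^ 2 ≤ n * P} with hAdef
  have hAm : MeasurableSet A := measurableSet_le (by fun_prop) measurable_const
  obtain ⟨hp1, hp2, hp3⟩ := cond_le_two (sp n P') A hAm hA
  set p := ProbabilityTheory.cond (sp n P') A
  set τ := Real.exp (n * ((1/2) * Real.log (1 + a * P') - δ)) with hτ
  have hτ0 : 0 < τ := Real.exp_pos _
  set s₁ : ℝ≥0∞ := if K₁ = 1 then 0 else ENNReal.ofReal (1/n) with hs₁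
  set s₂ : ℝ≥0∞ := ENNReal.ofReal (1/n) with hs₂
  obtain ⟨x, hxA, dec, hdec, hsum⟩ := one_shot (M₁ := Fin K₁) (M₂ := Fin K₂) (N := Fin N) p A hp2
    (scK n a) (scK n b₁) (scK n b₂) (sqm n a P') (sqm n b₁ P') (sqm n b₂ P')
    (sf n a P') (sf n b₁ P') (sf n b₂ P') 2 (by norm_num)
    (goodCh_sc hp3 a ha) (goodCh_sc hp3 b₁ hb₁) (goodCh_sc hp3 b₂ hb₂) τ hτ0 s₁ s₂
  have hB0 : ∫⁻ x, miss (sqm n a P') (sf n a P') τ x ∂p ≤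
      ENNReal.ofReal (2 * (Real.sqrt (n * Var[hh a P'; rho a P']) / (n * δ))) := miss_le hn hp3 a ha δ hδ
  have hBJ : (Fintype.card ((Fin K₁ × Fin K₂) × Fin N) : ℝ≥0∞) * (ENNReal.ofReal 2 / ENNReal.ofReal τ) ≤
      ENNReal.ofReal (16 * Real.exp (-(2 * n * δ))) := by
    rw [← ENNReal.ofReal_div_of_pos hτ0, ← ENNReal.ofReal_natCast, ← ENNReal.ofReal_mul (by positivity)]
    apply ENNReal.ofReal_le_ofReal
    simp only [Fintype.card_prod, Fintype.card_fin, Nat.cast_mul]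
    calc (K₁ * K₂ * N : ℝ) * (2 / τ) ≤ (8 * Real.exp (n * (Cn a P' - 3 * δ))) * (2 / τ) := by gcongr
      _ = 16 * (Real.exp (n * (Cn a P' - 3 * δ)) / τ) := by ring
      _ = _ := by rw [hτ, ← Real.exp_sub, Cn]; congr 2; ring
  have hB2 : softT p (sqm n b₂ P') (sf n b₂ P') 2 (Fintype.card (Fin N)) ≤
      ENNReal.ofReal (2 * (Real.log 3 + Real.sqrt (n * Var[hh b₂ P'; rho b₂ P']))) :=
    softT_le hp3 b₂ hb₂ _ (by simpa [Cn] using hN₂)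
  have hB1 : s₁ * softT p (sqm n b₁ P') (sf n b₁ P') 2 (Fintype.card (Fin K₂ × Fin N)) ≤
      ENNReal.ofReal (1/n) *
        ENNReal.ofReal (2 * (Real.log 3 + Real.sqrt (n * Var[hh b₁ P'; rho b₁ P']))) := by
    by_cases hK : K₁ = 1
    · simp [hs₁, hK]
    · have h := hN₁.resolve_left hK
      rw [hs₁, if_neg hK]
      gcongr
      exact softT_le hp3 b₁ hb₁ _ (by simpa [Cn] using h)
  have hl3 : 0 ≤ Real.log 3 := Real.log_nonneg (by norm_num)
  have htot := hsum.trans ((add_le_add (add_le_add (add_le_add hB0 hBJ) (mul_le_mul_right hB2 s₂)) hB1).trans (c := ENNReal.ofReal ε) (by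
    rw [hs₂, ← ENNReal.ofReal_mul (by positivity), ← ENNReal.ofReal_mul (by positivity),
      ← ENNReal.ofReal_add (by positivity) (by positivity), ← ENNReal.ofReal_add (by positivity) (by positivity),
      ← ENNReal.ofReal_add (by positivity) (by positivity)]
    exact ENNReal.ofReal_le_ofReal hε))
  have hmul : ∀ T : ℝ≥0∞, ENNReal.ofReal (1/n) * T ≤ ENNReal.ofReal ε → T ≤ ENNReal.ofReal (n * ε) := by
    intro T hT
    rw [ENNReal.ofReal_mul hn'.le]
    refine le_trans ?_ (mul_le_mul_right hT _)
    rw [← mul_assoc, ← ENNReal.ofReal_mul hn'.le]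
    rw [mul_one_div_cancel hn'.ne']; simp
  have hmx : ∀ m, Measurable fun k => x (m, k) := fun m => measurable_of_finite _
  have hencp : ∀ m, IsProbabilityMeasure ((unif (Fin N)).map fun k => x (m, k)) := fun m =>
    Measure.isProbabilityMeasure_map (hmx m).aemeasurable
  refine ⟨fun m => (unif (Fin N)).map fun k => x (m, k), hencp, ?_, ⟨dec, hdec, ?_⟩, ⟨sqm n b₂ P', inferInstance, ?_⟩, ?_⟩
  · intro m
    rw [Measure.map_apply (hmx m) hAm]
    have : (fun k => x (m, k)) ⁻¹' A = Set.univ := by ext k; simpa using hxA (m, k)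
    rw [this, measure_univ]
  · exact le_trans (le_trans le_self_add le_self_add) htot
  · apply hmul
    exact le_trans (le_trans le_add_self le_self_add) htot
  · by_cases hK : K₁ = 1
    · subst hK
      haveI : ∀ m₂, IsProbabilityMeasure ((unif (Fin N)).map fun k => x (((0 : Fin 1), m₂), k)) := fun m₂ => hencp _
      refine ⟨((unif (Fin K₂)).bind fun m₂ => (unif (Fin N)).map fun k => x (((0 : Fin 1), m₂), k)).bind (scK n b₁), ?_, ?_⟩
      · haveI : IsProbabilityMeasure ((unif (Fin K₂)).bind fun m₂ => (unif (Fin N)).map fun k => x (((0 : Fin 1), m₂), k)) :=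
          isProbabilityMeasure_bind (measurable_of_finite _).aemeasurable (Filter.Eventually.of_forall this)
        exact isProbabilityMeasure_bind (scK n b₁).measurable.aemeasurable (Filter.Eventually.of_forall fun _ => inferInstance)
      · haveI : IsProbabilityMeasure ((unif (Fin K₂)).bind fun m₂ => (unif (Fin N)).map fun k => x (((0 : Fin 1), m₂), k)) :=
          isProbabilityMeasure_bind (measurable_of_finite _).aemeasurable (Filter.Eventually.of_forall this)
        haveI : IsProbabilityMeasure (((unif (Fin K₂)).bind fun m₂ => (unif (Fin N)).map fun k => x (((0 : Fin 1), m₂), k)).bind (scK n b₁)) :=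
          isProbabilityMeasure_bind (scK n b₁).measurable.aemeasurable (Filter.Eventually.of_forall fun _ => inferInstance)
        refine le_trans (le_of_eq ?_) (zero_le)
        rw [lintegral_unif]
        simp
    · refine ⟨sqm n b₁ P', inferInstance, ?_⟩
      apply hmul
      have : s₁ = ENNReal.ofReal (1/n) := by rw [hs₁, if_neg hK]
      rw [← this]
      exact le_trans le_add_self htot

lemma scalar_trivial (n : ℕ) (a b₁ b₂ P : ℝ) (hP : 0 ≤ P) (ε : ℝ) : ScalarCode n a b₁ b₂ P 1 1 ε := by
  have hb : ∀ g, IsProbabilityMeasure ((Measure.dirac (0 : Fin n → ℝ)).bind (scK n g)) := fun g =>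
    isProbabilityMeasure_bind (scK n g).measurable.aemeasurable (Filter.Eventually.of_forall fun _ => inferInstance)
  have hu : (unif (Fin 1)).bind (fun _ => Measure.dirac (0 : Fin n → ℝ)) = Measure.dirac (0 : Fin n → ℝ) := by
    rw [Measure.bind_const]; simp
  refine ⟨fun _ => Measure.dirac 0, fun _ => inferInstance, fun _ => ?_, ⟨fun _ => (0, 0), measurable_const, ?_⟩,
    ⟨_, hb b₂, ?_⟩, ⟨_, hb b₁, ?_⟩⟩
  · rw [Measure.dirac_apply' _ (measurableSet_le (by fun_prop) measurable_const)]
    rw [Set.indicator_of_mem]; · rfl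
    simp only [Set.mem_setOf_eq, Pi.zero_apply, ne_eq, OfNat.ofNat_ne_zero, not_false_eq_true, zero_pow, Finset.sum_const_zero]; positivity
  · refine le_trans (le_of_eq ?_) zero_le
    have : ∀ m : Fin 1 × Fin 1, {y : Fin n → ℝ | ((0, 0) : Fin 1 × Fin 1) ≠ m} = ∅ := by
      intro m; ext y; simp; exact Subsingleton.elim _ _
    simp [this]
  · have := hb b₂
    refine le_trans (le_of_eq ?_) zero_le
    simp
  · have := hb b₁
    refine le_trans (le_of_eq ?_) zero_le
    simp [hu]

lemma ceil_exp_le {t : ℝ} (ht : 0 ≤ t) : (⌈Real.exp t⌉₊ : ℝ) ≤ 2 * Real.exp t := by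
  have h1 := Nat.ceil_lt_add_one (Real.exp_pos t).le
  have h2 := Real.one_le_exp ht
  linarith

lemma Cn_nonneg {g P : ℝ} (hg : 0 ≤ g) (hP : 0 ≤ P) : 0 ≤ Cn g P := by
  have : 0 ≤ g * P := mul_nonneg hg hP
  have := Real.log_nonneg (by linarith : 1 ≤ 1 + g * P)
  rw [Cn]; linarith

lemma Cn_tendsto {g P : ℝ} (hg : 0 ≤ g) (hP : 0 ≤ P) : Tendsto (Cn g) (𝓝[<] P) (𝓝 (Cn g P)) := by
  have h : 0 ≤ g * P := mul_nonneg hg hP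
  have : ContinuousAt (Cn g) P := by
    unfold Cn
    exact continuousAt_const.mul (ContinuousAt.log (by fun_prop) (by linarith))
  exact this.tendsto.mono_left nhdsWithin_le_nhds

theorem scalar_code (a b₁ b₂ P : ℝ) (ha : 0 ≤ a) (hb₁ : 0 ≤ b₁) (hb₂ : 0 ≤ b₂) (hP : 0 ≤ P)
    (r₁ r₂ : ℝ) (hr₁ : 0 ≤ r₁) (hr₂ : 0 ≤ r₂)
    (hr : (r₁ = 0 ∧ r₂ = 0) ∨ (r₁ + r₂ < Cn a P - Cn b₂ P ∧ (r₁ = 0 ∨ r₁ < Cn a P - Cn b₁ P)))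
    (ε : ℝ) (hε : 0 < ε) :
    ∃ n₀ : ℕ, ∀ n ≥ n₀, ∃ K₁ K₂ : ℕ, 0 < K₁ ∧ 0 < K₂ ∧ n * r₁ ≤ Real.log K₁ ∧ n * r₂ ≤ Real.log K₂ ∧
      ScalarCode n a b₁ b₂ P K₁ K₂ ε := by
  rcases hr with ⟨h1, h2⟩ | ⟨h2, h1⟩
  · refine ⟨0, fun n _ => ⟨1, 1, one_pos, one_pos, by simp [h1], by simp [h2], scalar_trivial n a b₁ b₂ P hP ε⟩⟩
  have hP0 : 0 < P := by
    rcases hP.eq_or_lt with h | h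
    · subst h
      simp [Cn] at h2
      linarith
    · exact h
  have e2 : ∀ᶠ t in 𝓝[<] P, r₁ + r₂ < Cn a t - Cn b₂ t :=
    ((Cn_tendsto ha hP).sub (Cn_tendsto hb₂ hP)).eventually (lt_mem_nhds h2)
  have e1 : ∀ᶠ t in 𝓝[<] P, r₁ = 0 ∨ r₁ < Cn a t - Cn b₁ t := by
    rcases h1 with h | h
    · exact Eventually.of_forall fun _ => Or.inl h
    · filter_upwards [((Cn_tendsto ha hP).sub (Cn_tendsto hb₁ hP)).eventually (lt_mem_nhds h)] with t ht
      exact Or.inr ht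
  have e0 : ∀ᶠ t in 𝓝[<] P, 0 < t ∧ t < P :=
    (eventually_nhdsWithin_of_eventually_nhds (lt_mem_nhds hP0)).and eventually_mem_nhdsWithin
  obtain ⟨t, ht2, ht1, ht0, htP⟩ := (e2.and (e1.and e0)).exists
  lift t to NNReal using ht0.le
  obtain ⟨δ, hδ, hd2, hd1⟩ : ∃ δ : ℝ, 0 < δ ∧ r₁ + r₂ + 4 * δ ≤ Cn a t - Cn b₂ t ∧
      (r₁ = 0 ∨ r₁ + 4 * δ ≤ Cn a t - Cn b₁ t) := by
    rcases ht1 with h | h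
    · exact ⟨(Cn a t - Cn b₂ t - (r₁ + r₂)) / 4, by linarith, by linarith, Or.inl h⟩
    · refine ⟨min (Cn a t - Cn b₂ t - (r₁ + r₂)) (Cn a t - Cn b₁ t - r₁) / 4, ?_, ?_, Or.inr ?_⟩
      · have := lt_min (sub_pos.2 ht2) (sub_pos.2 h)
        linarith
      · linarith [min_le_left (Cn a t - Cn b₂ t - (r₁ + r₂)) (Cn a t - Cn b₁ t - r₁)]
      · linarith [min_le_right (Cn a t - Cn b₂ t - (r₁ + r₂)) (Cn a t - Cn b₁ t - r₁)]
  obtain ⟨n₁, hn₁⟩ := pow_half t P htP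
  obtain ⟨n₂, hn₂⟩ := eventually_atTop.1 ((totB_tendsto Var[hh a t; rho a t] Var[hh b₁ t; rho b₁ t]
    Var[hh b₂ t; rho b₂ t] δ hδ).eventually (gt_mem_nhds hε))
  refine ⟨max (max n₁ n₂) 1, fun n hn => ?_⟩
  have hna : n₁ ≤ n := le_trans (le_trans (le_max_left _ _) (le_max_left _ _)) hn
  have hnb : n₂ ≤ n := le_trans (le_trans (le_max_right _ _) (le_max_left _ _)) hn
  have hn0 : 0 < n := le_trans (le_max_right _ _) hn
  have hn' : (0:ℝ) < n := by exact_mod_cast hn0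
  have hCb2 : 0 ≤ Cn b₂ t := Cn_nonneg hb₂ t.2
  have hx : ∀ r, Real.exp (n * r) ≤ (⌈Real.exp (n * r)⌉₊ : ℝ) := fun r => Nat.le_ceil _
  have hpos : ∀ r, 0 < ⌈Real.exp (n * r)⌉₊ := fun r => Nat.ceil_pos.2 (Real.exp_pos _)
  have hlog : ∀ r, n * r ≤ Real.log (⌈Real.exp (n * r)⌉₊ : ℝ) := fun r => by
    rw [Real.le_log_iff_exp_le (by exact_mod_cast hpos r)]; exact hx r
  set rN := Cn a t - 3 * δ - r₁ - r₂ with hrN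
  refine ⟨⌈Real.exp (n * r₁)⌉₊, ⌈Real.exp (n * r₂)⌉₊, hpos _, hpos _, hlog _, hlog _, ?_⟩
  refine scalar_core hn0 t P a b₁ b₂ ha hb₁ hb₂ (hn₁ n hna) δ hδ _ _ ⌈Real.exp (n * rN)⌉₊ (hpos _) (hpos _) (hpos _)
    ?_ ?_ ?_ ε (hn₂ n hnb).le
  · refine le_trans (Real.exp_le_exp.2 ?_) (hx _)
    exact mul_le_mul_of_nonneg_left (by rw [hrN]; linarith) hn'.le
  · rcases hd1 with h | h
    · left; simp [h]
    · right
      refine le_trans ?_ (mul_le_mul (hx _) (hx _) (Real.exp_pos _).le (Nat.cast_nonneg _))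
      rw [← Real.exp_add, ← mul_add]
      exact Real.exp_le_exp.2 (mul_le_mul_of_nonneg_left (by rw [hrN]; linarith) hn'.le)
  · have k1 := ceil_exp_le (mul_nonneg hn'.le hr₁)
    have k2 := ceil_exp_le (mul_nonneg hn'.le hr₂)
    have k3 := ceil_exp_le (mul_nonneg hn'.le (show 0 ≤ rN by rw [hrN]; linarith))
    calc _ ≤ (2 * Real.exp (n * r₁)) * (2 * Real.exp (n * r₂)) * (2 * Real.exp (n * rN)) := by gcongr
      _ = 8 * (Real.exp (n * r₁) * Real.exp (n * r₂) * Real.exp (n * rN)) := by ring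
      _ = _ := by rw [← Real.exp_add, ← Real.exp_add, hrN]; congr 2; ring

end ScalarCode


section Combine
open InformationTheory

/-- Transposition of real arrays. -/
def trE (n L : ℕ) : (Fin L → Fin n → ℝ) ≃ᵐ (Fin n → Fin L → ℝ) where
  toEquiv := Equiv.piComm _
  measurable_toFun := measurable_pi_iff.2 fun i => measurable_pi_iff.2 fun l =>
    (measurable_pi_apply i).comp (measurable_pi_apply l)
  measurable_invFun := measurable_pi_iff.2 fun i => measurable_pi_iff.2 fun l =>
    (measurable_pi_apply i).comp (measurable_pi_apply l)

lemma trE_apply (n L : ℕ) (x : Fin L → Fin n → ℝ) (i : Fin n) (l : Fin L) : trE n L x i l = x l i := rfl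
lemma trE_symm_apply (n L : ℕ) (x : Fin n → Fin L → ℝ) (i : Fin n) (l : Fin L) :
    (trE n L).symm x l i = x i l := rfl

lemma pi_trans (n L : ℕ) (μ : Fin n → Fin L → Measure ℝ) [∀ i l, IsProbabilityMeasure (μ i l)] :
    (Measure.pi fun i => Measure.pi fun l => μ i l) =
      (Measure.pi fun l => Measure.pi fun i => μ i l).map (trE n L) := by
  refine Measure.pi_eq_generateFrom
    (C := fun _ => Set.pi Set.univ '' Set.pi Set.univ fun _ => {s : Set ℝ | MeasurableSet s})
    (fun i => generateFrom_pi) (fun i => isPiSystem_pi)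
    (fun i => ⟨fun _ => Set.univ, fun _ => ⟨fun _ => Set.univ, by simp, by simp⟩, fun _ => by simp, by
      simp [Set.iUnion_const]⟩) ?_
  intro s hs
  choose t ht hts using hs
  have hs' : s = fun i => Set.pi Set.univ (t i) := funext fun i => (hts i).symm
  subst hs'
  rw [MeasurableEquiv.map_apply]
  have hpre : trE n L ⁻¹' (Set.pi Set.univ fun i => Set.pi Set.univ (t i)) =
      Set.pi Set.univ fun l => Set.pi Set.univ fun i => t i l := by
    ext x
    simp only [Set.mem_preimage, Set.mem_pi, Set.mem_univ, forall_true_left, trE_apply]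
    exact forall_comm
  rw [hpre]
  simp only [Measure.pi_pi]
  exact Finset.prod_comm

lemma parOut_trE (n L : ℕ) (g : Fin L → ℝ) (x : Fin L → Fin n → ℝ) :
    parOut g (trE n L x) = (Measure.pi fun l => scK n (g l) (x l)).map (trE n L) := by
  rw [parOut]
  simp only [scK_apply, trE_apply]
  exact pi_trans n L fun i l => gaussianReal (Real.sqrt (g l) * x l i) 1

instance bind_prob (n : ℕ) (g : ℝ) (μ : Measure (Fin n → ℝ)) [IsProbabilityMeasure μ] :
    IsProbabilityMeasure (μ.bind (scK n g)) :=
  isProbabilityMeasure_bind (scK n g).measurable.aemeasurable (Filter.Eventually.of_forall fun _ => inferInstance)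

lemma bind_parK (n L : ℕ) (g : Fin L → ℝ) (μ : Fin L → Measure (Fin n → ℝ)) [∀ l, IsProbabilityMeasure (μ l)] :
    ((Measure.pi μ).map (trE n L)).bind (parK n g) =
      (Measure.pi fun l => (μ l).bind (scK n (g l))).map (trE n L) := by
  rw [← pi_bind_pi μ (fun l => scK n (g l)) (fun l => (scK n (g l)).measurable)]
  have hm : Measurable fun x : Fin L → Fin n → ℝ => Measure.pi fun l => scK n (g l) (x l) :=
    measurable_pi_measure (fun l (x : Fin L → Fin n → ℝ) => scK n (g l) (x l))
      fun l => (scK n (g l)).measurable.comp (measurable_pi_apply l)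
  ext s hs
  rw [Measure.bind_apply hs (parK n g).measurable.aemeasurable,
    lintegral_map ((parK n g).measurable_coe hs) (trE n L).measurable, MeasurableEquiv.map_apply,
    Measure.bind_apply ((trE n L).measurable hs) hm.aemeasurable]
  refine lintegral_congr fun x => ?_
  rw [parK_apply, parOut_trE, MeasurableEquiv.map_apply]

lemma unif_map_pi {L : ℕ} {M : Type} [Fintype M] [MeasurableSpace M] [MeasurableSingletonClass M]
    {N : Fin L → Type} [∀ l, Fintype (N l)] [∀ l, Nonempty (N l)] [∀ l, MeasurableSpace (N l)]
    [∀ l, MeasurableSingletonClass (N l)] (φ : M ≃ ∀ l, N l) :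
    (unif M).map φ = Measure.pi fun l => unif (N l) := by
  classical
  refine Measure.ext_of_singleton fun f => ?_
  rw [Measure.map_apply (measurable_of_finite _) (measurableSet_singleton _), Measure.pi_singleton]
  have : φ ⁻¹' {f} = {φ.symm f} := by
    ext m; simp [Equiv.eq_symm_apply]
  rw [this]
  simp only [unif_singleton]
  rw [Fintype.card_congr φ, Fintype.card_pi, Nat.cast_prod]
  exact ENNReal.prod_inv_distrib (fun i _ j _ _ => Or.inr (by simp))

lemma avg_pi {L : ℕ} {M : Type} [Fintype M] [MeasurableSpace M] [MeasurableSingletonClass M]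
    {N : Fin L → Type} [∀ l, Fintype (N l)] [∀ l, Nonempty (N l)] [∀ l, MeasurableSpace (N l)]
    [∀ l, MeasurableSingletonClass (N l)] (φ : M ≃ ∀ l, N l) (g : ∀ l, N l → ℝ≥0∞) :
    ∫⁻ m, ∑ l, g l (φ m l) ∂(unif M) = ∑ l, ∫⁻ k, g l k ∂(unif (N l)) := by
  rw [lintegral_finsetSum _ fun l _ => measurable_of_finite _]
  refine Finset.sum_congr rfl fun l _ => ?_
  rw [← lintegral_map (f := fun f : ∀ l, N l => g l (f l)) (g := φ) (measurable_of_finite _) (measurable_of_finite _),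
    unif_map_pi φ]
  exact (measurePreserving_eval (fun l => unif (N l)) l).lintegral_comp (measurable_of_finite _)

lemma kl_comb (n L : ℕ) (ν Q : Fin L → Measure (Fin n → ℝ)) [∀ l, IsProbabilityMeasure (ν l)]
    [∀ l, IsProbabilityMeasure (Q l)] :
    klDiv ((Measure.pi ν).map (trE n L)) ((Measure.pi Q).map (trE n L)) = ∑ l, klDiv (ν l) (Q l) := by
  rw [klDiv_map_equiv, klDiv_pi_fin]

/-- bound on the mutual information in bits from average divergences -/
lemma miBits_le {n L : ℕ} {M : Type} [Fintype M] [MeasurableSpace M] [MeasurableSingletonClass M]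
    {N : Fin L → Type} [∀ l, Fintype (N l)] [∀ l, Nonempty (N l)] [∀ l, MeasurableSpace (N l)]
    [∀ l, MeasurableSingletonClass (N l)] (φ : M ≃ ∀ l, N l) [Nonempty M] [StandardBorelSpace M]
    (κ : Kernel M (Fin n → Fin L → ℝ)) [IsMarkovKernel κ]
    (ν : ∀ l, N l → Measure (Fin n → ℝ)) [∀ l k, IsProbabilityMeasure (ν l k)]
    (hκ : ∀ m, κ m = (Measure.pi fun l => ν l (φ m l)).map (trE n L))
    (Q : Fin L → Measure (Fin n → ℝ)) [∀ l, IsProbabilityMeasure (Q l)] (t : ℝ) (ht : 0 ≤ t)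
    (hQ : ∀ l, ∫⁻ k, klDiv (ν l k) (Q l) ∂(unif (N l)) ≤ ENNReal.ofReal t) :
    miBits (unif M ⊗ₘ κ) ≤ L * t / Real.log 2 := by
  rw [miBits_compProd_unif]
  have hl : 0 < Real.log 2 := Real.log_pos (by norm_num)
  haveI : IsProbabilityMeasure ((Measure.pi Q).map (trE n L)) :=
    Measure.isProbabilityMeasure_map (trE n L).measurable.aemeasurable
  gcongr
  refine ENNReal.toReal_le_of_le_ofReal (by positivity) ?_
  refine (mi_le_avg κ ((Measure.pi Q).map (trE n L))).trans ?_
  simp only [hκ, kl_comb]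
  rw [avg_pi φ (fun l k => klDiv (ν l k) (Q l))]
  refine (Finset.sum_le_sum fun l _ => hQ l).trans ?_
  rw [Finset.sum_const, Finset.card_univ, Fintype.card_fin, nsmul_eq_mul, ENNReal.ofReal_mul (Nat.cast_nonneg _),
    ENNReal.ofReal_natCast]

end Combine


section Final
open InformationTheory

lemma combine {L n : ℕ} (hn : 0 < n) (a b₁ b₂ P : Fin L → ℝ) (K₁ K₂ : Fin L → ℕ) (hK₁ : ∀ l, 0 < K₁ l)
    (hK₂ : ∀ l, 0 < K₂ l) (ε ε' : ℝ) (hε' : 0 ≤ ε') (hε : L * ε' ≤ ε) (hε2 : L * ε' / Real.log 2 ≤ ε)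
    (H : ∀ l, ScalarCode n (a l) (b₁ l) (b₂ l) (P l) (K₁ l) (K₂ l) ε') :
    ∃ enc : Fin (∏ l, K₁ l) × Fin (∏ l, K₂ l) → Measure (Fin n → Fin L → ℝ),
      (∀ m, IsProbabilityMeasure (enc m)) ∧ (∀ m, enc m (perSubPow L P n) = 1) ∧
      ∃ dec : (Fin n → Fin L → ℝ) → Fin (∏ l, K₁ l) × Fin (∏ l, K₂ l), Measurable dec ∧
        (jointLawPar a enc {p | dec p.2 ≠ p.1}).toReal ≤ ε ∧
        miBits (jointLawPar b₂ enc) ≤ n * ε ∧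
        miBits ((jointLawPar b₁ enc).map fun p => (p.1.1, p.2)) ≤ n * ε := by
  choose enc hp hpow hdec hQ₂ hQ₁ using H
  choose dec hdm hde using hdec
  choose Q₂ hQ₂p hQ₂ using hQ₂
  choose Q₁ hQ₁p hQ₁ using hQ₁
  have hn' : (0:ℝ) < n := by exact_mod_cast hn
  have hpr₁ : 0 < ∏ l, K₁ l := Finset.prod_pos fun l _ => hK₁ l
  have hpr₂ : 0 < ∏ l, K₂ l := Finset.prod_pos fun l _ => hK₂ l
  haveI : ∀ l, Nonempty (Fin (K₁ l)) := fun l => ⟨⟨0, hK₁ l⟩⟩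
  haveI : ∀ l, Nonempty (Fin (K₂ l)) := fun l => ⟨⟨0, hK₂ l⟩⟩
  haveI : Nonempty (Fin (∏ l, K₁ l)) := ⟨⟨0, hpr₁⟩⟩
  haveI : Nonempty (Fin (∏ l, K₂ l)) := ⟨⟨0, hpr₂⟩⟩
  let e₁ : Fin (∏ l, K₁ l) ≃ ∀ l, Fin (K₁ l) := finPiFinEquiv.symm
  let e₂ : Fin (∏ l, K₂ l) ≃ ∀ l, Fin (K₂ l) := finPiFinEquiv.symm
  let φ : Fin (∏ l, K₁ l) × Fin (∏ l, K₂ l) ≃ ∀ l, Fin (K₁ l) × Fin (K₂ l) :=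
    (e₁.prodCongr e₂).trans (Equiv.arrowProdEquivProdArrow _ _ _).symm
  have hφ : ∀ m₁ m₂ l, φ (m₁, m₂) l = (e₁ m₁ l, e₂ m₂ l) := fun _ _ _ => rfl
  clear_value φ e₁ e₂
  let E : Fin (∏ l, K₁ l) × Fin (∏ l, K₂ l) → Measure (Fin n → Fin L → ℝ) := fun m =>
    (Measure.pi fun l => enc l (φ m l)).map (trE n L)
  have hE : ∀ m, IsProbabilityMeasure (E m) := fun m =>
    Measure.isProbabilityMeasure_map (trE n L).measurable.aemeasurable
  have hκ : ∀ g m, (parK n g ∘ₖ fk E) m = (Measure.pi fun l => (enc l (φ m l)).bind (scK n (g l))).map (trE n L) := by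
    intro g m
    rw [Kernel.comp_apply, fk_apply]
    exact bind_parK n L g _
  have hdm' : Measurable fun y : Fin n → Fin L → ℝ => φ.symm fun l => dec l ((trE n L).symm y l) := by
    refine (measurable_of_finite _).comp (measurable_pi_iff.2 fun l => (hdm l).comp ?_)
    exact (measurable_pi_apply l).comp (trE n L).symm.measurable
  refine ⟨E, hE, ?_, fun y => φ.symm fun l => dec l ((trE n L).symm y l), hdm', ?_, ?_, ?_⟩
  · intro m
    have : trE n L ⁻¹' (perSubPow L P n) = Set.pi Set.univ fun l => {x : Fin n → ℝ | ∑ i, x i ^ 2 ≤ n * P l} := by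
      ext x; simp [perSubPow, trE_apply]
    simp only [E]
    rw [MeasurableEquiv.map_apply, this, Measure.pi_pi]
    simp [hpow]
  · rw [jointLawPar_eq]
    have hS : MeasurableSet {p : (Fin (∏ l, K₁ l) × Fin (∏ l, K₂ l)) × (Fin n → Fin L → ℝ) |
        (φ.symm fun l => dec l ((trE n L).symm p.2 l)) ≠ p.1} :=
      (measurableSet_eq_fun (hdm'.comp measurable_snd) measurable_fst).compl
    rw [Measure.compProd_apply hS]
    refine ENNReal.toReal_le_of_le_ofReal (le_trans (by positivity) hε) ?_
    have hb : ∀ m, (parK n a ∘ₖ fk E) m (Prod.mk m ⁻¹' {p : (Fin (∏ l, K₁ l) × Fin (∏ l, K₂ l)) × (Fin n → Fin L → ℝ) |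
        (φ.symm fun l => dec l ((trE n L).symm p.2 l)) ≠ p.1}) ≤
        ∑ l, ((enc l (φ m l)).bind (scK n (a l))) {y | dec l y ≠ φ m l} := by
      intro m
      rw [hκ, MeasurableEquiv.map_apply]
      have hsub : trE n L ⁻¹' (Prod.mk m ⁻¹' {p : (Fin (∏ l, K₁ l) × Fin (∏ l, K₂ l)) × (Fin n → Fin L → ℝ) |
        (φ.symm fun l => dec l ((trE n L).symm p.2 l)) ≠ p.1}) ⊆
          ⋃ l, (Function.eval l) ⁻¹' {y | dec l y ≠ φ m l} := by
        intro x hx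
        simp only [Set.mem_preimage, Set.mem_setOf_eq, MeasurableEquiv.symm_apply_apply] at hx
        rw [Ne, Equiv.symm_apply_eq, funext_iff] at hx
        push Not at hx
        obtain ⟨l, hl⟩ := hx
        exact Set.mem_iUnion.2 ⟨l, hl⟩
      refine (measure_mono hsub).trans ((measure_iUnion_fintype_le _ _).trans (Finset.sum_le_sum fun l _ => le_of_eq ?_))
      exact (measurePreserving_eval (fun l => (enc l (φ m l)).bind (scK n (a l))) l).measure_preimage
        ((measurableSet_eq_fun (hdm l) measurable_const).compl).nullMeasurableSet
    refine (lintegral_mono hb).trans ?_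
    rw [avg_pi φ (fun l k => ((enc l k).bind (scK n (a l))) {y | dec l y ≠ k})]
    refine (Finset.sum_le_sum fun l _ => hde l).trans ?_
    rw [Finset.sum_const, Finset.card_univ, Fintype.card_fin, nsmul_eq_mul, ← ENNReal.ofReal_natCast,
      ← ENNReal.ofReal_mul (Nat.cast_nonneg _)]
    exact ENNReal.ofReal_le_ofReal hε
  · rw [jointLawPar_eq]
    refine (miBits_le φ (parK n b₂ ∘ₖ fk E) (fun l k => (enc l k).bind (scK n (b₂ l))) (hκ b₂) Q₂ (n * ε')
      (by positivity) hQ₂).trans ?_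
    calc L * (n * ε') / Real.log 2 = n * (L * ε' / Real.log 2) := by ring
      _ ≤ _ := by gcongr
  · rw [jointLawPar_map_eq hpr₂]
    have hm : ∀ m₁, (unif (Fin (∏ l, K₂ l))).bind (fun m₂ => E (m₁, m₂)) =
        (Measure.pi fun l => (unif (Fin (K₂ l))).bind fun k => enc l (e₁ m₁ l, k)).map (trE n L) := by
      intro m₁
      rw [← pi_bind_pi (fun l => unif (Fin (K₂ l))) (fun l k => enc l (e₁ m₁ l, k)) (fun l => measurable_of_finite _),
        ← unif_map_pi e₂]
      ext s hs
      rw [Measure.bind_apply hs (measurable_of_finite _).aemeasurable, MeasurableEquiv.map_apply,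
        Measure.bind_apply ((trE n L).measurable hs) (measurable_of_finite _).aemeasurable,
        lintegral_map (measurable_of_finite _) (measurable_of_finite _)]
      refine lintegral_congr fun m₂ => ?_
      simp only [E, hφ]
      rw [MeasurableEquiv.map_apply]
    haveI hpb : ∀ l (k : Fin (K₁ l)), IsProbabilityMeasure ((unif (Fin (K₂ l))).bind fun k₂ => enc l (k, k₂)) := fun l k =>
      isProbabilityMeasure_bind (measurable_of_finite _).aemeasurable (Filter.Eventually.of_forall fun z => inferInstance)
    haveI : ∀ m₁, IsProbabilityMeasure ((unif (Fin (∏ l, K₂ l))).bind (fun m₂ => E (m₁, m₂))) := fun m₁ =>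
      isProbabilityMeasure_bind (measurable_of_finite _).aemeasurable (Filter.Eventually.of_forall fun z => inferInstance)
    refine (miBits_le e₁ (parK n b₁ ∘ₖ fk fun m₁ => (unif (Fin (∏ l, K₂ l))).bind (fun m₂ => E (m₁, m₂)))
      (fun l k => ((unif (Fin (K₂ l))).bind fun k₂ => enc l (k, k₂)).bind (scK n (b₁ l))) ?_ Q₁ (n * ε')
      (by positivity) hQ₁).trans ?_
    · intro m₁
      rw [Kernel.comp_apply, fk_apply, hm]
      exact bind_parK n L b₁ _
    calc L * (n * ε') / Real.log 2 = n * (L * ε' / Real.log 2) := by ring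
      _ ≤ _ := by gcongr

lemma Cs_eq (P a b : ℝ) : Cs P a b = max 0 ((Cn a P - Cn b P) / Real.log 2) := by
  rw [Cs, Cn, Cn, Real.logb, Real.logb]
  congr 1; ring

lemma rate_split {L : ℕ} (α β : Fin L → ℝ) (hα : ∀ l, 0 ≤ α l) (hαβ : ∀ l, α l ≤ β l) (R₁ R₂ : ℝ) (hR₁ : 0 ≤ R₁)
    (hR₂ : 0 ≤ R₂) (h₁ : R₁ ≤ ∑ l, α l) (h₂ : R₁ + R₂ ≤ ∑ l, β l) :
    ∃ x y : Fin L → ℝ, (∀ l, 0 ≤ x l ∧ x l ≤ α l ∧ 0 ≤ y l ∧ x l + y l ≤ β l) ∧ ∑ l, x l = R₁ ∧ ∑ l, y l = R₂ := by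
  have key : ∀ (γ : Fin L → ℝ), (∀ l, 0 ≤ γ l) → ∀ R, 0 ≤ R → R ≤ ∑ l, γ l →
      ∃ x : Fin L → ℝ, (∀ l, 0 ≤ x l ∧ x l ≤ γ l) ∧ ∑ l, x l = R := by
    intro γ hγ R hR hle
    rcases hR.eq_or_lt with h | h
    · exact ⟨0, fun l => ⟨le_rfl, hγ l⟩, by rw [← h]; simp⟩
    have hS : 0 < ∑ l, γ l := h.trans_le hle
    have hq : R / ∑ l, γ l ≤ 1 := (div_le_one hS).2 hle
    refine ⟨fun l => R / (∑ l, γ l) * γ l, fun l => ⟨mul_nonneg (by positivity) (hγ l), ?_⟩, ?_⟩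
    · exact mul_le_of_le_one_left (hγ l) hq
    · rw [← Finset.mul_sum, div_mul_cancel₀ _ hS.ne']
  obtain ⟨x, hx, hxs⟩ := key α hα R₁ hR₁ h₁
  obtain ⟨y, hy, hys⟩ := key (fun l => β l - x l) (fun l => by linarith [hx l, hαβ l]) R₂ hR₂ (by
    rw [Finset.sum_sub_distrib, hxs]; linarith)
  exact ⟨x, y, fun l => ⟨(hx l).1, (hx l).2, (hy l).1, by linarith [(hy l).2]⟩, hxs, hys⟩

theorem achiev_part (L : ℕ) (a b₁ b₂ P : Fin L → ℝ) (ha : ∀ l, 0 ≤ a l) (hb₁₂ : ∀ l, b₁ l ≥ b₂ l)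
    (hb₂ : ∀ l, b₂ l ≥ 0) (hP : ∀ l, 0 ≤ P l) (R₁ R₂ : ℝ) (hR₁ : 0 ≤ R₁) (hR₂ : 0 ≤ R₂)
    (h₁ : R₁ ≤ ∑ l, Cs (P l) (a l) (b₁ l)) (h₂ : R₁ + R₂ ≤ ∑ l, Cs (P l) (a l) (b₂ l)) :
    ParAchievable L a b₁ b₂ (perSubPow L P) R₁ R₂ := by
  intro ε hε
  have hl : 0 < Real.log 2 := Real.log_pos (by norm_num)
  have hb₁ : ∀ l, 0 ≤ b₁ l := fun l => (hb₂ l).trans (hb₁₂ l)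
  obtain ⟨x, y, hxy, hx, hy⟩ := rate_split (fun l => Cs (P l) (a l) (b₁ l)) (fun l => Cs (P l) (a l) (b₂ l))
    (fun l => le_max_left _ _) (fun l => by
      simp only [Cs_eq]
      refine max_le_max le_rfl ?_
      gcongr
      rw [Cn, Cn]
      have h0 : 0 ≤ b₂ l * P l := mul_nonneg (hb₂ l) (hP l)
      have h1 : b₂ l * P l ≤ b₁ l * P l := mul_le_mul_of_nonneg_right (hb₁₂ l) (hP l)
      gcongr) R₁ R₂ hR₁ hR₂ h₁ h₂
  set η := ε / (R₁ + R₂ + ε) with hη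
  have hD : 0 < R₁ + R₂ + ε := by linarith
  have hη0 : 0 < η := by positivity
  have hη1 : η ≤ 1 := (div_le_one hD).2 (by linarith)
  have hηD : η * (R₁ + R₂ + ε) = ε := div_mul_cancel₀ _ hD.ne'
  have hηR₁ : η * R₁ ≤ ε := by nlinarith [mul_nonneg hη0.le hR₂, mul_pos hη0 hε]
  have hηR₂ : η * R₂ ≤ ε := by nlinarith [mul_nonneg hη0.le hR₁, mul_pos hη0 hε]
  set ε' := min ε (ε * Real.log 2) / (L + 1) with hε'
  have hmin : 0 < min ε (ε * Real.log 2) := lt_min hε (by positivity)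
  have hε'0 : 0 < ε' := by positivity
  have hLε : L * ε' ≤ min ε (ε * Real.log 2) := by
    have : (L + 1) * ε' = min ε (ε * Real.log 2) := by rw [hε']; field_simp
    linarith
  have hsc := fun l => scalar_code (a l) (b₁ l) (b₂ l) (P l) (ha l) (hb₁ l) (hb₂ l) (hP l)
    ((1 - η) * x l * Real.log 2) ((1 - η) * y l * Real.log 2)
    (mul_nonneg (mul_nonneg (by linarith) (hxy l).1) hl.le)
    (mul_nonneg (mul_nonneg (by linarith) (hxy l).2.2.1) hl.le) (by
      obtain ⟨hx0, hxa, hy0, hxyb⟩ := hxy l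
      have hst : ∀ t u : ℝ, 0 ≤ t → t ≤ max 0 (u / Real.log 2) →
          t = 0 ∨ (1 - η) * t * Real.log 2 < u := by
        intro t u ht0 htu
        rcases ht0.eq_or_lt with h | h
        · exact Or.inl h.symm
        · right
          have : t ≤ u / Real.log 2 := (le_max_iff.1 htu).resolve_left (by linarith)
          rw [le_div_iff₀ hl] at this
          nlinarith [mul_pos (mul_pos hη0 h) hl]
      rw [Cs_eq] at hxa hxyb
      rcases hst _ _ (add_nonneg hx0 hy0) hxyb with h | h
      · left
        have h1 : x l = 0 := by linarith
        have h2 : y l = 0 := by linarith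
        simp [h1, h2]
      · right
        refine ⟨by linarith, ?_⟩
        rcases hst _ _ hx0 hxa with h' | h'
        · left; simp [h']
        · right; exact h') ε' hε'0
  choose n₀ hn₀ using hsc
  set n := (∑ l, n₀ l) + 1 with hn
  have hnl : ∀ l, n₀ l ≤ n := fun l =>
    (Finset.single_le_sum (f := n₀) (fun _ _ => Nat.zero_le _) (Finset.mem_univ l)).trans (Nat.le_succ _)
  choose K₁ K₂ hK₁ hK₂ hr₁ hr₂ hS using fun l => hn₀ l n (hnl l)
  have hn0 : 0 < n := Nat.succ_pos _
  clear_value n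
  have hn' : (0:ℝ) < n := by exact_mod_cast hn0
  have hrate : ∀ (K : Fin L → ℕ) (z : Fin L → ℝ) (R : ℝ), (∀ l, 0 < K l) → ∑ l, z l = R → η * R ≤ ε →
      (∀ l, n * ((1 - η) * z l * Real.log 2) ≤ Real.log (K l)) →
      (n:ℝ) * (R - ε) ≤ Real.logb 2 (∏ l, K l : ℕ) := by
    intro K z R hK hz hR hle
    rw [Real.logb, le_div_iff₀ hl, Nat.cast_prod, Real.log_prod (fun l _ => by
      have := hK l; positivity)]
    refine le_trans ?_ (Finset.sum_le_sum fun l _ => hle l)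
    rw [← Finset.mul_sum, ← Finset.sum_mul, ← Finset.mul_sum, hz, mul_assoc]
    gcongr
    linarith
  refine ⟨n, hn0, ∏ l, K₁ l, ∏ l, K₂ l, Finset.prod_pos fun l _ => hK₁ l, Finset.prod_pos fun l _ => hK₂ l,
    hrate K₁ x R₁ hK₁ hx hηR₁ hr₁, hrate K₂ y R₂ hK₂ hy hηR₂ hr₂, ?_⟩
  exact combine hn0 a b₁ b₂ P K₁ K₂ hK₁ hK₂ ε ε' hε'0.le (hLε.trans (min_le_left _ _))
    (by rw [div_le_iff₀ hl]; exact hLε.trans (min_le_right _ _)) hS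

end Final

/-- the secrecy capacity region of the independent parallel Gaussian
two-level security wiretap channel under the average individual per-subchannel power
constraints `P l` is exactly the set of nonnegative pairs with
`R₁ ≤ ∑ l, Cs(P l, a l, b₁ l)` and `R₁ + R₂ ≤ ∑ l, Cs(P l, a l, b₂ l)`. -/
theorem stmt8_parallel_gaussian_capacity_region (L : ℕ) (a b₁ b₂ P : Fin L → ℝ)
    (ha : ∀ l, 0 ≤ a l) (hb₁₂ : ∀ l, b₁ l ≥ b₂ l) (hb₂ : ∀ l, b₂ l ≥ 0)
    (hP : ∀ l, 0 ≤ P l) (R₁ R₂ : ℝ) (hR₁ : 0 ≤ R₁) (hR₂ : 0 ≤ R₂) :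
    ParAchievable L a b₁ b₂ (perSubPow L P) R₁ R₂ ↔
      R₁ ≤ ∑ l, Cs (P l) (a l) (b₁ l) ∧ R₁ + R₂ ≤ ∑ l, Cs (P l) (a l) (b₂ l) := by
  
  constructor
  · intro H
    exact converse_part L a b₁ b₂ P ha (fun l => le_trans (hb₂ l) (hb₁₂ l)) hb₂ hP R₁ R₂ H
  · rintro ⟨h₁, h₂⟩
    exact achiev_part L a b₁ b₂ P ha hb₁₂ hb₂ hP R₁ R₂ hR₁ hR₂ h₁ h₂
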